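/- Let n ≥ 4 and let ρ be an injective group endomorphism of the braid group B_n. Then there exist an element c ∈ B_n, e ∈ {0,1}, and an integer t such that ρ(g) = c·χ^e(g)·c^{−1}·z^{t·ℓ(g)} for all g ∈ B_n. (This is the algebraic form of the statement that ρ is induced by a homeomorphism h of the n-punctured disk, with ρ(H_a) = H_{h(a)}^{ε(h)}·z^t for every half-twist H_a.) -/

import Mathlib

/-- Relators for the braid group with generators `σ_0, …, σ_{m-1}`:
the braid relations `σ_i σ_j σ_i = σ_j σ_i σ_j` for `j = i+1`, and the
commutation relations `σ_i σ_j = σ_j σ_i` for `j ≥ i+2`. -/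
def braidRels (m : ℕ) : Set (FreeGroup (Fin m)) :=
  { r | ∃ i j : Fin m,
      ((i : ℕ) + 1 = (j : ℕ) ∧
        r = FreeGroup.of i * FreeGroup.of j * FreeGroup.of i *
            (FreeGroup.of j * FreeGroup.of i * FreeGroup.of j)⁻¹) ∨
      ((i : ℕ) + 2 ≤ (j : ℕ) ∧
        r = FreeGroup.of i * FreeGroup.of j * (FreeGroup.of j * FreeGroup.of i)⁻¹) }

/-- The braid group on `n` strands: the presented group with generators
`σ_1, …, σ_{n-1}` (indexed by `Fin (n-1)`) and the braid relators. -/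
abbrev BraidGroup (n : ℕ) : Type := PresentedGroup (braidRels (n - 1))

/-- The standard generator `σ_{i+1}` of the braid group (0-indexed). -/
def braidσ (n : ℕ) (i : Fin (n - 1)) : BraidGroup n := PresentedGroup.of i

/-- The element `δ = σ_1 σ_2 ⋯ σ_{n-1}` of the braid group. -/
def braidδ (n : ℕ) : BraidGroup n := (List.ofFn (braidσ n)).prod

/-- The full twist `z = (σ_1 σ_2 ⋯ σ_{n-1})^n`. -/
def fullTwist (n : ℕ) : BraidGroup n := braidδ n ^ n

set_option linter.unusedSimpArgs false

namespace Braid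

abbrev Br (m : ℕ) : Type := PresentedGroup (braidRels m)

/-- The Artin generator `σ_i`, extended by `1` to all natural indices. -/
def sg (m i : ℕ) : Br m := if h : i < m then PresentedGroup.of ⟨i, h⟩ else 1

structure IsBraid {G : Type*} [Group G] (m : ℕ) (t : ℕ → G) : Prop where
  braid : ∀ i, i + 1 < m → t i * t (i + 1) * t i = t (i + 1) * t i * t (i + 1)
  comm : ∀ i j, i + 2 ≤ j → j < m → t i * t j = t j * t i

theorem sg_of_lt {m i : ℕ} (h : i < m) : sg m i = PresentedGroup.of ⟨i, h⟩ := by simp [sg, h]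

theorem isBraid_sg (m : ℕ) : IsBraid m (sg m) where
  braid i hi := by
    have h1 : i < m := by omega
    rw [sg_of_lt h1, sg_of_lt hi]
    have := PresentedGroup.mk_eq_one_iff.2 (Subgroup.subset_normalClosure
      (show FreeGroup.of ⟨i, h1⟩ * FreeGroup.of ⟨i + 1, hi⟩ * FreeGroup.of ⟨i, h1⟩ *
        (FreeGroup.of ⟨i + 1, hi⟩ * FreeGroup.of ⟨i, h1⟩ * FreeGroup.of ⟨i + 1, hi⟩)⁻¹ ∈ braidRels m
        from ⟨⟨i, h1⟩, ⟨i + 1, hi⟩, Or.inl ⟨rfl, rfl⟩⟩))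
    rw [map_mul, map_inv, mul_inv_eq_one] at this
    simp only [map_mul] at this
    exact this
  comm i j hij hj := by
    have h1 : i < m := by omega
    rw [sg_of_lt h1, sg_of_lt hj]
    have := PresentedGroup.mk_eq_one_iff.2 (Subgroup.subset_normalClosure
      (show FreeGroup.of ⟨i, h1⟩ * FreeGroup.of ⟨j, hj⟩ *
        (FreeGroup.of ⟨j, hj⟩ * FreeGroup.of ⟨i, h1⟩)⁻¹ ∈ braidRels m
        from ⟨⟨i, h1⟩, ⟨j, hj⟩, Or.inr ⟨hij, rfl⟩⟩))
    rw [map_mul, map_inv, mul_inv_eq_one] at this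
    simp only [map_mul] at this
    exact this

theorem IsBraid.map {G H : Type*} [Group G] [Group H] {m : ℕ} {t : ℕ → G} (h : IsBraid m t)
    (f : G →* H) : IsBraid m (fun i => f (t i)) where
  braid i hi := by simpa using congrArg f (h.braid i hi)
  comm i j hij hj := by simpa using congrArg f (h.comm i j hij hj)

theorem IsBraid.mono {G : Type*} [Group G] {m k : ℕ} {t : ℕ → G} (h : IsBraid m t) (hk : k ≤ m) :
    IsBraid k t where
  braid i hi := h.braid i (by omega)
  comm i j hij hj := h.comm i j hij (by omega)

section lift
variable {G : Type*} [Group G] {m : ℕ}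

def lift (t : ℕ → G) (h : IsBraid m t) : Br m →* G :=
  PresentedGroup.toGroup (f := fun i : Fin m => t i) (by
    rintro r ⟨i, j, ⟨hij, rfl⟩ | ⟨hij, rfl⟩⟩
    · have := h.braid i (by omega)
      rw [hij] at this
      simp [this]
    · have := h.comm i j (by omega) j.2
      simp [this])

theorem lift_sg {t : ℕ → G} (h : IsBraid m t) {i : ℕ} (hi : i < m) : lift t h (sg m i) = t i := by
  rw [sg_of_lt hi]; exact PresentedGroup.toGroup.of _

theorem hom_ext {M : Type*} [Monoid M] {f g : Br m →* M} (h : ∀ i < m, f (sg m i) = g (sg m i)) :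
    f = g := by
  have hf : f.comp (PresentedGroup.mk (braidRels m)) = g.comp (PresentedGroup.mk (braidRels m)) := by
    ext i
    have := h i i.2
    rwa [sg_of_lt i.2] at this
  ext x
  obtain ⟨y, rfl⟩ := PresentedGroup.mk_surjective _ x
  exact DFunLike.congr_fun hf y

theorem hom_congr {M : Type*} [Monoid M] {f g : Br m →* M} (h : ∀ i < m, f (sg m i) = g (sg m i))
    (b : Br m) : f b = g b := DFunLike.congr_fun (hom_ext h) b

theorem closure_sg (m : ℕ) : Subgroup.closure {b | ∃ i < m, sg m i = b} = ⊤ := by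
  rw [← PresentedGroup.closure_range_of]
  congr 1
  ext b
  constructor
  · rintro ⟨i, hi, rfl⟩; exact ⟨⟨i, hi⟩, (sg_of_lt hi).symm⟩
  · rintro ⟨i, rfl⟩; exact ⟨i, i.2, sg_of_lt i.2⟩

theorem mem_of_sg {m : ℕ} (S : Subgroup (Br m)) (h : ∀ i < m, sg m i ∈ S) (b : Br m) : b ∈ S := by
  have : Subgroup.closure {b | ∃ i < m, sg m i = b} ≤ S :=
    (Subgroup.closure_le _).2 (by rintro _ ⟨i, hi, rfl⟩; exact h i hi)
  exact this (by rw [closure_sg]; trivial)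

@[elab_as_elim]
theorem br_induction {m : ℕ} {P : Br m → Prop} (one : P 1) (sg : ∀ i < m, P (sg m i))
    (mul : ∀ a b, P a → P b → P (a * b)) (inv : ∀ a, P a → P a⁻¹) (b : Br m) : P b := by
  have : b ∈ Subgroup.closure {b | ∃ i < m, Braid.sg m i = b} := by rw [closure_sg]; trivial
  induction this using Subgroup.closure_induction with
  | mem x hx => obtain ⟨i, hi, rfl⟩ := hx; exact sg i hi
  | one => exact one
  | mul a b _ _ ha hb => exact mul a b ha hb
  | inv a _ ha => exact inv a ha

end lift

/-- The length homomorphism. -/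
def len (m : ℕ) : Br m →* Multiplicative ℤ :=
  lift (fun _ => Multiplicative.ofAdd 1) ⟨fun _ _ => rfl, fun _ _ _ _ => rfl⟩

theorem len_sg {m i : ℕ} (h : i < m) : len m (sg m i) = Multiplicative.ofAdd 1 := lift_sg _ h

/-- Inversion of the generators. -/
def chi (m : ℕ) : Br m →* Br m :=
  lift (fun i => (sg m i)⁻¹)
    ⟨fun i hi => by
      have := congrArg (·⁻¹) ((isBraid_sg m).braid i hi)
      simpa [mul_assoc] using this,
    fun i j hij hj => by
      have := congrArg (·⁻¹) ((isBraid_sg m).comm i j hij hj)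
      simpa using this.symm⟩

theorem chi_sg {m i : ℕ} (h : i < m) : chi m (sg m i) = (sg m i)⁻¹ := lift_sg _ h

theorem isBraid_swap (m : ℕ) : IsBraid m (fun i => Equiv.swap i (i + 1)) where
  braid i _ := by
    ext x
    simp only [Equiv.Perm.mul_apply, Equiv.swap_apply_def]
    split_ifs <;> omega
  comm i j hij _ := by
    ext x
    simp only [Equiv.Perm.mul_apply, Equiv.swap_apply_def]
    split_ifs <;> omega

/-- The permutation underlying a braid. -/
def perm (m : ℕ) : Br m →* Equiv.Perm ℕ := lift _ (isBraid_swap m)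

theorem perm_sg {m i : ℕ} (h : i < m) : perm m (sg m i) = Equiv.swap i (i + 1) := lift_sg _ h

theorem perm_apply_of_lt {m : ℕ} (b : Br m) {x : ℕ} (hx : m < x) : perm m b x = x := by
  induction b using br_induction with
  | one => simp
  | sg i hi => rw [perm_sg hi]; exact Equiv.swap_apply_of_ne_of_ne (by omega) (by omega)
  | mul a b ha hb => simp [ha, hb]
  | inv a ha => rw [map_inv, Equiv.Perm.inv_eq_iff_eq, ha]

theorem perm_apply_le {m : ℕ} (b : Br m) {x : ℕ} (hx : x ≤ m) : perm m b x ≤ m := by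
  by_contra h
  have := perm_apply_of_lt b (not_le.1 h)
  have := (perm m b).injective this
  omega

end Braid

namespace Braid

theorem arrow_apply {Q A M : Type*} [Group Q] [MulAction Q A] [Monoid M] (g : Q) (f : A → M)
    (a : A) : (mulAutArrow g : MulAut (A → M)) f a = f (g⁻¹ • a) := rfl

/-- Pairwise linking data of a braid, as a crossed homomorphism. -/
abbrev LkGroup : Type := (ℕ × ℕ → Multiplicative ℤ) ⋊[mulAutArrow] Equiv.Perm ℕ

def lkGen (i : ℕ) : LkGroup :=
  ⟨fun p => if (p.1 = i ∧ p.2 = i + 1) ∨ (p.1 = i + 1 ∧ p.2 = i) then Multiplicative.ofAdd 1 else 1,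
    Equiv.swap i (i + 1)⟩

theorem lkGen_mul_left (i : ℕ) (w : LkGroup) (p : ℕ × ℕ) :
    (lkGen i * w).left p = (lkGen i).left p * w.left (Equiv.swap i (i + 1) p.1, Equiv.swap i (i + 1) p.2) := by
  rfl

set_option maxHeartbeats 1000000 in
theorem isBraid_lkGen (m : ℕ) : IsBraid m lkGen where
  braid i hi := by
    refine SemidirectProduct.ext ?_ ((isBraid_swap m).braid i hi)
    funext ⟨j, k⟩
    have key : ∀ x, x = i ∨ x = i + 1 ∨ x = i + 1 + 1 ∨ (x ≠ i ∧ x ≠ i + 1 ∧ x ≠ i + 1 + 1) := by omega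
    simp only [mul_assoc, lkGen_mul_left]
    simp only [lkGen, Equiv.swap_apply_def]
    have a1 : i + 1 ≠ i := by omega
    have a2 : i + 1 + 1 ≠ i := by omega
    have a3 : i + 1 + 1 ≠ i + 1 := by omega
    generalize i + 1 + 1 = i2 at *
    generalize i + 1 = i1 at *
    rcases key j with rfl | rfl | rfl | ⟨h1, h2, h3⟩ <;>
    rcases key k with h | h | h | ⟨h4, h5, h6⟩ <;> (try subst h) <;> clear key <;>
    simp [*, a1.symm, a2.symm, a3.symm]
  comm i j hij hj := by
    refine SemidirectProduct.ext ?_ ((isBraid_swap m).comm i j hij hj)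
    funext ⟨x, y⟩
    simp only [lkGen_mul_left]
    simp only [lkGen, Equiv.swap_apply_def]
    have key : ∀ x, x = i ∨ x = i + 1 ∨ x = j ∨ x = j + 1 ∨ 
      (x ≠ i ∧ x ≠ i + 1 ∧ x ≠ j ∧ x ≠ j + 1) := by omega
    have a1 : i + 1 ≠ i := by omega
    have a2 : j ≠ i := by omega
    have a3 : j + 1 ≠ i := by omega
    have a4 : j ≠ i + 1 := by omega
    have a5 : j + 1 ≠ i + 1 := by omega
    have a6 : j + 1 ≠ j := by omega
    clear hij hj
    generalize i + 1 = i1 at *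
    generalize j + 1 = j1 at *
    rcases key x with rfl | rfl | rfl | rfl | ⟨h1, h2, h3, h3'⟩ <;>
    rcases key y with h | h | h | h | ⟨h4, h5, h6, h6'⟩ <;> (try subst h) <;> clear key <;>
    simp [*, a1.symm, a2.symm, a3.symm, a4.symm, a5.symm, a6.symm]

def lkHom (m : ℕ) : Br m →* LkGroup := lift lkGen (isBraid_lkGen m)

/-- The linking number of the strands ending at `j` and `k`. -/
def lk {m : ℕ} (b : Br m) (j k : ℕ) : ℤ := ((lkHom m b).left (j, k)).toAdd

variable {m : ℕ}

theorem lkHom_right (b : Br m) : (lkHom m b).right = perm m b := by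
  have : (SemidirectProduct.rightHom.comp (lkHom m)) = perm m := hom_ext fun i hi => by
    simp [lkHom, lift_sg _ hi, perm_sg hi, lkGen]
  exact DFunLike.congr_fun this b

theorem lk_mul (a b : Br m) (j k : ℕ) :
    lk (a * b) j k = lk a j k + lk b ((perm m a)⁻¹ j) ((perm m a)⁻¹ k) := by
  simp only [lk, map_mul, SemidirectProduct.mul_left, Pi.mul_apply, arrow_apply, toAdd_mul,
    Prod.smul_mk, Equiv.Perm.smul_def, lkHom_right]

@[simp] theorem lk_one (j k : ℕ) : lk (1 : Br m) j k = 0 := by simp [lk]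

theorem lk_sg {i : ℕ} (h : i < m) (j k : ℕ) :
    lk (sg m i) j k = if (j = i ∧ k = i + 1) ∨ (j = i + 1 ∧ k = i) then 1 else 0 := by
  simp only [lk, lkHom, lift_sg _ h, lkGen]
  split_ifs <;> rfl

theorem lk_inv (a : Br m) (j k : ℕ) : lk a⁻¹ j k = - lk a (perm m a j) (perm m a k) := by
  have := lk_mul a a⁻¹ (perm m a j) (perm m a k)
  simp at this
  omega

theorem lk_symm (b : Br m) (j k : ℕ) : lk b j k = lk b k j := by
  induction b using br_induction generalizing j k with
  | one => simp
  | sg i hi => rw [lk_sg hi, lk_sg hi]; split_ifs <;> omega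
  | mul a b ha hb => rw [lk_mul, lk_mul, ha, hb]
  | inv a ha => rw [lk_inv, lk_inv, ha]

theorem lk_eq_zero_of_lt (b : Br m) (j : ℕ) {k : ℕ} (hk : m < k) : lk b j k = 0 := by
  induction b using br_induction generalizing j k with
  | one => simp
  | sg i hi => rw [lk_sg hi]; split_ifs <;> omega
  | mul a b ha hb => rw [lk_mul, ha _ hk, ← map_inv, perm_apply_of_lt _ hk, hb _ hk, add_zero]
  | inv a ha => rw [lk_inv, perm_apply_of_lt _ hk, ha _ hk, neg_zero]

@[simp] theorem lk_self (b : Br m) (j : ℕ) : lk b j j = 0 := by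
  induction b using br_induction generalizing j with
  | one => simp
  | sg i hi => rw [lk_sg hi]; split_ifs <;> omega
  | mul a b ha hb => rw [lk_mul, ha, hb, add_zero]
  | inv a ha => rw [lk_inv, ha, neg_zero]

theorem even_lk_iff (b : Br m) {j k : ℕ} (hjk : j ≠ k) :
    Even (lk b j k) ↔ (j < k ↔ (perm m b)⁻¹ j < (perm m b)⁻¹ k) := by
  induction b using br_induction generalizing j k with
  | one => simp
  | sg i hi =>
    rw [lk_sg hi, perm_sg hi, Equiv.swap_inv]
    simp only [Equiv.swap_apply_def]
    split_ifs <;> first | (exfalso; omega) | (simp; done) | (simp; omega)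
  | mul a b ha hb =>
    rw [lk_mul, Int.even_add, ha hjk, hb (fun h => hjk ((perm m a)⁻¹.injective h))]
    simp only [map_mul, mul_inv_rev, Equiv.Perm.mul_apply]
    tauto
  | inv a ha =>
    rw [lk_inv, even_neg, ha (fun h => hjk ((perm m a).injective h))]
    simp
    tauto

theorem even_lk_of_pure {b : Br m} (hb : perm m b = 1) (j k : ℕ) : Even (lk b j k) := by
  by_cases h : j = k
  · subst h; simp
  · rw [even_lk_iff b h, hb]; simp

theorem lk_mul_of_pure {a : Br m} (ha : perm m a = 1) (b : Br m) (j k : ℕ) :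
    lk (a * b) j k = lk a j k + lk b j k := by rw [lk_mul, ha]; simp

theorem lk_inv_of_pure {a : Br m} (ha : perm m a = 1) (j k : ℕ) :
    lk a⁻¹ j k = - lk a j k := by rw [lk_inv, ha]; simp

theorem lk_pow_of_pure {a : Br m} (ha : perm m a = 1) (n : ℕ) (j k : ℕ) :
    lk (a ^ n) j k = n * lk a j k := by
  induction n with
  | zero => simp
  | succ n ih => rw [pow_succ', lk_mul_of_pure ha, ih]; push_cast; ring

theorem lk_zpow_of_pure {a : Br m} (ha : perm m a = 1) (n : ℤ) (j k : ℕ) :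
    lk (a ^ n) j k = n * lk a j k := by
  cases n with
  | ofNat n => simpa using lk_pow_of_pure ha n j k
  | negSucc n =>
    rw [zpow_negSucc, lk_inv_of_pure (by simp [ha]), lk_pow_of_pure ha, Int.negSucc_eq]
    push_cast; ring

theorem lk_conj (g : Br m) {p : Br m} (hp : perm m p = 1) (j k : ℕ) :
    lk (g * p * g⁻¹) j k = lk p ((perm m g)⁻¹ j) ((perm m g)⁻¹ k) := by
  rw [lk_mul, lk_mul, lk_inv]
  simp [hp]

theorem perm_conj_pure (g : Br m) {p : Br m} (hp : perm m p = 1) :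
    perm m (g * p * g⁻¹) = 1 := by simp [hp]

theorem perm_sq {i : ℕ} (hi : i < m) : perm m (sg m i ^ 2) = 1 := by
  rw [map_pow, perm_sg hi, pow_two, Equiv.swap_mul_self]

theorem lk_sq {i : ℕ} (hi : i < m) (j k : ℕ) :
    lk (sg m i ^ 2) j k = if (j = i ∧ k = i + 1) ∨ (j = i + 1 ∧ k = i) then 2 else 0 := by
  rw [pow_two, lk_mul, lk_sg hi, perm_sg hi, lk_sg hi, Equiv.swap_inv]
  simp only [Equiv.swap_apply_def]
  split_ifs <;> omega

theorem lk_chi (b : Br m) (j k : ℕ) : lk (chi m b) j k = - lk b j k ∧ perm m (chi m b) = perm m b := by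
  induction b using br_induction generalizing j k with
  | one => simp
  | sg i hi =>
    rw [chi_sg hi, lk_inv, lk_sg hi, lk_sg hi, map_inv, perm_sg hi, Equiv.swap_inv]
    simp only [Equiv.swap_apply_def, and_true]
    split_ifs <;> omega
  | mul a b ha hb =>
    rw [map_mul, lk_mul, lk_mul, (ha j k).2, (ha _ _).1, (hb _ _).1, map_mul, (ha j k).2, (hb j k).2]
    simp
    omega
  | inv a ha =>
    rw [map_inv, lk_inv, lk_inv, (ha j k).2, (ha _ _).1, map_inv, (ha j k).2]
    simp

end Braid

namespace Braid

/-- The free group on which `Br m` acts. -/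
abbrev F (m : ℕ) : Type := FreeGroup (Fin (m + 1))

/-- The free basis `gf 1, …, gf (m+1)`, with `gf k = x_{k-1} ⋯ x_0`. -/
def gf (m : ℕ) : ℕ → F m
  | 0 => 1
  | k + 1 => if h : k < m + 1 then FreeGroup.of ⟨k, h⟩ else 1

/-- The standard meridian generators. -/
def xf (m j : ℕ) : F m := gf m (j + 1) * (gf m j)⁻¹

variable {m : ℕ}

@[simp] theorem gf_zero : gf m 0 = 1 := rfl

theorem gf_succ {k : ℕ} (h : k < m + 1) : gf m (k + 1) = FreeGroup.of ⟨k, h⟩ := by simp [gf, h]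

theorem of_eq_gf (k : Fin (m + 1)) : FreeGroup.of k = gf m (k + 1) := (gf_succ k.2).symm

theorem F_ext {G : Type*} [Monoid G] {f g : F m →* G} (h : ∀ k ≤ m, f (gf m (k + 1)) = g (gf m (k + 1))) :
    f = g := by
  apply FreeGroup.ext_hom
  intro k
  rw [of_eq_gf]
  exact h k (by omega)

def liftF {G : Type*} [Group G] (w : ℕ → G) : F m →* G := FreeGroup.lift fun k => w (k + 1)

theorem liftF_gf {G : Type*} [Group G] (w : ℕ → G) {k : ℕ} (h1 : 1 ≤ k) (h2 : k ≤ m + 1) :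
    liftF (m := m) w (gf m k) = w k := by
  obtain ⟨k, rfl⟩ : ∃ k', k = k' + 1 := ⟨k - 1, by omega⟩
  rw [gf_succ (by omega : k < m + 1)]
  simp [liftF]

theorem liftF_gf' {G : Type*} [Group G] (w : ℕ → G) (h0 : w 0 = 1) {k : ℕ} (h2 : k ≤ m + 1) :
    liftF (m := m) w (gf m k) = w k := by
  rcases Nat.eq_zero_or_pos k with rfl | h
  · simp [h0]
  · exact liftF_gf w h h2

def actHom (m i : ℕ) : F m →* F m :=
  liftF fun k => if k = i + 1 then gf m i * (gf m (i + 1))⁻¹ * gf m (i + 2) else gf m k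

def actInvHom (m i : ℕ) : F m →* F m :=
  liftF fun k => if k = i + 1 then gf m (i + 2) * (gf m (i + 1))⁻¹ * gf m i else gf m k

theorem gf_of_lt {k : ℕ} (h : m + 1 < k) : gf m k = 1 := by
  obtain ⟨k, rfl⟩ : ∃ k', k = k' + 1 := ⟨k - 1, by omega⟩
  have : ¬ k < m + 1 := by omega
  simp [gf, this]

theorem actHom_gf {i : ℕ} (hi : i < m) (k : ℕ) : actHom m i (gf m k) =
    if k = i + 1 then gf m i * (gf m (i + 1))⁻¹ * gf m (i + 2) else gf m k := by
  by_cases h : k ≤ m + 1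
  · exact liftF_gf' _ (by simp) h
  · rw [gf_of_lt (not_le.1 h), if_neg (by omega)]; simp

theorem actInvHom_gf {i : ℕ} (hi : i < m) (k : ℕ) : actInvHom m i (gf m k) =
    if k = i + 1 then gf m (i + 2) * (gf m (i + 1))⁻¹ * gf m i else gf m k := by
  by_cases h : k ≤ m + 1
  · exact liftF_gf' _ (by simp) h
  · rw [gf_of_lt (not_le.1 h), if_neg (by omega)]; simp

theorem actHom_inv {i : ℕ} (hi : i < m) : (actHom m i).comp (actInvHom m i) = MonoidHom.id _ := by
  refine F_ext fun k _ => ?_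
  rw [MonoidHom.comp_apply, actInvHom_gf hi]
  split_ifs with h
  · simp [actHom_gf hi, h, mul_assoc]
  · simp [actHom_gf hi, show k ≠ i by omega]

theorem actInvHom_hom {i : ℕ} (hi : i < m) : (actInvHom m i).comp (actHom m i) = MonoidHom.id _ := by
  refine F_ext fun k _ => ?_
  rw [MonoidHom.comp_apply, actHom_gf hi]
  split_ifs with h
  · simp [actInvHom_gf hi, h, mul_assoc]
  · simp [actInvHom_gf hi, show k ≠ i by omega]

def actGen (m i : ℕ) : MulAut (F m) :=
  if hi : i < m then MonoidHom.toMulEquiv (actHom m i) (actInvHom m i) (actInvHom_hom hi) (actHom_inv hi)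
  else 1

theorem actGen_gf {i : ℕ} (hi : i < m) (k : ℕ) : actGen m i (gf m k) =
    if k = i + 1 then gf m i * (gf m (i + 1))⁻¹ * gf m (i + 2) else gf m k := by
  simp only [actGen, hi, dif_pos]
  exact actHom_gf hi k

theorem mulAut_ext {f g : MulAut (F m)} (h : ∀ k ≤ m, f (gf m (k + 1)) = g (gf m (k + 1))) : f = g := by
  apply MulEquiv.toMonoidHom_injective
  exact F_ext h

theorem isBraid_actGen (m : ℕ) : IsBraid m (actGen m) where
  braid i hi := by
    refine mulAut_ext fun k _ => ?_
    have h1 : i < m := by omega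
    have n1 : i ≠ i + 1 + 1 := by omega
    rcases eq_or_ne k i with rfl | hk
    · simp [MulAut.mul_apply, actGen_gf hi, actGen_gf h1, mul_assoc, n1]
    rcases eq_or_ne k (i + 1) with rfl | hk'
    · simp [MulAut.mul_apply, actGen_gf hi, actGen_gf h1, mul_assoc, n1]
    · simp [MulAut.mul_apply, actGen_gf hi, actGen_gf h1, mul_assoc, hk, hk']
  comm i j hij hj := by
    refine mulAut_ext fun k _ => ?_
    have h1 : i < m := by omega
    have n1 : i ≠ j := by omega
    have n2 : i + 1 ≠ j := by omega
    have n3 : j + 1 ≠ i := by omega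
    have n4 : i ≠ j + 1 := by omega
    have n5 : j ≠ i + 1 := by omega
    rcases eq_or_ne k i with rfl | hk
    · simp [MulAut.mul_apply, actGen_gf hj, actGen_gf h1, mul_assoc, *, n1.symm]
    rcases eq_or_ne k j with rfl | hk'
    · simp [MulAut.mul_apply, actGen_gf hj, actGen_gf h1, mul_assoc, *, n1.symm]
    · simp [MulAut.mul_apply, actGen_gf hj, actGen_gf h1, mul_assoc, *]

/-- The Artin action. -/
def act (m : ℕ) : Br m →* MulAut (F m) := lift _ (isBraid_actGen m)

theorem act_sg {i : ℕ} (hi : i < m) : act m (sg m i) = actGen m i := lift_sg _ hi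

theorem act_sg_gf {i : ℕ} (hi : i < m) (k : ℕ) : act m (sg m i) (gf m k) =
    if k = i + 1 then gf m i * (gf m (i + 1))⁻¹ * gf m (i + 2) else gf m k := by
  rw [act_sg hi, actGen_gf hi]

theorem act_last (b : Br m) : act m b (gf m (m + 1)) = gf m (m + 1) := by
  induction b using br_induction with
  | one => simp
  | sg i hi => rw [act_sg_gf hi, if_neg (by omega)]
  | mul a b ha hb => rw [map_mul, MulAut.mul_apply, hb, ha]
  | inv a ha => rw [map_inv, MulAut.inv_apply, MulEquiv.symm_apply_eq, ha]

theorem act_sg_xf_self {i : ℕ} (hi : i < m) :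
    act m (sg m i) (xf m i) = (xf m i)⁻¹ * xf m (i + 1) * xf m i := by
  simp [xf, act_sg_gf hi, mul_assoc]

theorem act_sg_xf_succ {i : ℕ} (hi : i < m) : act m (sg m i) (xf m (i + 1)) = xf m i := by
  simp [xf, act_sg_gf hi, mul_assoc]

theorem act_sg_xf_of_ne {i j : ℕ} (hi : i < m) (h1 : j ≠ i) (h2 : j ≠ i + 1) :
    act m (sg m i) (xf m j) = xf m j := by
  simp [xf, act_sg_gf hi, mul_assoc, h1, h2]

/-- Auxiliary product `σ_j σ_{j+1} ⋯ σ_{m-1}`. -/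
def tl (m j : ℕ) : Br m := ((List.range' j (m - j)).map (sg m)).prod

theorem tl_eq {j : ℕ} (h : j < m) : tl m j = sg m j * tl m (j + 1) := by
  obtain ⟨d, rfl⟩ : ∃ d, m = j + 1 + d := ⟨m - (j + 1), by omega⟩
  rw [tl, tl, show j + 1 + d - j = d + 1 by omega, List.range'_succ]
  simp

theorem tl_of_le {j : ℕ} (h : m ≤ j) : tl m j = 1 := by
  rw [tl, show m - j = 0 by omega]; simp

theorem tl_comm {i j : ℕ} (h : i + 1 < j) : sg m i * tl m j = tl m j * sg m i := by
  have key : ∀ d j, m ≤ j + d → i + 1 < j → sg m i * tl m j = tl m j * sg m i := by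
    intro d
    induction d with
    | zero => intro j hj _; rw [tl_of_le (by omega)]; simp
    | succ d ih =>
      intro j hj hij
      rcases lt_or_ge j m with h | h
      · rw [tl_eq h, ← mul_assoc, (isBraid_sg m).comm i j (by omega) h, mul_assoc,
          ih (j + 1) (by omega) (by omega), mul_assoc]
      · rw [tl_of_le h]; simp
  exact key m j (by omega) h

theorem tl_shift {i j : ℕ} (h : j ≤ i) (hi : i + 1 < m) :
    sg m (i + 1) * tl m j = tl m j * sg m i := by
  have key : ∀ d j, i = j + d → sg m (i + 1) * tl m j = tl m j * sg m i := by
    intro d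
    induction d with
    | zero =>
      intro j hj
      obtain rfl : i = j := hj
      rw [tl_eq (by omega : i < m), tl_eq hi, ← mul_assoc, ← mul_assoc, ← (isBraid_sg m).braid i hi]
      simp only [mul_assoc]
      rw [tl_comm (by omega)]
    | succ d ih =>
      intro j hj
      rw [tl_eq (by omega : j < m), ← mul_assoc, ← (isBraid_sg m).comm j (i + 1) (by omega) hi, mul_assoc,
          ih (j + 1) (by omega), mul_assoc]
  exact key (i - j) j (by omega)

/-- The image of `xf m j` in `Br (m+1)`. -/
def xb (m j : ℕ) : Br (m + 1) := (tl (m + 1) (j + 1))⁻¹ * sg (m + 1) j ^ 2 * tl (m + 1) (j + 1)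

def gb (m : ℕ) : ℕ → Br (m + 1)
  | 0 => 1
  | k + 1 => xb m k * gb m k

theorem xb_last : xb m m = sg (m + 1) m ^ 2 := by
  rw [xb, tl_of_le le_rfl]; simp

theorem braid_conj {G : Type*} [Group G] {a b : G} (h : a * b * a = b * a * b) :
    b⁻¹ * a ^ 2 * b = a * b ^ 2 * a⁻¹ := by
  have h2 : a ^ 2 * b * a = b * a * b ^ 2 := by
    calc a ^ 2 * b * a = a * (a * b * a) := by simp only [pow_two, mul_assoc]
      _ = (a * b * a) * b := by rw [h]; nth_rewrite 1 [← mul_assoc, ← mul_assoc, h]; rfl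
      _ = b * a * b ^ 2 := by rw [h]; simp only [pow_two, mul_assoc]
  calc b⁻¹ * a ^ 2 * b = b⁻¹ * (a ^ 2 * b * a) * a⁻¹ := by group
    _ = a * b ^ 2 * a⁻¹ := by rw [h2]; group

theorem sg_xb_succ {i : ℕ} (hi : i < m) :
    sg (m + 1) i * xb m (i + 1) * (sg (m + 1) i)⁻¹ = xb m i := by
  rw [xb, xb, tl_eq (by omega : i + 1 < m + 1)]
  have h1 := tl_comm (m := m + 1) (by omega : i + 1 < i + 1 + 1)
  have h2 := braid_conj ((isBraid_sg (m + 1)).braid i (by omega))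
  have h3 : sg (m + 1) i * (tl (m + 1) (i + 1 + 1))⁻¹ = (tl (m + 1) (i + 1 + 1))⁻¹ * sg (m + 1) i := by
    rw [mul_inv_eq_iff_eq_mul, mul_assoc, h1, inv_mul_cancel_left]
  have h4 : tl (m + 1) (i + 1 + 1) * (sg (m + 1) i)⁻¹ = (sg (m + 1) i)⁻¹ * tl (m + 1) (i + 1 + 1) := by
    rw [mul_inv_eq_iff_eq_mul, mul_assoc, ← h1, inv_mul_cancel_left]
  calc _ = (sg (m + 1) i * (tl (m + 1) (i + 1 + 1))⁻¹) * sg (m + 1) (i + 1) ^ 2 *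
        (tl (m + 1) (i + 1 + 1) * (sg (m + 1) i)⁻¹) := by simp only [mul_assoc]
    _ = (tl (m + 1) (i + 1 + 1))⁻¹ * (sg (m + 1) i * sg (m + 1) (i + 1) ^ 2 * (sg (m + 1) i)⁻¹) *
        tl (m + 1) (i + 1 + 1) := by rw [h3, h4]; simp only [mul_assoc]
    _ = _ := by rw [← h2]; simp only [mul_assoc, mul_inv_rev]

theorem sg_xb_of_ne {i j : ℕ} (hi : i < m) (hj : j ≤ m) (h1 : j ≠ i) (h2 : j ≠ i + 1) :
    sg (m + 1) i * xb m j = xb m j * sg (m + 1) i := by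
  have key : ∀ {G : Type} [Group G] (s s' p t : G), s' * t = t * s → s' * p = p * s' →
      s * (t⁻¹ * p ^ 2 * t) = (t⁻¹ * p ^ 2 * t) * s := by
    intro G _ s s' p t h1 h2
    have h3 : s = t⁻¹ * s' * t := by rw [mul_assoc, h1]; group
    have h4 : s' * p ^ 2 = p ^ 2 * s' := by rw [pow_two, ← mul_assoc, h2, mul_assoc, h2, mul_assoc]
    rw [h3]
    calc _ = t⁻¹ * (s' * p ^ 2) * t := by group
      _ = _ := by rw [h4]; group
  rcases lt_or_ge j i with h | h
  · refine key _ (sg (m + 1) (i + 1)) _ _ (tl_shift (by omega) (by omega)) ?_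
    exact ((isBraid_sg (m + 1)).comm j (i + 1) (by omega) (by omega)).symm
  · refine key _ (sg (m + 1) i) _ _ (tl_comm (by omega)) ?_
    exact (isBraid_sg (m + 1)).comm i j (by omega) (by omega)

theorem sg_xb_xb {i : ℕ} (hi : i < m) :
    sg (m + 1) i * xb m i * (sg (m + 1) i)⁻¹ = (xb m i)⁻¹ * xb m (i + 1) * xb m i := by
  rw [xb, xb, tl_eq (by omega : i + 1 < m + 1)]
  have h1 := tl_comm (m := m + 1) (by omega : i + 1 < i + 1 + 1)
  have h2 := (isBraid_sg (m + 1)).braid i (by omega)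
  generalize sg (m + 1) i = a at *
  generalize sg (m + 1) (i + 1) = b at *
  generalize tl (m + 1) (i + 1 + 1) = t at *
  have h5 := braid_conj h2
  have h6 : (b⁻¹ * a ^ 2 * b)⁻¹ * b ^ 2 * (b⁻¹ * a ^ 2 * b) = a * (b⁻¹ * a ^ 2 * b) * a⁻¹ := by
    rw [h5]
    have : b * (a * b ^ 2 * a) = (a * b ^ 2 * a) * b := by
      calc b * (a * b ^ 2 * a) = (b * a * b) * (b * a) := by simp only [pow_two, mul_assoc]
        _ = a * b * (a * b * a) := by rw [← h2]; simp only [mul_assoc]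
        _ = _ := by rw [h2]; simp only [pow_two, mul_assoc]
    have h7 : b ^ 2 * (a * b ^ 2 * a) = (a * b ^ 2 * a) * b ^ 2 := by
      calc _ = b * (b * (a * b ^ 2 * a)) := by rw [pow_two b, mul_assoc b b]
        _ = _ := by rw [this, ← mul_assoc, this, mul_assoc, ← pow_two]
    calc _ = a * (b ^ 2)⁻¹ * a⁻¹ * (b ^ 2 * (a * b ^ 2 * a)) * a⁻¹ * a⁻¹ := by group
      _ = _ := by rw [h7]; group
  have h3 : a * t⁻¹ = t⁻¹ * a := by
    rw [mul_inv_eq_iff_eq_mul, mul_assoc, h1, inv_mul_cancel_left]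
  have h4 : t * a⁻¹ = a⁻¹ * t := by
    rw [mul_inv_eq_iff_eq_mul, mul_assoc, ← h1, inv_mul_cancel_left]
  calc _ = (a * t⁻¹) * (b⁻¹ * a ^ 2 * b) * (t * a⁻¹) := by group
    _ = t⁻¹ * (a * (b⁻¹ * a ^ 2 * b) * a⁻¹) * t := by rw [h3, h4]; group
    _ = _ := by rw [← h6]; group

theorem sg_gb {i : ℕ} (hi : i < m) (k : ℕ) (hk : k ≤ m + 1) :
    sg (m + 1) i * gb m k * (sg (m + 1) i)⁻¹ = 
    if k = i + 1 then gb m i * (gb m (i + 1))⁻¹ * gb m (i + 2) else gb m k := by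
  have low : ∀ k ≤ i, sg (m + 1) i * gb m k * (sg (m + 1) i)⁻¹ = gb m k := by
    intro k
    induction k with
    | zero => simp [gb]
    | succ k ih =>
      intro hk
      have := ih (by omega)
      rw [mul_inv_eq_iff_eq_mul] at this
      rw [gb, ← mul_assoc, sg_xb_of_ne hi (by omega) (by omega) (by omega), mul_assoc (xb m k), this]
      group
  have mid : sg (m + 1) i * gb m (i + 1) * (sg (m + 1) i)⁻¹ =
      (xb m i)⁻¹ * xb m (i + 1) * xb m i * gb m i := by
    rw [gb]
    calc _ = (sg (m + 1) i * xb m i * (sg (m + 1) i)⁻¹) *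
        (sg (m + 1) i * gb m i * (sg (m + 1) i)⁻¹) := by group
      _ = _ := by rw [sg_xb_xb hi, low i le_rfl]
  have high : ∀ d, i + 2 + d ≤ m + 1 → sg (m + 1) i * gb m (i + 2 + d) * (sg (m + 1) i)⁻¹ = gb m (i + 2 + d) := by
    intro d
    induction d with
    | zero =>
      intro _
      change sg (m + 1) i * (xb m (i + 1) * gb m (i + 1)) * (sg (m + 1) i)⁻¹ = xb m (i + 1) * gb m (i + 1)
      calc _ = (sg (m + 1) i * xb m (i + 1) * (sg (m + 1) i)⁻¹) *
          (sg (m + 1) i * gb m (i + 1) * (sg (m + 1) i)⁻¹) := by group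
        _ = _ := by rw [sg_xb_succ hi, mid, gb]; group
    | succ d ih =>
      intro hd
      have := ih (by omega)
      rw [mul_inv_eq_iff_eq_mul] at this
      rw [show i + 2 + (d + 1) = (i + 2 + d) + 1 by omega, gb, ← mul_assoc,
        sg_xb_of_ne hi (by omega) (by omega) (by omega), mul_assoc (xb m _), this]
      group
  split_ifs with h
  · subst h
    rw [mid]
    simp only [gb]
    group
  · rcases lt_or_ge i k with h' | h'
    · obtain ⟨d, rfl⟩ : ∃ d, k = i + 2 + d := ⟨k - (i + 2), by omega⟩
      exact high d hk
    · exact low k h'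

theorem isBraid_inc (m : ℕ) : IsBraid m (sg (m + 1)) := (isBraid_sg (m + 1)).mono (by omega)

/-- Adding a trivial last strand. -/
def inc (m : ℕ) : Br m →* Br (m + 1) := lift _ (isBraid_inc m)

theorem inc_sg {i : ℕ} (hi : i < m) : inc m (sg m i) = sg (m + 1) i := lift_sg _ hi

/-- The embedding of the free group as braids moving only the last strand. -/
def xhom (m : ℕ) : F m →* Br (m + 1) := liftF (gb m)

theorem xhom_gf {k : ℕ} (hk : k ≤ m + 1) : xhom m (gf m k) = gb m k := liftF_gf' _ rfl hk

theorem xhom_xf {j : ℕ} (hj : j ≤ m) : xhom m (xf m j) = xb m j := by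
  rw [xf, map_mul, map_inv, xhom_gf (by omega), xhom_gf (by omega), gb]; group

theorem xhom_act (b : Br m) (v : F m) : xhom m (act m b v) = inc m b * xhom m v * (inc m b)⁻¹ := by
  induction b using br_induction generalizing v with
  | one => simp
  | sg i hi =>
    have : (xhom m).comp (act m (sg m i)).toMonoidHom =
        (MulAut.conj (inc m (sg m i))).toMonoidHom.comp (xhom m) := by
      refine F_ext fun k hk => ?_
      simp only [MonoidHom.comp_apply, MulEquiv.toMonoidHom_eq_coe, MonoidHom.coe_coe, act_sg_gf hi,
        MulAut.conj_apply, inc_sg hi, xhom_gf (by omega : k + 1 ≤ m + 1), sg_gb hi _ (by omega : k + 1 ≤ m + 1)]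
      split_ifs
      · simp [xhom_gf (by omega : i ≤ m + 1), xhom_gf (by omega : i + 1 ≤ m + 1), xhom_gf (by omega : i + 2 ≤ m + 1)]
      · exact xhom_gf (by omega)
    exact DFunLike.congr_fun this v
  | mul a b ha hb => rw [map_mul, MulAut.mul_apply, ha, hb, map_mul]; group
  | inv a ha =>
    have := ha (act m a⁻¹ v)
    rw [← MulAut.mul_apply, ← map_mul, mul_inv_cancel, map_one, MulAut.one_apply] at this
    rw [this, map_inv (inc m)]; group

abbrev SD (m : ℕ) : Type := F m ⋊[act m] Br m

def iota (m : ℕ) : SD m →* Br (m + 1) :=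
  SemidirectProduct.lift (xhom m) (inc m) fun b => MonoidHom.ext fun v => xhom_act b v

theorem iota_apply (g : SD m) : iota m g = xhom m g.left * inc m g.right := rfl

end Braid

namespace Braid
variable {m : ℕ}

abbrev CombGroup (m : ℕ) : Type := (ℕ → SD m) ⋊[mulAutArrow] Equiv.Perm ℕ

def combCoeff (m i t : ℕ) : SD m :=
  if t < i then SemidirectProduct.inr (sg m (i - 1))
  else if t = i then 1
  else if t = i + 1 then SemidirectProduct.inl (xf m i)
  else if t ≤ m + 1 then SemidirectProduct.inr (sg m i) else 1

def combGen (m i : ℕ) : CombGroup m := ⟨combCoeff m i, Equiv.swap i (i + 1)⟩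

theorem combGen_mul_left (i : ℕ) (w : CombGroup m) (t : ℕ) :
    (combGen m i * w).left t = combCoeff m i t * w.left (Equiv.swap i (i + 1) t) := rfl

theorem combGen_left (i : ℕ) (t : ℕ) :
    (combGen m i).left t = combCoeff m i t := rfl

theorem inr_mul_inl (b : Br m) (v : F m) :
    (SemidirectProduct.inr b * SemidirectProduct.inl v : SD m) =
    SemidirectProduct.inl (act m b v) * SemidirectProduct.inr b := by
  ext <;> simp

theorem combCoeff_lt {i t : ℕ} (h : t < i) : combCoeff m i t = SemidirectProduct.inr (sg m (i - 1)) := by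
  simp [combCoeff, h]
theorem combCoeff_self (i : ℕ) : combCoeff m i i = 1 := by simp [combCoeff]
theorem combCoeff_succ (i : ℕ) : combCoeff m i (i + 1) = SemidirectProduct.inl (xf m i) := by
  simp [combCoeff]
theorem combCoeff_gt {i t : ℕ} (h : i + 1 < t) (h' : t ≤ m + 1) :
    combCoeff m i t = SemidirectProduct.inr (sg m i) := by
  simp [combCoeff, h', show ¬ t < i by omega, show t ≠ i by omega, show t ≠ i + 1 by omega]
theorem combCoeff_big {i t : ℕ} (h : i < m + 1) (h' : m + 1 < t) : combCoeff m i t = 1 := by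
  simp [combCoeff, show ¬ t ≤ m + 1 by omega, show ¬ t < i by omega, show t ≠ i by omega,
    show t ≠ i + 1 by omega]

theorem isBraid_combGen (m : ℕ) : IsBraid (m + 1) (combGen m) where
  braid i hi := by
    refine SemidirectProduct.ext ?_ ((isBraid_swap (m + 1)).braid i hi)
    funext t
    simp only [mul_assoc, combGen_mul_left, combGen_left]
    have sl : ∀ j, Equiv.swap j (j + 1) j = j + 1 := fun j => Equiv.swap_apply_left _ _
    have sr : ∀ j, Equiv.swap j (j + 1) (j + 1) = j := fun j => Equiv.swap_apply_right _ _
    have sn : ∀ j t, t ≠ j → t ≠ j + 1 → Equiv.swap j (j + 1) t = t :=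
      fun j t h1 h2 => Equiv.swap_apply_of_ne_of_ne h1 h2
    rcases lt_or_ge t i with h | h
    · rw [sn i t (by omega) (by omega), sn (i + 1) t (by omega) (by omega), sn i t (by omega) (by omega)]
      rw [combCoeff_lt h, combCoeff_lt (by omega : t < i + 1)]
      obtain ⟨i, rfl⟩ : ∃ i', i = i' + 1 := ⟨i - 1, by omega⟩
      have := (isBraid_sg m).braid i (by omega)
      simp only [← map_mul, ← mul_assoc, Nat.add_sub_cancel, this]
    rcases eq_or_lt_of_le h with rfl | h
    · rw [sl, sl, combCoeff_self, combCoeff_self, combCoeff_gt (by omega) (by omega),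
        sn (i + 1) i (by omega) (by omega), sl, combCoeff_lt (by omega), combCoeff_self, combCoeff_self]
      simp
    rcases eq_or_lt_of_le (Nat.succ_le_of_lt h) with rfl | h
    · simp only [Nat.succ_eq_add_one]
      rw [sr, sn (i + 1) i (by omega) (by omega), sl, sn i (i + 1 + 1) (by omega) (by omega),
        combCoeff_self, combCoeff_self, combCoeff_succ, combCoeff_succ, combCoeff_lt (by omega : i < i + 1),
        combCoeff_gt (by omega : i + 1 < i + 1 + 1) (by omega)]
      simp only [one_mul, mul_one, Nat.add_sub_cancel]
      rw [inr_mul_inl, act_sg_xf_succ (by omega)]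
    simp only [Nat.succ_eq_add_one] at h
    rcases eq_or_lt_of_le (Nat.succ_le_of_lt h) with rfl | h
    · simp only [Nat.succ_eq_add_one]
      rw [sn i (i + 1 + 1) (by omega) (by omega), sr, sr,
        combCoeff_succ, combCoeff_succ, combCoeff_lt (by omega : i < i + 1),
        combCoeff_gt (by omega : i + 1 < i + 1 + 1) (by omega)]
      simp only [Nat.add_sub_cancel]
      rw [← map_mul, inr_mul_inl, ← mul_assoc, ← map_mul, map_mul (act m _), act_sg_xf_succ (by omega),
        act_sg_xf_self (by omega)]
      simp only [mul_assoc, mul_inv_cancel_left]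
    simp only [Nat.succ_eq_add_one] at h
    rw [sn i t (by omega) (by omega), sn (i + 1) t (by omega) (by omega), sn i t (by omega) (by omega)]
    rcases lt_or_ge (m + 1) t with h2 | h2
    · rw [combCoeff_big (by omega) h2, combCoeff_big (by omega) h2]
    · rw [combCoeff_gt (by omega) h2, combCoeff_gt (by omega) h2]
      have := (isBraid_sg m).braid i (by omega)
      simp only [← map_mul, ← mul_assoc, Nat.add_sub_cancel, this]
  comm i j hij hj := by
    refine SemidirectProduct.ext ?_ ((isBraid_swap (m + 1)).comm i j hij hj)
    funext t
    simp only [mul_assoc, combGen_mul_left, combGen_left]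
    have sl : ∀ j, Equiv.swap j (j + 1) j = j + 1 := fun j => Equiv.swap_apply_left _ _
    have sr : ∀ j, Equiv.swap j (j + 1) (j + 1) = j := fun j => Equiv.swap_apply_right _ _
    have sn : ∀ j t, t ≠ j → t ≠ j + 1 → Equiv.swap j (j + 1) t = t :=
      fun j t h1 h2 => Equiv.swap_apply_of_ne_of_ne h1 h2
    obtain ⟨j, rfl⟩ : ∃ i', j = i' + 1 := ⟨j - 1, by omega⟩
    by_cases e1 : t = i
    · subst e1
      rw [sl, sn (j + 1) t (by omega) (by omega), combCoeff_self, combCoeff_lt (by omega), combCoeff_lt (by omega)]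
      simp
    by_cases e2 : t = i + 1
    · subst e2
      rw [sr, sn (j + 1) (i + 1) (by omega) (by omega), combCoeff_succ, combCoeff_lt (by omega), combCoeff_lt (by omega)]
      rw [inr_mul_inl, act_sg_xf_of_ne (by omega) (by omega) (by omega)]
    by_cases e3 : t = j + 1
    · subst e3
      rw [sl, sn i (j + 1) (by omega) (by omega), combCoeff_self, combCoeff_gt (by omega) (by omega), combCoeff_gt (by omega) (by omega)]
      simp
    by_cases e4 : t = j + 1 + 1
    · subst e4
      rw [sr, sn i (j + 1 + 1) (by omega) (by omega), combCoeff_succ, combCoeff_gt (by omega) (by omega), combCoeff_gt (by omega) (by omega)]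
      rw [inr_mul_inl, act_sg_xf_of_ne (by omega) (by omega) (by omega)]
    rw [sn _ _ e1 e2, sn _ _ e3 e4]
    rcases lt_or_ge (m + 1) t with h2 | h2
    · rw [combCoeff_big (by omega) h2, combCoeff_big (by omega) h2]
    rcases lt_or_ge t i with h | h
    · rw [combCoeff_lt h, combCoeff_lt (by omega)]
      obtain ⟨i, rfl⟩ : ∃ i', i = i' + 1 := ⟨i - 1, by omega⟩
      have := (isBraid_sg m).comm i j (by omega) (by omega)
      simp only [← map_mul, Nat.add_sub_cancel, this]
    rcases lt_or_ge t (j + 1) with h | h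
    · rw [combCoeff_lt h, combCoeff_gt (by omega) h2]
      have := (isBraid_sg m).comm i j (by omega) (by omega)
      simp only [← map_mul, Nat.add_sub_cancel, this]
    · rw [combCoeff_gt (by omega) h2, combCoeff_gt (by omega) h2]
      have := (isBraid_sg m).comm i (j + 1) (by omega) (by omega)
      simp only [← map_mul, Nat.add_sub_cancel, this]

def psi (m : ℕ) : Br (m + 1) →* CombGroup m := lift _ (isBraid_combGen m)

theorem psi_sg {i : ℕ} (hi : i < m + 1) : psi m (sg (m + 1) i) = combGen m i := lift_sg _ hi

theorem psi_right (b : Br (m + 1)) : (psi m b).right = perm (m + 1) b := by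
  have : (SemidirectProduct.rightHom.comp (psi m)) = perm (m + 1) := hom_ext fun i hi => by
    simp [psi_sg hi, perm_sg hi, combGen]
  exact DFunLike.congr_fun this b

theorem psi_mul_left (a b : Br (m + 1)) (t : ℕ) :
    (psi m (a * b)).left t = (psi m a).left t * (psi m b).left ((perm (m + 1) a)⁻¹ t) := by
  rw [map_mul, SemidirectProduct.mul_left, psi_right]; rfl

theorem xhom_inl_xf {i : ℕ} (hi : i < m + 1) : iota m (SemidirectProduct.inl (xf m i)) = xb m i := by
  rw [iota, SemidirectProduct.lift_inl, xhom_xf (by omega)]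

theorem iota_inr_sg {i : ℕ} (hi : i < m) : iota m (SemidirectProduct.inr (sg m i)) = sg (m + 1) i := by
  rw [iota, SemidirectProduct.lift_inr, inc_sg hi]

theorem mul_tl (b : Br (m + 1)) {t : ℕ} (ht : t ≤ m + 1) :
    b * tl (m + 1) ((perm (m + 1) b)⁻¹ t) = tl (m + 1) t * iota m ((psi m b).left t) := by
  have perm_inv_le : ∀ (a : Br (m + 1)) {t : ℕ}, t ≤ m + 1 → (perm (m + 1) a)⁻¹ t ≤ m + 1 := by
    intro a t ht
    rw [← map_inv]
    exact perm_apply_le _ ht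
  induction b using br_induction generalizing t with
  | one => simp
  | sg i hi =>
    rw [psi_sg hi, perm_sg hi, Equiv.swap_inv, combGen_left]
    rcases lt_or_ge t i with h | h
    · rw [combCoeff_lt h, Equiv.swap_apply_of_ne_of_ne (by omega) (by omega), iota_inr_sg (by omega)]
      obtain ⟨i, rfl⟩ : ∃ i', i = i' + 1 := ⟨i - 1, by omega⟩
      exact tl_shift (by omega) hi
    rcases eq_or_lt_of_le h with rfl | h
    · rw [combCoeff_self, Equiv.swap_apply_left, map_one, mul_one, tl_eq hi]
    rcases eq_or_lt_of_le (Nat.succ_le_of_lt h) with rfl | h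
    · simp only [Nat.succ_eq_add_one]
      rw [combCoeff_succ, Equiv.swap_apply_right, xhom_inl_xf hi, xb, tl_eq hi]
      simp [mul_assoc, pow_two]
    · simp only [Nat.succ_eq_add_one] at h
      rw [combCoeff_gt h ht, Equiv.swap_apply_of_ne_of_ne (by omega) (by omega), iota_inr_sg (by omega)]
      exact tl_comm (by omega)
  | mul a b ha hb =>
    rw [psi_mul_left, map_mul, map_mul, ← mul_assoc (tl _ _), ← ha ht, mul_assoc a _ (iota _ _), ← hb (perm_inv_le a ht)]
    simp [mul_assoc]
  | inv a ha =>
    have h1 := ha (perm_apply_le a ht)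
    have h2 := psi_mul_left a a⁻¹ (perm (m + 1) a t)
    simp only [mul_inv_cancel, map_one, SemidirectProduct.one_left, Pi.one_apply, Equiv.Perm.inv_def, Equiv.symm_apply_apply] at h1 h2
    rw [map_inv (perm _), inv_inv, ← inv_eq_of_mul_eq_one_right h2.symm, map_inv, eq_mul_inv_iff_mul_eq,
      mul_assoc, ← h1]
    simp

/-- Combing: the `F ⋊ Br m` coordinate of a braid at the last strand. -/
def comb (b : Br (m + 1)) : SD m := (psi m b).left (m + 1)

def Fixes (b : Br (m + 1)) : Prop := perm (m + 1) b (m + 1) = m + 1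

theorem fixes_inv {b : Br (m + 1)} (h : Fixes b) : (perm (m + 1) b)⁻¹ (m + 1) = m + 1 := by
  rw [Equiv.Perm.inv_eq_iff_eq]; exact h.symm

theorem Fixes.mul {a b : Br (m + 1)} (ha : Fixes a) (hb : Fixes b) : Fixes (a * b) := by
  unfold Fixes at *; simp [ha, hb]

theorem Fixes.inv {b : Br (m + 1)} (h : Fixes b) : Fixes b⁻¹ := by
  unfold Fixes; rw [map_inv]; exact fixes_inv h

theorem iota_comb {b : Br (m + 1)} (h : Fixes b) : iota m (comb b) = b := by
  have := mul_tl b (le_refl (m + 1))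
  rw [fixes_inv h, tl_of_le le_rfl, mul_one, one_mul] at this
  exact this.symm

theorem comb_mul {a : Br (m + 1)} (ha : Fixes a) (b : Br (m + 1)) : comb (a * b) = comb a * comb b := by
  rw [comb, psi_mul_left, fixes_inv ha]; rfl

theorem comb_inv {a : Br (m + 1)} (ha : Fixes a) : comb a⁻¹ = (comb a)⁻¹ := by
  have := comb_mul ha a⁻¹
  rw [mul_inv_cancel, comb, map_one] at this
  exact (inv_eq_of_mul_eq_one_right this.symm).symm

theorem perm_inc (b : Br m) : perm (m + 1) (inc m b) = perm m b := by
  have : (perm (m + 1)).comp (inc m) = perm m := hom_ext fun i hi => by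
    simp [inc_sg hi, perm_sg hi, perm_sg (by omega : i < m + 1)]
  exact DFunLike.congr_fun this b

theorem perm_xb (j : ℕ) (hj : j ≤ m) : perm (m + 1) (xb m j) = 1 := by
  simp [xb, perm_sg (by omega : j < m + 1), pow_two]

theorem perm_xhom (v : F m) : perm (m + 1) (xhom m v) = 1 := by
  have : (perm (m + 1)).comp (xhom m) = 1 := F_ext fun k hk => by
    rw [MonoidHom.comp_apply, xhom_gf (by omega)]
    have : ∀ k ≤ m + 1, perm (m + 1) (gb m k) = 1 := by
      intro k
      induction k with
      | zero => simp [gb]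
      | succ k ih => intro hk; rw [gb, map_mul, ih (by omega), perm_xb _ (by omega), one_mul]
    exact this _ (by omega)
  exact DFunLike.congr_fun this v

theorem perm_iota (g : SD m) : perm (m + 1) (iota m g) = perm m g.right := by
  rw [iota_apply, map_mul, perm_xhom, perm_inc, one_mul]

theorem fixes_iota (g : SD m) : Fixes (iota m g) := by
  rw [Fixes, perm_iota, perm_apply_of_lt _ (by omega)]

theorem sd_hom_ext {G : Type*} [Group G] {f g : SD m →* G}
    (h1 : ∀ i < m, f (SemidirectProduct.inr (sg m i)) = g (SemidirectProduct.inr (sg m i)))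
    (h2 : ∀ j ≤ m, f (SemidirectProduct.inl (xf m j)) = g (SemidirectProduct.inl (xf m j))) : f = g := by
  refine SemidirectProduct.hom_ext (F_ext fun k hk => ?_) (hom_ext h1)
  have : ∀ k ≤ m + 1, f (SemidirectProduct.inl (gf m k)) = g (SemidirectProduct.inl (gf m k)) := by
    intro k
    induction k with
    | zero => simp
    | succ k ih =>
      intro hk
      have : gf m (k + 1) = xf m k * gf m k := by simp [xf]
      rw [this, map_mul, map_mul, map_mul, ih (by omega), h2 k (by omega)]
  exact this _ (by omega)

theorem comb_iota (g : SD m) : comb (iota m g) = g := by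
  let f : SD m →* SD m := 
    { toFun := fun g => comb (iota m g)
      map_one' := by simp [comb]
      map_mul' := fun a b => by rw [map_mul, comb_mul (fixes_iota a)] }
  have : f = MonoidHom.id _ := by
    refine sd_hom_ext (fun i hi => ?_) ?_
    · change comb (iota m _) = _
      rw [iota_inr_sg hi, comb, psi_sg (by omega), combGen_left, combCoeff_gt (by omega) le_rfl]; rfl
    · have : ∀ d j, j + d = m → f (SemidirectProduct.inl (xf m j)) = (SemidirectProduct.inl (xf m j)) := by
        intro d
        induction d with
        | zero =>
          intro j hj
          obtain rfl : j = m := hj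
          change comb (iota j _) = _
          rw [xhom_inl_xf (by omega), xb_last, comb, pow_two, psi_mul_left, psi_sg (by omega),
            combGen_left, combGen_left, combCoeff_succ, perm_sg (by omega), Equiv.swap_inv,
            Equiv.swap_apply_right, combCoeff_self, mul_one]
        | succ d ih =>
          intro j hj
          have h1 := ih (j + 1) (by omega)
          change comb (iota m _) = _ at h1
          change comb (iota m _) = _
          have hf : Fixes (sg (m + 1) j) := by
            rw [← iota_inr_sg (by omega)]; exact fixes_iota _
          have hc : comb (sg (m + 1) j) = SemidirectProduct.inr (sg m j) := by
            rw [comb, psi_sg (by omega), combGen_left, combCoeff_gt (by omega) le_rfl]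
          rw [xhom_inl_xf (by omega)] at h1
          have hx : Fixes (xb m (j + 1)) := by rw [← xhom_inl_xf (by omega)]; exact fixes_iota _
          rw [xhom_inl_xf (by omega), ← sg_xb_succ (by omega), comb_mul (hf.mul hx), comb_mul hf,
            comb_inv hf, h1, hc, inr_mul_inl, act_sg_xf_succ (by omega), mul_inv_cancel_right]
      intro j hj
      exact this (m - j) j (by omega)
  exact DFunLike.congr_fun this g

theorem iota_injective : Function.Injective (iota m) := fun a b h => by
  rw [← comb_iota a, h, comb_iota]

theorem xhom_injective : Function.Injective (xhom m) := fun a b h => by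
  have : iota m (SemidirectProduct.inl a) = iota m (SemidirectProduct.inl b) := by
    simpa [iota] using h
  exact SemidirectProduct.inl_injective (iota_injective this)

theorem inc_injective : Function.Injective (inc m) := fun a b h => by
  have : iota m (SemidirectProduct.inr a) = iota m (SemidirectProduct.inr b) := by
    simpa [iota] using h
  exact SemidirectProduct.inr_injective (iota_injective this)

theorem exists_decomp {b : Br (m + 1)} (h : Fixes b) : ∃ v b', b = xhom m v * inc m b' :=
  ⟨(comb b).left, (comb b).right, by rw [← iota_apply, iota_comb h]⟩

theorem decomp_inj {u v : F m} {a b : Br m} (h : xhom m u * inc m a = xhom m v * inc m b) :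
    u = v ∧ a = b := by
  have : iota m ⟨u, a⟩ = iota m ⟨v, b⟩ := h
  have := iota_injective this
  exact ⟨congrArg SemidirectProduct.left this, congrArg SemidirectProduct.right this⟩

end Braid

namespace Braid
section FreeGroupFacts
variable {α : Type*}

open FreeGroup

theorem reduced_append_singleton [DecidableEq α] {W : List (α × Bool)} (hW : IsReduced W) {x : α × Bool}
    (h : ∀ y ∈ W.getLast?, y.1 ≠ x.1) : IsReduced (W ++ [x]) := by
  unfold FreeGroup.IsReduced at *
  rw [List.isChain_append]
  refine ⟨hW, by simp, ?_⟩
  intro y hy z hz e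
  simp at hz
  subst hz
  exact absurd e (h y hy)

theorem exists_zpow_of_commute_of (a : α) (v : FreeGroup α) (h : Commute (of a) v) :
    ∃ j : ℤ, v = of a ^ j := by
  classical
  induction hn : v.toWord.length using Nat.strong_induction_on generalizing v with
  | _ n ih =>
  subst hn
  by_cases h1 : ∃ s W, v.toWord = (a, s) :: W
  · obtain ⟨s, W, hW⟩ := h1
    have hv : v = of a ^ (if s then (1 : ℤ) else -1) * mk W := by
      conv_lhs => rw [← mk_toWord (x := v), hW]
      cases s <;> simp [of, inv_mk, invRev]
    have hr : IsReduced W := by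
      have h := isReduced_toWord (x := v)
      rw [hW] at h
      exact List.IsChain.tail h
    have hc : Commute (of a) (mk W) := by
      have e : mk W = (of a ^ (if s then (1 : ℤ) else -1))⁻¹ * v := by rw [hv]; group
      rw [e]
      exact (((Commute.refl (of a)).zpow_right _).inv_right).mul_right h
    obtain ⟨j, hj⟩ := ih _ (by rw [toWord_mk, hr.reduce_eq, hW]; simp) (mk W) hc rfl
    exact ⟨_ , by rw [hv, hj, ← zpow_add]⟩
  by_cases h2 : ∃ s W, v.toWord = W ++ [(a, s)]
  · obtain ⟨s, W, hW⟩ := h2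
    have hv : v = mk W * of a ^ (if s then (1 : ℤ) else -1) := by
      conv_lhs => rw [← mk_toWord (x := v), hW]
      cases s <;> simp [of, inv_mk, invRev]
    have hr : IsReduced W := List.IsChain.left_of_append (hW ▸ isReduced_toWord (x := v))
    have hc : Commute (of a) (mk W) := by
      have e : mk W = v * (of a ^ (if s then (1 : ℤ) else -1))⁻¹ := by rw [hv]; group
      rw [e]
      exact h.mul_right (((Commute.refl (of a)).zpow_right _).inv_right)
    obtain ⟨j, hj⟩ := ih _ (by rw [toWord_mk, hr.reduce_eq, hW]; simp) (mk W) hc rfl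
    exact ⟨_ , by rw [hv, hj, ← zpow_add]⟩
  rcases hW : v.toWord with _ | ⟨x, W⟩
  · exact ⟨0, by rw [toWord_eq_nil_iff.1 hW]; simp⟩
  exfalso
  have hr : IsReduced (x :: W) := hW ▸ isReduced_toWord
  have hx : x.1 ≠ a := fun e => h1 ⟨x.2, W, by rw [hW, ← e]⟩
  have e1 : (of a * v).toWord = (a, true) :: x :: W := by
    rw [toWord_mul, toWord_of, hW]
    refine IsReduced.reduce_eq ?_
    unfold FreeGroup.IsReduced at *
    simp only [List.singleton_append, List.isChain_cons_cons]
    exact ⟨fun e => absurd e.symm hx, hr⟩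
  have e2 : (v * of a).toWord = x :: W ++ [(a, true)] := by
    rw [toWord_mul, toWord_of, hW]
    refine IsReduced.reduce_eq (reduced_append_singleton hr ?_)
    intro y hy e
    rw [Option.mem_def, List.getLast?_eq_some_iff] at hy
    obtain ⟨ys, hys⟩ := hy
    simp at e
    exact h2 ⟨y.2, ys, by rw [hW, hys, ← e]⟩
  rw [h.eq, e2] at e1
  simp at e1
  exact hx (by rw [e1.1])

theorem subsingleton_of_central {x : FreeGroup α} (hx : x ≠ 1) (h : ∀ u, Commute u x) :
    Subsingleton α := by
  classical
  refine ⟨fun a b => ?_⟩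
  by_contra hab
  obtain ⟨j, hj⟩ := exists_zpow_of_commute_of a x (h _)
  obtain ⟨k, hk⟩ := exists_zpow_of_commute_of b x (h _)
  let f : FreeGroup α →* Multiplicative ℤ := FreeGroup.lift fun t => if t = a then Multiplicative.ofAdd 1 else 1
  have h1 : f x = Multiplicative.ofAdd j := by
    rw [hj]; simp [f, ← ofAdd_zsmul]
  have h2 : f x = 1 := by
    rw [hk]; simp [f, Ne.symm hab]
  rw [h1] at h2
  have : j = 0 := by simpa using h2
  exact hx (by rw [hj, this, zpow_zero])

/-- Centralizers of nontrivial elements of a free group are cyclic. -/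
theorem exists_root {x : FreeGroup α} (hx : x ≠ 1) :
    ∃ d : FreeGroup α, ∀ u, Commute u x → ∃ k : ℤ, u = d ^ k := by
  let C := Subgroup.centralizer {x}
  have hC : ∀ {u}, u ∈ C ↔ Commute u x := fun {u} => by
    rw [Subgroup.mem_centralizer_singleton_iff]; exact ⟨fun h => h, fun h => h⟩
  let e := IsFreeGroup.toFreeGroup C
  let x' : C := ⟨x, hC.2 (Commute.refl x)⟩
  have hs : Subsingleton (IsFreeGroup.Generators C) := by
    refine subsingleton_of_central (x := e x') ?_ ?_
    · intro h
      rw [map_eq_one_iff e e.injective] at h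
      exact hx (congrArg Subtype.val h)
    · intro u
      obtain ⟨u, rfl⟩ := e.surjective u
      have : Commute u x' := Subtype.ext (hC.1 u.2).eq
      exact this.map e
  have hn : Nonempty (IsFreeGroup.Generators C) := by
    by_contra hn
    rw [not_nonempty_iff] at hn
    apply hx
    have : x' = 1 := e.injective (Subsingleton.elim _ _)
    exact congrArg Subtype.val this
  obtain ⟨s⟩ := hn
  refine ⟨(e.symm (FreeGroup.of s) : C), fun u hu => ?_⟩
  have hz : e ⟨u, hC.2 hu⟩ ∈ Subgroup.zpowers (FreeGroup.of s) := by
    have : ∀ w : FreeGroup (IsFreeGroup.Generators C), w ∈ Subgroup.zpowers (FreeGroup.of s) := by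
      intro w
      induction w using FreeGroup.induction_on with
      | C1 => exact one_mem _
      | of t => rw [Subsingleton.elim t s]; exact Subgroup.mem_zpowers _
      | inv_of t h => exact inv_mem h
      | mul a b ha hb => exact mul_mem ha hb
    exact this _
  obtain ⟨k, hk⟩ := hz
  refine ⟨k, ?_⟩
  have := congrArg e.symm hk
  simp only [map_zpow, MulEquiv.symm_apply_apply] at this
  have := congrArg Subtype.val this
  simpa using this.symm

theorem commute_trans {x u v : FreeGroup α} (hx : x ≠ 1) (hu : Commute u x) (hv : Commute v x) :
    Commute u v := by
  obtain ⟨d, hd⟩ := exists_root hx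
  obtain ⟨j, rfl⟩ := hd u hu
  obtain ⟨k, rfl⟩ := hd v hv
  exact (Commute.refl d).zpow_zpow j k

/-- A hom from a perfect group to a free group is trivial. -/
theorem hom_eq_one_of_perfect {P : Type*} [Group P] (hP : commutator P = ⊤)
    (f : P →* FreeGroup α) (p : P) : f p = 1 := by
  classical
  let R := f.range
  let e := IsFreeGroup.toFreeGroup R
  have hab : ∀ g : P →* Multiplicative ℤ, ∀ p, g p = 1 := fun g p => by
    have : p ∈ g.ker := Abelianization.commutator_subset_ker g (by rw [hP]; trivial)
    exact this
  have he : IsEmpty (IsFreeGroup.Generators R) := by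
    refine ⟨fun s => ?_⟩
    let g : FreeGroup (IsFreeGroup.Generators R) →* Multiplicative ℤ :=
      FreeGroup.lift fun _ => Multiplicative.ofAdd 1
    obtain ⟨q, hq⟩ := f.rangeRestrict_surjective (e.symm (FreeGroup.of s))
    have := hab (g.comp (e.toMonoidHom.comp f.rangeRestrict)) q
    simp [hq, g] at this
  have : f.rangeRestrict p = 1 := e.injective (Subsingleton.elim _ _)
  exact congrArg Subtype.val this

theorem eq_of_commute_zpow {G : Type*} [Group G] [IsMulTorsionFree G] {x u : G} {j : ℤ} (hj : j ≠ 0)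
    (h : Commute u (x ^ j)) : Commute u x := by
  have h1 : (u * x * u⁻¹) ^ j = x ^ j := by
    rw [conj_zpow, h.eq, mul_inv_cancel_right]
  have h2 := zpow_left_injective hj h1
  exact mul_inv_eq_iff_eq_mul.1 h2

end FreeGroupFacts
end Braid

namespace Braid
section Blocks
variable {X : Type*}

open FreeGroup

/-- The group element of a signed letter. -/
def letter (l : X × Bool) : FreeGroup X := FreeGroup.mk [l]

theorem letter_true (x : X) : letter (x, true) = of x := rfl
theorem letter_false (x : X) : letter (x, false) = (of x)⁻¹ := rfl

/-- The inverse letter. -/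
def bar (l : X × Bool) : X × Bool := (l.1, !l.2)

theorem letter_bar (l : X × Bool) : letter (bar l) = (letter l)⁻¹ := by
  obtain ⟨x, s⟩ := l
  cases s <;> simp [bar, letter_true, letter_false]

/-- The product of the blocks `l y^p`. -/
def blockVal (y : X) : List ((X × Bool) × ℤ) → FreeGroup X
  | [] => 1
  | (l, p) :: M => letter l * of y ^ p * blockVal y M

theorem blockVal_append (y : X) (M N : List ((X × Bool) × ℤ)) :
    blockVal y (M ++ N) = blockVal y M * blockVal y N := by
  induction M with
  | nil => simp [blockVal]
  | cons x M ih => simp [blockVal, ih, mul_assoc]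

theorem blockVal_replicate (y : X) (M : List ((X × Bool) × ℤ)) (k : ℕ) :
    blockVal y (List.replicate k M).flatten = blockVal y M ^ k := by
  induction k with
  | zero => simp [blockVal]
  | succ k ih => rw [List.replicate_succ, List.flatten_cons, blockVal_append, ih, pow_succ']

/-- Adjacent blocks do not cancel. -/
def NonCancel (a b : (X × Bool) × ℤ) : Prop := a.2 = 0 → b.1 ≠ bar a.1

def blockWord (y : X) : List ((X × Bool) × ℤ) → List (X × Bool)
  | [] => []
  | (l, p) :: M => l :: (List.replicate p.natAbs (y, decide (0 ≤ p)) ++ blockWord y M)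

def blockLen : List ((X × Bool) × ℤ) → ℕ
  | [] => 0
  | x :: M => 1 + x.2.natAbs + blockLen M

theorem blockLen_append (M N : List ((X × Bool) × ℤ)) :
    blockLen (M ++ N) = blockLen M + blockLen N := by
  induction M with
  | nil => simp [blockLen]
  | cons x M ih => simp [blockLen, ih, add_assoc]

theorem blockLen_replicate (M : List ((X × Bool) × ℤ)) (k : ℕ) :
    blockLen (List.replicate k M).flatten = k * blockLen M := by
  induction k with
  | zero => simp [blockLen]
  | succ k ih => rw [List.replicate_succ, List.flatten_cons, blockLen_append, ih]; ring

theorem length_blockWord (y : X) (M : List ((X × Bool) × ℤ)) :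
    (blockWord y M).length = blockLen M := by
  induction M with
  | nil => simp [blockWord, blockLen]
  | cons x M ih => simp [blockWord, blockLen, ih]; omega

theorem mk_replicate (y : X) (p : ℤ) :
    FreeGroup.mk (List.replicate p.natAbs (y, decide (0 ≤ p))) = of y ^ p := by
  classical
  have h : ∀ n : ℕ, FreeGroup.mk (List.replicate n (y, true)) = of y ^ n := fun n => by
    rw [← toWord_of_pow, mk_toWord]
  rcases Int.le_total 0 p with hp | hp
  · obtain ⟨n, rfl⟩ := Int.eq_ofNat_of_zero_le hp
    simpa using h n
  · obtain ⟨n, hn⟩ := Int.eq_ofNat_of_zero_le (neg_nonneg.2 hp)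
    obtain rfl : p = -n := by omega
    rcases Nat.eq_zero_or_pos n with rfl | hn
    · simp
      rfl
    · have : ¬ (0 ≤ -(n : ℤ)) := by omega
      simp only [this, decide_false, Int.natAbs_neg, Int.natAbs_natCast, zpow_neg, zpow_natCast]
      rw [← h n, inv_mk]
      congr 1
      simp [invRev]

theorem mk_blockWord (y : X) (M : List ((X × Bool) × ℤ)) :
    FreeGroup.mk (blockWord y M) = blockVal y M := by
  induction M with
  | nil => rfl
  | cons x M ih =>
    obtain ⟨l, p⟩ := x
    rw [blockWord, blockVal, ← ih, ← mk_replicate, letter, mul_mk, mul_mk]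
    simp

theorem isReduced_blockWord {y : X} {M : List ((X × Bool) × ℤ)} (hy : ∀ x ∈ M, x.1.1 ≠ y)
    (h : M.IsChain NonCancel) : FreeGroup.IsReduced (blockWord y M) := by
  induction M with
  | nil => simp [blockWord, FreeGroup.IsReduced]
  | cons x M ih =>
    obtain ⟨l, p⟩ := x
    have h1 := ih (fun x hx => hy x (List.mem_cons_of_mem _ hx)) h.tail
    have hl : l.1 ≠ y := hy (l, p) (by simp)
    rw [blockWord]
    unfold FreeGroup.IsReduced at *
    rw [List.isChain_cons, List.isChain_append]
    refine ⟨?_, List.isChain_replicate_of_rel _ (fun _ => rfl), h1, ?_⟩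
    · intro z hz e
      rcases hp : p.natAbs with _ | k
      · rw [hp] at hz
        rcases M with _ | ⟨⟨l', q⟩, M⟩
        · simp [blockWord] at hz
        · simp [blockWord] at hz
          subst hz
          rw [List.isChain_cons_cons] at h
          have := h.1 (by simpa using hp)
          simp only [bar] at this
          by_contra hne
          apply this
          obtain ⟨a, b⟩ := l
          obtain ⟨c, d⟩ := l'
          cases b <;> cases d <;> simp_all
      · rw [hp] at hz
        simp [List.replicate_succ] at hz
        subst hz
        exact absurd e hl
    · intro z hz w hw e
      have hz1 : z.1 = y := by
        have := List.mem_of_getLast? hz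
        rw [List.eq_of_mem_replicate this]
      rcases M with _ | ⟨⟨l', q⟩, M⟩
      · simp [blockWord] at hw
      · simp [blockWord] at hw
        subst hw
        exact absurd (e.symm.trans hz1) (hy (l', q) (by simp))

theorem norm_blockVal [DecidableEq X] {y : X} {M : List ((X × Bool) × ℤ)} (hy : ∀ x ∈ M, x.1.1 ≠ y)
    (h : M.IsChain NonCancel) : (blockVal y M).norm = blockLen M := by
  rw [FreeGroup.norm, ← mk_blockWord, toWord_mk, (isReduced_blockWord hy h).reduce_eq,
    length_blockWord]

theorem isChain_replicate_flatten {β : Type*} {R : β → β → Prop} {x : β} {t : List β}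
    (h : (x :: t ++ [x]).IsChain R) (k : ℕ) : ((List.replicate k (x :: t)).flatten ++ [x]).IsChain R := by
  induction k with
  | zero => simp
  | succ k ih =>
    rw [List.replicate_succ, List.flatten_cons, List.append_assoc]
    rw [List.isChain_append] at h ⊢
    refine ⟨h.1, ih, ?_⟩
    intro z hz w hw
    refine h.2.2 z hz w ?_
    cases k with
    | zero => simpa using hw
    | succ k => simpa [List.replicate_succ] using hw

theorem blockLen_le_of_isConj {y : X} {x x' : (X × Bool) × ℤ} {t t' : List ((X × Bool) × ℤ)}
    (hy : ∀ z ∈ x :: t, z.1.1 ≠ y) (hy' : ∀ z ∈ x' :: t', z.1.1 ≠ y)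
    (h : (x :: t ++ [x]).IsChain NonCancel) (h' : (x' :: t' ++ [x']).IsChain NonCancel)
    (hc : IsConj (blockVal y (x :: t)) (blockVal y (x' :: t'))) :
    blockLen (x' :: t') ≤ blockLen (x :: t) := by
  classical
  obtain ⟨g, hg⟩ := isConj_iff.1 hc
  have key : ∀ k : ℕ, k * blockLen (x' :: t') ≤ k * blockLen (x :: t) + 2 * g.norm := by
    intro k
    have m1 : ∀ {x : (X × Bool) × ℤ} {t : List ((X × Bool) × ℤ)}, (∀ z ∈ x :: t, z.1.1 ≠ y) →
        (x :: t ++ [x]).IsChain NonCancel → (blockVal y (x :: t) ^ k).norm = k * blockLen (x :: t) := by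
      intro x t hy h
      rw [← blockVal_replicate, ← blockLen_replicate]
      refine norm_blockVal ?_ (isChain_replicate_flatten h k).left_of_append
      intro z hz
      obtain ⟨l, hl, hz⟩ := List.mem_flatten.1 hz
      rw [List.eq_of_mem_replicate hl] at hz
      exact hy z hz
    rw [← m1 hy' h', ← m1 hy h, ← hg, conj_pow]
    have a1 := norm_mul_le (g * blockVal y (x :: t) ^ k) g⁻¹
    have a2 := norm_mul_le g (blockVal y (x :: t) ^ k)
    have a3 := norm_inv_eq (x := g)
    omega
  by_contra hlt
  have := key (2 * g.norm + 1)
  nlinarith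

section Twist
variable (A B : X → ℤ)

def sA (l : X × Bool) : ℤ := if l.2 then A l.1 else - B l.1
def sB (l : X × Bool) : ℤ := if l.2 then B l.1 else - A l.1

def hd (e : ℤ) : List ((X × Bool) × ℤ) → ℤ
  | [] => e
  | x :: _ => sA A B x.1

def tw (n e : ℤ) : List ((X × Bool) × ℤ) → List ((X × Bool) × ℤ)
  | [] => []
  | x :: M => (x.1, x.2 + n * (sB A B x.1 + hd A B e M)) :: tw n e M

theorem twist_letter {y : X} {τ : FreeGroup X →* FreeGroup X} {n : ℤ}
    (hτ : ∀ x, x ≠ y → τ (of x) = of y ^ (n * A x) * of x * of y ^ (n * B x))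
    {l : X × Bool} (hl : l.1 ≠ y) :
    τ (letter l) = of y ^ (n * sA A B l) * letter l * of y ^ (n * sB A B l) := by
  obtain ⟨x, s⟩ := l
  cases s
  · rw [letter_false, _root_.map_inv, hτ x hl]
    simp [sA, sB, mul_assoc]
  · rw [letter_true, hτ x hl]
    simp [sA, sB]

theorem twist_blockVal {y : X} {τ : FreeGroup X →* FreeGroup X} {n : ℤ} (hy : τ (of y) = of y)
    (hτ : ∀ x, x ≠ y → τ (of x) = of y ^ (n * A x) * of x * of y ^ (n * B x))
    {M : List ((X × Bool) × ℤ)} (hM : ∀ x ∈ M, x.1.1 ≠ y) (e : ℤ) :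
    τ (blockVal y M) * of y ^ (n * e) = of y ^ (n * hd A B e M) * blockVal y (tw A B n e M) := by
  induction M with
  | nil => simp [blockVal, hd, tw]
  | cons x M ih =>
    obtain ⟨l, p⟩ := x
    have h1 := ih (fun x hx => hM x (List.mem_cons_of_mem _ hx))
    rw [blockVal, _root_.map_mul, _root_.map_mul, map_zpow, hy, mul_assoc, h1,
      twist_letter A B hτ (hM (l, p) (by simp)), tw, blockVal, hd]
    simp only [mul_add, zpow_add]
    have : Commute (of y ^ (n * sB A B l)) (of y ^ p) := (Commute.refl _).zpow_zpow _ _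
    simp only [mul_assoc]
    rw [← mul_assoc (of y ^ (n * sB A B l)), this.eq]
    simp only [mul_assoc]

theorem sB_add_sA_bar (l : X × Bool) : sB A B l + sA A B (bar l) = 0 := by
  obtain ⟨x, s⟩ := l
  cases s <;> simp [sA, sB, bar]

theorem tw_isChain (n : ℤ) {z : (X × Bool) × ℤ} (q : ℤ) {M : List ((X × Bool) × ℤ)}
    (h : (M ++ [z]).IsChain NonCancel) :
    (tw A B n (sA A B z.1) M ++ [(z.1, q)]).IsChain NonCancel := by
  induction M with
  | nil => simp [tw]
  | cons x M ih =>
    rw [List.cons_append, List.isChain_cons] at h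
    rw [tw, List.cons_append, List.isChain_cons]
    refine ⟨?_, ih h.2⟩
    rcases M with _ | ⟨x', M⟩
    · intro w hw
      have h1 := h.1 z (by simp)
      simp [tw] at hw
      subst hw
      intro h2 h3
      refine h1 ?_ h3
      simp only at h2 h3
      simpa [hd, h3, sB_add_sA_bar] using h2
    · intro w hw
      have h1 := h.1 x' (by simp)
      simp [tw] at hw
      subst hw
      intro h2 h3
      refine h1 ?_ h3
      simp only at h2 h3
      simpa [hd, h3, sB_add_sA_bar] using h2

theorem natAbs_le_blockLen {M : List ((X × Bool) × ℤ)} {x : (X × Bool) × ℤ} (hx : x ∈ M) :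
    x.2.natAbs ≤ blockLen M := by
  induction M with
  | nil => simp at hx
  | cons z M ih =>
    rcases List.mem_cons.1 hx with rfl | hx
    · simp [blockLen]; omega
    · have := ih hx
      simp [blockLen]; omega

theorem isChain_of_tw_le (z : (X × Bool) × ℤ) {C : ℕ} {M : List ((X × Bool) × ℤ)}
    (h1 : ∀ x ∈ M, x.2.natAbs ≤ C) (h2 : ∀ x ∈ tw A B (2 * C + 1) (sA A B z.1) M, x.2.natAbs ≤ C) :
    (M ++ [z]).IsChain fun a b => sB A B a.1 + sA A B b.1 = 0 := by
  induction M with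
  | nil => simp
  | cons x M ih =>
    rw [List.cons_append, List.isChain_cons]
    refine ⟨?_, ih (fun x hx => h1 x (by simp [hx])) (fun x hx => h2 x (by simp [tw, hx]))⟩
    have hx := h1 x (by simp)
    have hx' := h2 _ (by rw [tw]; exact List.mem_cons_self)
    intro w hw
    have hw' : hd A B (sA A B z.1) M = sA A B w.1 := by
      rcases M with _ | ⟨x', M⟩
      · simp at hw; simp [hd, hw]
      · simp at hw; simp [hd, hw]
    rw [hw'] at hx'
    simp only at hx'
    generalize sB A B x.1 + sA A B w.1 = d at *
    by_contra hd0
    have : (2 * (C : ℤ) + 1) ≤ |(2 * (C : ℤ) + 1) * d| := by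
      rw [abs_mul, abs_of_nonneg (by omega : (0:ℤ) ≤ 2 * C + 1)]
      have := Int.one_le_abs hd0
      nlinarith
    rcases abs_cases ((2 * (C : ℤ) + 1) * d) with h | h <;> omega

theorem tw_mem_ne {y : X} (n e : ℤ) {M : List ((X × Bool) × ℤ)} (hM : ∀ x ∈ M, x.1.1 ≠ y) :
    ∀ x ∈ tw A B n e M, x.1.1 ≠ y := by
  induction M with
  | nil => simp [tw]
  | cons x M ih =>
    intro w hw
    rw [tw, List.mem_cons] at hw
    rcases hw with rfl | hw
    · exact hM x (by simp)
    · exact ih (fun x hx => hM x (by simp [hx])) w hw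

/-- If a twist along `y` preserves the conjugacy class of a cyclically reduced block word, then the
twisting exponents between consecutive blocks vanish. -/
theorem twist_isChain {y : X} {τ : FreeGroup X →* FreeGroup X} (hy : τ (of y) = of y)
    (hτ : ∀ x, x ≠ y → τ (of x) = of y ^ A x * of x * of y ^ B x)
    {x : (X × Bool) × ℤ} {t : List ((X × Bool) × ℤ)} (hM : ∀ z ∈ x :: t, z.1.1 ≠ y)
    (h : (x :: t ++ [x]).IsChain NonCancel) (hc : IsConj (τ (blockVal y (x :: t))) (blockVal y (x :: t))) :
    (x :: t ++ [x]).IsChain fun a b => sB A B a.1 + sA A B b.1 = 0 := by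
  let τn : ℕ → (FreeGroup X →* FreeGroup X) := fun n => Nat.rec (MonoidHom.id _) (fun _ f => τ.comp f) n
  have hn0 : ∀ n, τn (n + 1) = τ.comp (τn n) := fun n => rfl
  have hny : ∀ n, τn n (of y) = of y := by
    intro n
    induction n with
    | zero => rfl
    | succ n ih => rw [hn0, MonoidHom.comp_apply, ih, hy]
  have hnx : ∀ n x, x ≠ y → τn n (of x) = of y ^ ((n : ℤ) * A x) * of x * of y ^ ((n : ℤ) * B x) := by
    intro n x hx
    induction n with
    | zero => simp [τn]
    | succ n ih =>
      rw [hn0, MonoidHom.comp_apply, ih, _root_.map_mul, _root_.map_mul, map_zpow, map_zpow, hy, hτ x hx]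
      push_cast
      rw [add_mul, add_mul, one_mul, one_mul, zpow_add, add_comm _ (B x), zpow_add]
      simp only [mul_assoc]
  have hnc : ∀ n, IsConj (τn n (blockVal y (x :: t))) (blockVal y (x :: t)) := by
    intro n
    induction n with
    | zero => exact IsConj.refl _
    | succ n ih =>
      rw [hn0, MonoidHom.comp_apply]
      exact (τ.map_isConj ih).trans hc
  let C := blockLen (x :: t)
  have hm : ∀ n : ℕ, blockLen (tw A B n (sA A B x.1) (x :: t)) ≤ C := by
    intro n
    have h1 := twist_blockVal A B (hny n) (hnx n) hM (sA A B x.1)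
    have h2 := tw_isChain A B n (x.2 + n * (sB A B x.1 + hd A B (sA A B x.1) t)) h
    have h3 := tw_mem_ne A B n (sA A B x.1) hM
    refine blockLen_le_of_isConj hM h3 h h2 ?_
    refine (hnc n).symm.trans (IsConj.symm ?_)
    rw [isConj_iff]
    refine ⟨of y ^ (n * sA A B x.1), ?_⟩
    change _ * blockVal y (tw A B n (sA A B x.1) (x :: t)) * _ = _
    rw [mul_inv_eq_iff_eq_mul, h1]; rfl
  refine isChain_of_tw_le A B x (C := C) (fun z hz => natAbs_le_blockLen hz) fun z hz => ?_
  refine (natAbs_le_blockLen hz).trans ?_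
  have := hm (2 * C + 1)
  push_cast at this
  exact this

end Twist

theorem isConj_mul_comm {G : Type*} [Group G] (a b : G) : IsConj (a * b) (b * a) :=
  isConj_iff.2 ⟨b, by group⟩

theorem exists_block_form_aux (y : X) (n : ℕ) : ∀ (M : List ((X × Bool) × ℤ)) (k : ℤ), M.length = n →
    (∀ z ∈ M, z.1.1 ≠ y) →
    ((∃ j : ℤ, IsConj (of y ^ k * blockVal y M) (of y ^ j)) ∨
      ∃ x t, (∀ z ∈ x :: t, z.1.1 ≠ y) ∧ (x :: t ++ [x]).IsChain NonCancel ∧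
        IsConj (of y ^ k * blockVal y M) (blockVal y (x :: t))) := by
  induction n using Nat.strong_induction_on with
  | _ n ih =>
  intro M k hn hM
  rcases List.eq_nil_or_concat M with rfl | ⟨M', ⟨l0, p0⟩, rfl⟩
  · left; exact ⟨k, by rw [blockVal, mul_one]⟩
  simp only [List.concat_eq_append] at *
  have hc0 : IsConj (of y ^ k * blockVal y (M' ++ [(l0, p0)])) (blockVal y (M' ++ [(l0, p0 + k)])) := by
    refine (isConj_mul_comm _ _).trans ?_
    rw [blockVal_append, blockVal_append]
    simp only [blockVal, zpow_add, mul_assoc, mul_one]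
    exact IsConj.refl _
  suffices H : ∀ N : List ((X × Bool) × ℤ), N.length = n → N ≠ [] → (∀ z ∈ N, z.1.1 ≠ y) →
    ((∃ j : ℤ, IsConj (blockVal y N) (of y ^ j)) ∨
      ∃ x t, (∀ z ∈ x :: t, z.1.1 ≠ y) ∧ (x :: t ++ [x]).IsChain NonCancel ∧
        IsConj (blockVal y N) (blockVal y (x :: t))) by
    rcases H (M' ++ [(l0, p0 + k)]) (by simpa using hn) (by simp) (by
      intro z hz
      rcases List.mem_append.1 hz with hz | hz
      · exact hM z (by simp [hz])
      · simp at hz; subst hz; exact hM (l0, p0) (by simp)) with ⟨j, hj⟩ | ⟨x, t, h1, h2, h3⟩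
    · exact Or.inl ⟨j, hc0.trans hj⟩
    · exact Or.inr ⟨x, t, h1, h2, hc0.trans h3⟩
  intro N hN hne hNy
  rcases N with _ | ⟨x, t⟩
  · simp at hne
  by_cases hch : (x :: t ++ [x]).IsChain NonCancel
  · exact Or.inr ⟨x, t, hNy, hch, IsConj.refl _⟩
  have hsplit : ∃ a b T, IsConj (blockVal y (x :: t)) (blockVal y (a :: b :: T)) ∧ ¬ NonCancel a b ∧
      (∀ z ∈ a :: b :: T, z ∈ x :: t) ∧ (a :: b :: T).length = n := by
    obtain ⟨i, hi, hnot⟩ := List.exists_not_getElem_of_not_isChain hch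
    have hrot : ∀ i, IsConj (blockVal y (x :: t)) (blockVal y ((x :: t).rotate i)) := by
      intro i
      conv_lhs => rw [← List.take_append_drop (i % (x :: t).length) (x :: t)]
      rw [List.rotate_eq_drop_append_take_mod, blockVal_append, blockVal_append]
      exact isConj_mul_comm _ _
    have hcan : ∀ a : (X × Bool) × ℤ, NonCancel a a := by
      intro a _ h
      obtain ⟨⟨u, s⟩, p⟩ := a
      cases s <;> simp [bar] at h
    rcases t with _ | ⟨x2, t⟩
    · exfalso
      simp at hi
      subst hi
      exact hnot (hcan x)
    generalize hL : x :: x2 :: t = L at *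
    have hlen : 2 ≤ L.length := by rw [← hL]; simp
    have hx0 : L[0]'(by omega) = x := by simp [← hL]
    have hi' : i < L.length := by
      have : (L ++ [x]).length = L.length + 1 := by simp
      omega
    rcases hr : L.rotate i with _ | ⟨a, _ | ⟨b, T⟩⟩
    · have := congrArg List.length hr; rw [List.length_rotate] at this; simp only [List.length_nil, List.length_cons] at this; omega
    · have := congrArg List.length hr; rw [List.length_rotate] at this; simp only [List.length_nil, List.length_cons] at this; omega
    refine ⟨a, b, T, hr ▸ hrot i, ?_, ?_, ?_⟩
    · have ha : a = L[i] := by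
        have : (L.rotate i)[0]'(by simp; omega) = a := by simp [hr]
        rw [← this, List.getElem_rotate]
        simp [Nat.mod_eq_of_lt hi']
      have hb : b = (L ++ [x])[i + 1]'(by rw [List.length_append]; simp; omega) := by
        have : (L.rotate i)[1]'(by simp; omega) = b := by simp [hr]
        rw [← this, List.getElem_rotate]
        rcases Nat.lt_or_ge (i + 1) L.length with h | h
        · simp [add_comm 1 i, Nat.mod_eq_of_lt h, List.getElem_append_left, h]
        · have hh : i + 1 = L.length := by omega
          simp [add_comm 1 i, hh, hx0]
      rw [ha, hb]
      rw [List.getElem_append_left hi'] at hnot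
      exact hnot
    · intro z hz
      rw [← hr] at hz
      exact List.mem_rotate.1 hz
    · rw [← hr, List.length_rotate]; exact hN
  obtain ⟨a, b, T, hc, hnot, hmem, hlen⟩ := hsplit
  obtain ⟨l, p⟩ := a
  obtain ⟨l', p'⟩ := b
  simp only [NonCancel] at hnot
  push Not at hnot
  obtain ⟨rfl, rfl⟩ := hnot
  have hv : blockVal y ((l, 0) :: (bar l, p') :: T) = of y ^ p' * blockVal y T := by
    simp [blockVal, letter_bar, mul_assoc]
  rw [hv] at hc
  rcases ih T.length (by simp at hlen; omega) T p' rfl (fun z hz => hNy z (hmem z (by simp [hz]))) with ⟨j, hj⟩ | ⟨x', t', h1, h2, h3⟩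
  · exact Or.inl ⟨j, hc.trans hj⟩
  · exact Or.inr ⟨x', t', h1, h2, hc.trans h3⟩

theorem exists_blocks (y : X) (v : FreeGroup X) :
    ∃ (k : ℤ) (M : List ((X × Bool) × ℤ)), (∀ z ∈ M, z.1.1 ≠ y) ∧ v = of y ^ k * blockVal y M := by
  classical
  obtain ⟨L, rfl⟩ : ∃ L, v = FreeGroup.mk L := ⟨v.toWord, mk_toWord.symm⟩
  induction L with
  | nil => exact ⟨0, [], by simp, by simp [blockVal, one_eq_mk]⟩
  | cons l L ih =>
    obtain ⟨k, M, h1, h2⟩ := ih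
    have e : FreeGroup.mk (l :: L) = letter l * FreeGroup.mk L := by rw [letter, mul_mk]; rfl
    by_cases hl : l.1 = y
    · have : ∃ j : ℤ, letter l = of y ^ j := by
        obtain ⟨x, s⟩ := l
        simp at hl
        subst hl
        cases s
        · exact ⟨-1, by simp [letter_false]⟩
        · exact ⟨1, by simp [letter_true]⟩
      obtain ⟨j, hj⟩ := this
      exact ⟨j + k, M, h1, by rw [e, h2, hj, zpow_add, mul_assoc]⟩
    · refine ⟨0, (l, k) :: M, ?_, ?_⟩
      · intro z hz
        rcases List.mem_cons.1 hz with rfl | hz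
        · exact hl
        · exact h1 z hz
      · rw [e, h2]; simp [blockVal, mul_assoc]

/-- Every element is conjugate to a power of `y` or to a cyclically reduced block word. -/
theorem exists_block_form (y : X) (v : FreeGroup X) : (∃ j : ℤ, IsConj v (of y ^ j)) ∨
      ∃ x t, (∀ z ∈ x :: t, z.1.1 ≠ y) ∧ (x :: t ++ [x]).IsChain NonCancel ∧
        IsConj v (blockVal y (x :: t)) := by
  obtain ⟨k, M, h1, h2⟩ := exists_blocks y v
  rw [h2]
  exact exists_block_form_aux y _ M k rfl h1

end Blocks
end Braid

namespace Braid
section Twists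
variable {X : Type*}
open FreeGroup

/-- Kill one generator. -/
def kill [DecidableEq X] (x0 : X) : FreeGroup X →* FreeGroup X :=
  FreeGroup.lift fun x => if x = x0 then 1 else of x

/-- The exponent of one generator. -/
def expo [DecidableEq X] (z : X) : FreeGroup X →* Multiplicative ℤ :=
  FreeGroup.lift fun x => if x = z then Multiplicative.ofAdd 1 else 1

theorem hom_conj_comm {G A : Type*} [Group G] [CommGroup A] (f : G →* A) {a b : G} (h : IsConj a b) :
    f a = f b := isConj_iff_eq.1 (f.map_isConj h)

theorem hom_blockVal_of_forall {G : Type*} [Group G] (f g : FreeGroup X →* G) {y : X} (hy : f (of y) = g (of y))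
    {M : List ((X × Bool) × ℤ)} (h : ∀ z ∈ M, f (of z.1.1) = g (of z.1.1)) :
    f (blockVal y M) = g (blockVal y M) := by
  induction M with
  | nil => simp [blockVal]
  | cons x M ih =>
    obtain ⟨⟨u, s⟩, p⟩ := x
    have h1 := h ((u, s), p) (by simp)
    simp only at h1
    rw [blockVal, _root_.map_mul, _root_.map_mul, _root_.map_mul, _root_.map_mul, map_zpow, map_zpow, hy, ih fun z hz => h z (by simp [hz])]
    cases s <;> simp [letter_true, letter_false, h1]

theorem isChain_const {β : Type*} {P : β → Prop} {L : List β} (h : L.IsChain fun a b => (P a ↔ P b)) :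
    (∀ a ∈ L, P a) ∨ (∀ a ∈ L, ¬ P a) := by
  induction L with
  | nil => simp
  | cons x L ih =>
    rcases L with _ | ⟨x', L⟩
    · simp; tauto
    · rw [List.isChain_cons_cons] at h
      rcases ih h.2 with h1 | h1
      · left; intro a ha
        rcases List.mem_cons.1 ha with rfl | ha
        · exact h.1.2 (h1 _ (by simp))
        · exact h1 a ha
      · right; intro a ha
        rcases List.mem_cons.1 ha with rfl | ha
        · exact fun hh => h1 _ (by simp) (h.1.1 hh)
        · exact h1 a ha

theorem isConj_kill [DecidableEq X] {x0 y z : X} (hxy : x0 ≠ y) (hz0 : z ≠ x0) (hzy : z ≠ y)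
    {τ : FreeGroup X →* FreeGroup X} (hτ0 : τ (of x0) = (of y)⁻¹ * of x0 * of y)
    (hτ : ∀ x, x ≠ x0 → τ (of x) = of x) {v : FreeGroup X} (hv : IsConj (τ v) v)
    (he : expo z v ≠ 1) : IsConj v (kill x0 v) := by
  rcases exists_block_form y v with ⟨j, hj⟩ | ⟨x, t, h1, h2, h3⟩
  · rw [hom_conj_comm _ hj] at he
    simp [expo, Ne.symm hzy] at he
  have h4 := twist_isChain (fun x => if x = x0 then -1 else 0) (fun x => if x = x0 then 1 else 0)
    (hτ y hxy.symm) (fun x _ => by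
      by_cases hx : x = x0
      · subst hx; simp [hτ0]
      · simp [hx, hτ x hx]) h1 h2 ((τ.map_isConj h3).symm.trans (hv.trans h3))
  have h5 := isChain_const (P := fun a : (X × Bool) × ℤ => a.1.1 = x0) (h4.imp fun a b hab => by
    obtain ⟨⟨a, s⟩, p⟩ := a
    obtain ⟨⟨b, s'⟩, p'⟩ := b
    simp only [sA, sB] at hab
    by_cases ha : a = x0 <;> by_cases hb : b = x0 <;> cases s <;> cases s' <;> simp [ha, hb] at hab ⊢)
  rcases h5 with h5 | h5
  · exfalso
    apply he
    rw [hom_conj_comm _ h3]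
    refine (hom_blockVal_of_forall (expo z) 1 (by simp [expo, Ne.symm hzy]) fun w hw => ?_)
    rw [h5 w (by simp at hw ⊢; tauto)]
    simp [expo, Ne.symm hz0]
  · have : kill x0 (blockVal y (x :: t)) = blockVal y (x :: t) := by
      refine (hom_blockVal_of_forall (kill x0) (MonoidHom.id _) (by simp [kill, Ne.symm hxy]) fun w hw => ?_)
      have := h5 w (by simp at hw ⊢; tauto)
      simp [kill, this]
    have h6 := (kill x0).map_isConj h3
    rw [this] at h6
    exact h3.trans h6.symm

theorem eq_kill [DecidableEq X] {x0 y : X} (hxy : x0 ≠ y)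
    {τ : FreeGroup X →* FreeGroup X} (hτ0 : τ (of x0) = (of y)⁻¹ * of x0 * of y)
    (hτ : ∀ x, x ≠ x0 → τ (of x) = of x) {v : FreeGroup X} (hv : τ v = v) : v = kill x0 v := by
  let φ : FreeGroup X →* FreeGroup (Option X) := FreeGroup.map some
  let τ' : FreeGroup (Option X) →* FreeGroup (Option X) :=
    FreeGroup.lift fun x => if x = some x0 then (of (some y))⁻¹ * of (some x0) * of (some y) else of x
  let w := φ v * of none
  have h1 : τ' w = w := by
    have : τ'.comp φ = φ.comp τ := by
      ext x
      by_cases hx : x = x0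
      · subst hx; simp [τ', φ, hτ0]
      · simp [τ', φ, hτ x hx, hx]
    have h := DFunLike.congr_fun this v
    simp only [MonoidHom.comp_apply, hv] at h
    simp [w, h, τ']
  have h2 : expo none w ≠ 1 := by
    have : (expo none).comp φ = 1 := by
      ext x
      simp [expo, φ]
    have h := DFunLike.congr_fun this v
    simp only [MonoidHom.comp_apply, MonoidHom.one_apply] at h
    rw [_root_.map_mul, h]
    simp [expo]
  have h3 := isConj_kill (x0 := some x0) (y := some y) (z := none) (by simpa using hxy) (by simp) (by simp)
    (τ := τ') (by simp [τ']) (fun x hx => by simp [τ', hx]) (by rw [h1]) h2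
  let ψ : FreeGroup (Option X) →* FreeGroup X := FreeGroup.lift fun x => x.elim ((kill x0 v)⁻¹) of
  have h4 := ψ.map_isConj h3
  have h5 : ψ w = v * (kill x0 v)⁻¹ := by
    have : ψ.comp φ = MonoidHom.id _ := by ext x; simp [ψ, φ]
    have h := DFunLike.congr_fun this v
    simp only [MonoidHom.comp_apply, MonoidHom.id_apply] at h
    simp [w, h, ψ]
  have h6 : ψ (kill (some x0) w) = 1 := by
    have : (ψ.comp (kill (some x0))).comp φ = kill x0 := by
      ext x
      by_cases hx : x = x0
      · simp [φ, kill, hx]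
      · simp [ψ, φ, kill, hx]
    have h := DFunLike.congr_fun this v
    simp only [MonoidHom.comp_apply, MonoidHom.id_apply] at h
    simp only [w, _root_.map_mul, h]
    simp [kill, ψ]
  rw [h5, h6] at h4
  exact mul_inv_eq_one.1 (isConj_one_left.1 h4)

end Twists

section Commutator
open FreeGroup

theorem isChain_alternating {β : Type*} {x y : β} (hxy : x ≠ y) {S : β → β → Prop} (h1 : ∀ b, S x b → b = y)
    (h2 : ∀ b, S y b → b = x) (n : ℕ) : ∀ t : List β, t.length = n → (x :: t ++ [x]).IsChain S →
    ∃ k, x :: t = (List.replicate k [x, y]).flatten := by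
  induction n using Nat.strong_induction_on with
  | _ n ih =>
  intro t ht h
  rcases t with _ | ⟨z, t⟩
  · simp at h; exact absurd (h1 _ h) hxy
  rcases t with _ | ⟨w, t⟩
  · simp at h
    rw [h1 _ h.1]
    exact ⟨1, by simp⟩
  · simp only [List.cons_append, List.isChain_cons_cons] at h
    obtain rfl := h1 _ h.1
    obtain rfl := h2 _ h.2.1
    obtain ⟨k, hk⟩ := ih t.length (by simp at ht; omega) t rfl h.2.2
    exact ⟨k + 1, by rw [List.replicate_succ, List.flatten_cons, ← hk]; rfl⟩

/-- The block `a^p d^q` written with one block per letter `a`. -/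
def expand (p q : ℤ) : List ((Fin 2 × Bool) × ℤ) :=
  List.replicate (p.natAbs - 1) ((0, decide (0 ≤ p)), 0) ++ [((0, decide (0 ≤ p)), q)]

def sgnLetter (l : Fin 2 × Bool) : ℤ := if l.2 then 1 else -1

def hdSgn (e : ℤ) : List ((Fin 2 × Bool) × ℤ) → ℤ
  | [] => e
  | x :: _ => sgnLetter x.1

def reblock (e : ℤ) : List ((Fin 2 × Bool) × ℤ) → List ((Fin 2 × Bool) × ℤ)
  | [] => []
  | x :: M => expand x.2 (hdSgn e M) ++ reblock e M

theorem blockVal_expand {p : ℤ} (hp : p ≠ 0) (q : ℤ) :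
    blockVal 1 (expand p q) = of 0 ^ p * of 1 ^ q := by
  have h : ∀ (l : Fin 2 × Bool) (n : ℕ), blockVal 1 (List.replicate n (l, 0)) = letter l ^ n := by
    intro l n
    induction n with
    | zero => simp [blockVal]
    | succ n ih => rw [List.replicate_succ, blockVal, ih]; simp [pow_succ']
  rw [expand, blockVal_append, h, blockVal, blockVal, mul_one, ← mul_assoc, ← pow_succ,
    Nat.sub_add_cancel (by omega)]
  congr 1
  rcases Int.le_total 0 p with h | h
  · obtain ⟨n, rfl⟩ := Int.eq_ofNat_of_zero_le h
    simp [letter_true]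
  · obtain ⟨n, hn⟩ := Int.eq_ofNat_of_zero_le (neg_nonneg.2 h)
    obtain rfl : p = -n := by omega
    have : ¬ (0 ≤ -(n : ℤ)) := by omega
    simp only [this, decide_false, letter_false, Int.natAbs_neg, Int.natAbs_natCast, inv_pow,
      zpow_neg, zpow_natCast]

theorem letter_sgn {l : Fin 2 × Bool} (hl : l.1 ≠ 0) : letter l = of 1 ^ sgnLetter l := by
  obtain ⟨u, s⟩ := l
  obtain rfl : u = 1 := by simp at hl; omega
  cases s <;> simp [letter_true, letter_false, sgnLetter]

theorem blockVal_reblock (e : ℤ) {M : List ((Fin 2 × Bool) × ℤ)} (hM : ∀ z ∈ M, z.1.1 ≠ 0)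
    (hp : ∀ z ∈ M, z.2 ≠ 0) :
    of 1 ^ hdSgn e M * blockVal 1 (reblock e M) = blockVal 0 M * of 1 ^ e := by
  induction M with
  | nil => simp [hdSgn, reblock, blockVal]
  | cons x M ih =>
    have := ih (fun z hz => hM z (by simp [hz])) (fun z hz => hp z (by simp [hz]))
    rw [reblock, blockVal_append, blockVal_expand (hp x (by simp)), hdSgn, blockVal,
      ← letter_sgn (hM x (by simp))]
    simp only [mul_assoc]
    rw [this]

theorem hdSgn_ne {e : ℤ} (he : e ≠ 0) (M : List ((Fin 2 × Bool) × ℤ)) : hdSgn e M ≠ 0 := by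
  rcases M with _ | ⟨x, M⟩
  · exact he
  · simp only [hdSgn, sgnLetter]; split_ifs <;> simp

theorem isChain_reblock {e : ℤ} (he : e ≠ 0) (M : List ((Fin 2 × Bool) × ℤ)) (z : (Fin 2 × Bool) × ℤ) :
    (reblock e M ++ [z]).IsChain NonCancel := by
  induction M with
  | nil => simp [reblock]
  | cons x M ih =>
    rw [reblock, expand, List.append_assoc, List.append_assoc, List.isChain_append, List.singleton_append,
      List.isChain_cons]
    refine ⟨List.isChain_replicate_of_rel _ fun _ h => ?_, ⟨?_, ih⟩, ?_⟩
    · simp [bar] at h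
    · intro w _ h
      exact absurd h (hdSgn_ne he M)
    · intro u hu w hw h1 h2
      rw [List.eq_of_mem_replicate (List.mem_of_getLast? hu)] at h2
      simp at hw
      subst hw
      simp [bar] at h2

theorem reblock_spec {e : ℤ} {M : List ((Fin 2 × Bool) × ℤ)} {z : (Fin 2 × Bool) × ℤ} {q : ℤ}
    (h : (reblock e M ++ [((0, decide (0 ≤ z.2)), q)]).IsChain fun a b : (Fin 2 × Bool) × ℤ => b.1 = bar a.1) :
    (∀ x ∈ M, x.2.natAbs ≤ 1) ∧ (M ++ [z]).IsChain fun a b => decide (0 ≤ b.2) = ! decide (0 ≤ a.2) := by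
  induction M with
  | nil => simp
  | cons x M ih =>
    rw [reblock, expand, List.append_assoc, List.append_assoc, List.isChain_append, List.singleton_append,
      List.isChain_cons] at h
    obtain ⟨h1, h2⟩ := ih h.2.1.2
    constructor
    · intro w hw
      rcases List.mem_cons.1 hw with rfl | hw
      · by_contra hlt
        have := h.2.2 ((0, decide (0 ≤ w.2)), 0) (by
          rw [Option.mem_def, List.getLast?_replicate, if_neg (by omega)]) _ (by simp; rfl)
        simp [bar] at this
      · exact h1 w hw
    · rw [List.cons_append, List.isChain_cons]
      refine ⟨?_, h2⟩
      intro w hw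
      have h3 := h.2.1.1
      rcases M with _ | ⟨x', M⟩
      · simp at hw
        subst hw
        have := h3 _ (by simp [reblock]; rfl)
        simpa [bar] using this
      · simp at hw
        subst hw
        have : ∃ q', ((0, decide (0 ≤ x'.2)), q') ∈ (reblock e (x' :: M) ++ [((0, decide (0 ≤ z.2)), q)]).head? := by
          rw [reblock, expand]
          rcases hk : x'.2.natAbs - 1 with _ | k
          · simp
          · simp [List.replicate_succ]
        obtain ⟨q', hq'⟩ := this
        have := h3 _ hq'
        simpa [bar] using this

theorem isChain_and {α : Type*} {R S : α → α → Prop} {l : List α} (h : l.IsChain R) (h' : l.IsChain S) :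
    l.IsChain fun a b => R a b ∧ S a b := by
  rw [List.isChain_iff_getElem] at *
  exact fun i hi => ⟨h i hi, h' i hi⟩

/-- The commutator `a d a⁻¹ d⁻¹` in the free group of rank two. -/
def kap : FreeGroup (Fin 2) := of 0 * of 1 * (of 0)⁻¹ * (of 1)⁻¹

theorem isConj_kap_pow {τ₁ τ₂ : FreeGroup (Fin 2) →* FreeGroup (Fin 2)} (h10 : τ₁ (of 0) = of 0)
    (h11 : τ₁ (of 1) = of 1 * (of 0)⁻¹) (h20 : τ₂ (of 0) = of 0 * of 1) (h21 : τ₂ (of 1) = of 1)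
    {v : FreeGroup (Fin 2)} (hv1 : IsConj (τ₁ v) v) (hv2 : IsConj (τ₂ v) v) : ∃ j : ℤ, IsConj v (kap ^ j) := by
  rcases exists_block_form 0 v with ⟨j, hj⟩ | ⟨x, t, h1, h2, h3⟩
  · have h := hom_conj_comm (expo 1) ((τ₂.map_isConj hj).symm.trans (hv2.trans hj))
    rw [map_zpow, map_zpow, map_zpow, h20] at h
    simp [expo, ← ofAdd_zsmul] at h
    refine ⟨0, ?_⟩
    simpa [h] using hj
  have h01 : ∀ u : Fin 2, u ≠ 0 → u = 1 := by decide
  have h10' : ∀ u : Fin 2, u ≠ 1 → u = 0 := by decide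
  have h4 := twist_isChain (fun _ => 0) (fun _ => -1) h10 (fun x hx => by rw [h01 x hx, h11]; simp) h1 h2
    ((τ₁.map_isConj h3).symm.trans (hv1.trans h3))
  have h1' : ∀ z ∈ x :: t ++ [x], z.1.1 ≠ 0 := by
    intro z hz
    refine h1 z ?_
    simp at hz ⊢; tauto
  have h5 : (x :: t ++ [x]).IsChain fun a b => b.1 = bar a.1 := by
    refine List.IsChain.imp_of_mem_imp ?_ h4
    intro a b ha hb hab
    obtain ⟨⟨a, s⟩, p⟩ := a
    obtain ⟨⟨b, s'⟩, p'⟩ := b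
    obtain rfl := h01 _ (h1' _ ha)
    obtain rfl := h01 _ (h1' _ hb)
    cases s <;> cases s' <;> simp [sA, sB, bar] at hab ⊢
  have hp : ∀ z ∈ x :: t, z.2 ≠ 0 := by
    have : ∀ M : List ((Fin 2 × Bool) × ℤ), (M ++ [x]).IsChain NonCancel →
        (M ++ [x]).IsChain (fun a b => b.1 = bar a.1) → ∀ z ∈ M, z.2 ≠ 0 := by
      intro M
      induction M with
      | nil => simp
      | cons w M ih =>
        intro a1 a2
        rw [List.cons_append, List.isChain_cons] at a1 a2
        intro z hz
        rcases List.mem_cons.1 hz with rfl | hz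
        · rcases hM : (M ++ [x]).head? with _ | u
          · simp at hM
          · intro h0
            exact a1.1 u hM h0 (a2.1 u hM)
        · exact ih a1.2 a2.2 z hz
    exact this _ h2 h5
  set e := sgnLetter x.1 with he
  have he0 : e ≠ 0 := by rw [he, sgnLetter]; split_ifs <;> simp
  have h6 := blockVal_reblock e h1 hp
  have h7 : IsConj v (blockVal 1 (reblock e (x :: t))) := by
    refine h3.trans (IsConj.symm (isConj_iff.2 ⟨of 1 ^ e, ?_⟩))
    rw [mul_inv_eq_iff_eq_mul, ← h6]; rfl
  obtain ⟨w, s, hws⟩ : ∃ w s, reblock e (x :: t) = w :: s := by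
    rcases h : reblock e (x :: t) with _ | ⟨w, s⟩
    · simp [reblock, expand] at h
    · exact ⟨w, s, rfl⟩
  have hw1 : ∀ M : List ((Fin 2 × Bool) × ℤ), ∀ z ∈ reblock e M, z.1.1 = 0 := by
    intro M
    induction M with
    | nil => simp [reblock]
    | cons x M ih =>
      intro z hz
      rw [reblock, expand, List.mem_append, List.mem_append] at hz
      rcases hz with (hz | hz) | hz
      · rw [List.eq_of_mem_replicate hz]
      · simp at hz; rw [hz]
      · exact ih z hz
  have hwy : ∀ z ∈ w :: s, z.1.1 ≠ 1 := by
    intro z hz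
    rw [← hws] at hz
    rw [hw1 _ z hz]; decide
  have h8 : (w :: s ++ [w]).IsChain NonCancel := by rw [← hws]; exact isChain_reblock he0 _ _
  rw [hws] at h7
  have h9 := twist_isChain (fun _ => 0) (fun _ => 1) h21 (fun x hx => by rw [h10' x hx, h20]; simp) hwy h8
    ((τ₂.map_isConj h7).symm.trans (hv2.trans h7))
  have h10 : (w :: s ++ [w]).IsChain fun a b => b.1 = bar a.1 := by
    refine List.IsChain.imp_of_mem_imp ?_ h9
    have hwy' : ∀ z ∈ w :: s ++ [w], z.1.1 ≠ 1 := by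
      intro z hz
      refine hwy z ?_
      simp at hz ⊢; tauto
    intro a b ha hb hab
    obtain ⟨⟨a, s⟩, p⟩ := a
    obtain ⟨⟨b, s'⟩, p'⟩ := b
    obtain rfl := h10' _ (hwy' _ ha)
    obtain rfl := h10' _ (hwy' _ hb)
    cases s <;> cases s' <;> simp [sA, sB, bar] at hab ⊢
  have hw : w = ((0, decide (0 ≤ x.2)), w.2) := by
    have : (reblock e (x :: t)).head? = some w := by rw [hws]; rfl
    rw [reblock, expand] at this
    rcases hk : x.2.natAbs - 1 with _ | k
    · rw [hk] at this; simp at this; rw [← this]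
    · rw [hk] at this; simp [List.replicate_succ] at this; rw [← this]
  rw [hw, ← hw, ← hws] at h10
  rw [hw] at h10
  obtain ⟨h11, h12⟩ := reblock_spec h10
  let S : ((Fin 2 × Bool) × ℤ) → ((Fin 2 × Bool) × ℤ) → Prop := fun a b => b = (bar a.1, -a.2)
  have h13 : (x :: t ++ [x]).IsChain S := by
    have hmem : ∀ z ∈ x :: t ++ [x], z ∈ x :: t := by
      intro z hz
      simp at hz ⊢; tauto
    refine List.IsChain.imp_of_mem_imp ?_ (isChain_and h5 h12)
    intro a b ha hb hab
    have a1 := h11 a (hmem a ha)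
    have a2 := h11 b (hmem b hb)
    have a3 := hp a (hmem a ha)
    have a4 := hp b (hmem b hb)
    refine Prod.ext hab.1 ?_
    have := hab.2
    by_cases q1 : 0 ≤ a.2 <;> by_cases q2 : 0 ≤ b.2 <;> simp [q1, q2] at this <;> simp <;> omega
  obtain ⟨k, hk⟩ := isChain_alternating (x := x) (y := (bar x.1, -x.2)) (by
    intro h
    have := congrArg (fun z => z.1.2) h
    simp [bar] at this) (S := S) (fun b hb => hb) (fun b hb => by
      rw [show b = _ from hb]; simp [bar]) _ t rfl h13
  rw [hk, blockVal_replicate] at h3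
  have h14 : ∃ i : ℤ, IsConj (blockVal 0 [x, (bar x.1, -x.2)]) (kap ^ i) := by
    have a1 := h11 x (by simp)
    have a2 := hp x (by simp)
    obtain ⟨⟨u, s⟩, p⟩ := x
    obtain rfl := h01 _ (h1 _ (List.mem_cons_self))
    have : p = 1 ∨ p = -1 := by simp at a1 a2; omega
    rcases this with rfl | rfl <;> cases s
    · refine ⟨1, isConj_iff.2 ⟨of 1, ?_⟩⟩
      simp [blockVal, bar, kap, letter_true, letter_false, mul_assoc]
    · refine ⟨-1, isConj_iff.2 ⟨1, ?_⟩⟩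
      simp [blockVal, bar, kap, letter_true, letter_false, mul_assoc]
    · refine ⟨-1, isConj_iff.2 ⟨of 1 * of 0, ?_⟩⟩
      simp [blockVal, bar, kap, letter_true, letter_false, mul_assoc]
    · refine ⟨1, isConj_iff.2 ⟨of 0, ?_⟩⟩
      simp [blockVal, bar, kap, letter_true, letter_false, mul_assoc]
  obtain ⟨i, hi⟩ := h14
  refine ⟨i * k, h3.trans ?_⟩
  rw [zpow_mul, zpow_natCast]
  exact hi.pow k

end Commutator
end Braid

namespace Braid
variable {m : ℕ}

/-- Kill the first `j` basis elements. -/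
def killLow (m j : ℕ) : F m →* F m := liftF fun k => if k ≤ j then 1 else gf m k

theorem killLow_gf (j k : ℕ) : killLow m j (gf m k) = if k ≤ j then 1 else gf m k := by
  by_cases h : k ≤ m + 1
  · exact liftF_gf' _ (by simp) h
  · rw [gf_of_lt (not_le.1 h)]; simp

def foldHom (m j : ℕ) : F m →* F m :=
  liftF fun k => if k < j then 1 else if k = j then (gf m (j + 2))⁻¹ * gf m (j + 1) else gf m k

theorem foldHom_gf {j : ℕ} (hj : 1 ≤ j) (k : ℕ) : foldHom m j (gf m k) =
    if k < j then 1 else if k = j then (gf m (j + 2))⁻¹ * gf m (j + 1) else gf m k := by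
  by_cases h : k ≤ m + 1
  · rcases Nat.eq_zero_or_pos k with rfl | h'
    · simp; omega
    · exact liftF_gf _ h' h
  · rw [gf_of_lt (not_le.1 h)]
    rw [map_one]
    split_ifs with h1 h2
    · rfl
    · subst h2
      rw [gf_of_lt (by omega), gf_of_lt (by omega)]; simp
    · rfl

theorem foldHom_killLow {j : ℕ} (hj : 1 ≤ j) (v : F m) : foldHom m j (killLow m j v) = killLow m j v := by
  have : (foldHom m j).comp (killLow m j) = killLow m j := by
    refine F_ext fun k _ => ?_
    rw [MonoidHom.comp_apply, killLow_gf]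
    split_ifs with h
    · simp
    · rw [foldHom_gf hj, if_neg (by omega), if_neg (by omega)]
  exact DFunLike.congr_fun this v

theorem foldHom_act_killLow {j : ℕ} (hj : 1 ≤ j) (hm : j < m) (v : F m) :
    foldHom m j (act m (sg m j) (killLow m j v)) = killLow m (j + 1) v := by
  have : (foldHom m j).comp ((act m (sg m j)).toMonoidHom.comp (killLow m j)) = killLow m (j + 1) := by
    refine F_ext fun k _ => ?_
    simp only [MonoidHom.comp_apply, killLow_gf, MulEquiv.toMonoidHom_eq_coe, MonoidHom.coe_coe]
    split_ifs with h h' h'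
    · simp
    · omega
    · obtain rfl : k = j := by omega
      rw [act_sg_gf hm, if_pos rfl]
      simp [foldHom_gf hj]
    · rw [act_sg_gf hm, if_neg (by omega), foldHom_gf hj, if_neg (by omega), if_neg (by omega)]
  exact DFunLike.congr_fun this v

theorem act_sg_zero_sq (hm : 1 ≤ m) (k : ℕ) : act m (sg m 0 ^ 2) (gf m k) =
    if k = 1 then (gf m 2)⁻¹ * gf m 1 * gf m 2 else gf m k := by
  rw [pow_two, map_mul, MulAut.mul_apply, act_sg_gf hm]
  split_ifs with h
  · simp [act_sg_gf hm, mul_assoc]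
  · rw [act_sg_gf hm, if_neg h]

theorem kill_eq_killLow : kill (0 : Fin (m + 1)) = killLow m 1 := by
  refine F_ext fun k hk => ?_
  rw [killLow_gf, gf_succ (by omega)]
  by_cases h : k = 0
  · subst h; simp [kill]
  · rw [if_neg (by omega), kill, FreeGroup.lift_apply_of, if_neg (by simpa [Fin.ext_iff] using h)]

theorem sq_hyps (hm : 2 ≤ m) : (0 : Fin (m + 1)) ≠ ⟨1, by omega⟩ ∧
    (act m (sg m 0 ^ 2)).toMonoidHom (FreeGroup.of (0 : Fin (m + 1))) = (FreeGroup.of ⟨1, by omega⟩)⁻¹ *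
      FreeGroup.of 0 * FreeGroup.of ⟨1, by omega⟩ ∧
    ∀ x : Fin (m + 1), x ≠ 0 → (act m (sg m 0 ^ 2)).toMonoidHom (FreeGroup.of x) = FreeGroup.of x := by
  refine ⟨by simp [Fin.ext_iff], ?_, ?_⟩
  · have := act_sg_zero_sq (by omega : 1 ≤ m) 1
    rw [if_pos rfl] at this
    rw [← gf_succ (show 1 < m + 1 by omega)]
    exact this
  · intro x hx
    have := act_sg_zero_sq (by omega : 1 ≤ m) (x + 1)
    rw [if_neg (by have := Fin.val_ne_of_ne hx; simp at this ⊢; omega)] at this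
    simpa [of_eq_gf] using this

theorem isConj_act_mul {a b : Br m} {v : F m} (ha : IsConj (act m a v) v) (hb : IsConj (act m b v) v) :
    IsConj (act m (a * b) v) v := by
  rw [map_mul, MulAut.mul_apply]
  exact ((act m a).toMonoidHom.map_isConj hb).trans ha

/-- The exponent of the last basis element. -/
def lastExp (m : ℕ) : F m →* Multiplicative ℤ := expo (Fin.last m)

theorem lastExp_gf (k : ℕ) : lastExp m (gf m k) = if k = m + 1 then Multiplicative.ofAdd 1 else 1 := by
  rcases k with _ | k
  · simp
  · by_cases h : k < m + 1
    · rw [gf_succ h]; simp [lastExp, expo, Fin.ext_iff]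
    · rw [gf_of_lt (by omega), if_neg (by omega), map_one]

theorem killLow_last (v : F m) : killLow m m v = gf m (m + 1) ^ (Multiplicative.toAdd (lastExp m v)) := by
  have : killLow m m = (zpowersHom (F m) (gf m (m + 1))).comp (lastExp m) := by
    refine F_ext fun k hk => ?_
    rw [killLow_gf, MonoidHom.comp_apply, lastExp_gf]
    by_cases h : k = m
    · subst h; simp [zpowersHom_apply]
    · rw [if_pos (by omega), if_neg (by omega)]; simp
  rw [this]; rfl

/-- A conjugacy class fixed by the braid action and with the right exponents is the class of the
boundary element. -/
theorem isConj_last (hm : 2 ≤ m) {v : F m} (hv : ∀ i < m, IsConj (act m (sg m i) v) v)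
    (he : lastExp m v = Multiplicative.ofAdd 1) : IsConj v (gf m (m + 1)) := by
  have key : ∀ j, 1 ≤ j → j ≤ m → IsConj v (killLow m j v) := by
    intro j hj
    induction j, hj using Nat.le_induction with
    | base =>
      intro _
      obtain ⟨h1, h2, h3⟩ := sq_hyps hm
      rw [← kill_eq_killLow]
      refine isConj_kill (z := Fin.last m) h1 (by simp [Fin.ext_iff]; omega) (by simp [Fin.ext_iff]; omega) h2 h3 ?_ ?_
      · rw [pow_two]
        exact isConj_act_mul (hv 0 (by omega)) (hv 0 (by omega))
      · change lastExp m v ≠ 1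
        rw [he]; decide
    | succ j hj ih =>
      intro hjm
      have h1 := ih (by omega)
      have h2 : IsConj (act m (sg m j) (killLow m j v)) (killLow m j v) :=
        ((act m (sg m j)).toMonoidHom.map_isConj h1.symm).trans ((hv j (by omega)).trans h1)
      have h3 := (foldHom m j).map_isConj h2
      rw [foldHom_killLow hj, foldHom_act_killLow hj (by omega)] at h3
      exact h1.trans h3.symm
  have := key m (by omega) le_rfl
  rw [killLow_last, he] at this
  simpa using this

theorem killLow_of_fixed {v : F m} (hv : ∀ i, i + 1 < m → act m (sg m i) v = v) : killLow m (m - 1) v = v := by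
  have key : ∀ j, 1 ≤ j → j < m → killLow m j v = v := by
    intro j hj
    induction j, hj using Nat.le_induction with
    | base =>
      intro hm
      obtain ⟨h1, h2, h3⟩ := sq_hyps (m := m) (by omega)
      rw [← kill_eq_killLow]
      refine (eq_kill h1 h2 h3 ?_).symm
      have := hv 0 (by omega)
      simp [pow_two, this]
    | succ j hj ih =>
      intro hjm
      have h1 := ih (by omega)
      have := foldHom_act_killLow hj (by omega) v
      rw [← this, h1, hv j (by omega), ← h1, foldHom_killLow hj]
  rcases Nat.lt_or_ge 1 m with h | h
  · exact key (m - 1) (by omega) (by omega)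
  · have : killLow m (m - 1) = MonoidHom.id _ := by
      refine F_ext fun k hk => ?_
      rw [killLow_gf, if_neg (by omega)]; rfl
    rw [this]; rfl

end Braid

namespace Braid
variable {m : ℕ}

theorem lk_inc (b : Br m) (j k : ℕ) : lk (inc m b) j k = lk b j k := by
  induction b using br_induction generalizing j k with
  | one => simp
  | sg i hi => rw [inc_sg hi, lk_sg hi, lk_sg (by omega)]
  | mul a b ha hb => rw [map_mul, lk_mul, lk_mul, ha, hb, perm_inc]
  | inv a ha => rw [map_inv, lk_inv, lk_inv, ha, perm_inc]

theorem lk_xb {j : ℕ} (hj : j ≤ m) (a b : ℕ) :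
    lk (xb m j) a b = if (a = j ∧ b = m + 1) ∨ (a = m + 1 ∧ b = j) then 2 else 0 := by
  have key : ∀ d j, j + d = m → ∀ a b, lk (xb m j) a b =
      if (a = j ∧ b = m + 1) ∨ (a = m + 1 ∧ b = j) then 2 else 0 := by
    intro d
    induction d with
    | zero =>
      intro j hj a b
      obtain rfl : j = m := hj
      rw [xb_last, lk_sq (by omega)]
    | succ d ih =>
      intro j hj a b
      rw [← sg_xb_succ (by omega : j < m), lk_conj _ (perm_xb _ (by omega)), ih (j + 1) (by omega),
        perm_sg (by omega), Equiv.swap_inv]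
      simp only [Equiv.swap_apply_def]
      split_ifs <;> omega
  exact key (m - j) j (by omega) a b

theorem gf_succ_eq (k : ℕ) : gf m (k + 1) = xf m k * gf m k := by simp [xf]

theorem F_ext_xf {G : Type*} [Monoid G] {f g : F m →* G} (h : ∀ j ≤ m, f (xf m j) = g (xf m j)) : f = g := by
  refine F_ext fun k => ?_
  induction k with
  | zero => intro hk; simpa [xf] using h 0 hk
  | succ k ih =>
    intro hk
    rw [gf_succ_eq, map_mul, map_mul, h _ hk, ih (by omega)]

/-- The exponent of `xf m j`. -/
def ex (m j : ℕ) : F m →* Multiplicative ℤ := liftF fun k => if j < k then Multiplicative.ofAdd 1 else 1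

theorem ex_gf {j k : ℕ} (hk : k ≤ m + 1) : ex m j (gf m k) = if j < k then Multiplicative.ofAdd 1 else 1 :=
  liftF_gf' _ (by simp) hk

theorem ex_xf {j k : ℕ} (hk : k ≤ m) : ex m j (xf m k) = if j = k then Multiplicative.ofAdd 1 else 1 := by
  rw [xf, map_mul, map_inv, ex_gf (by omega), ex_gf (by omega)]
  split_ifs <;> first | omega | simp

def lkXhom (m j k : ℕ) : F m →* Multiplicative ℤ where
  toFun v := Multiplicative.ofAdd (lk (xhom m v) j k)
  map_one' := by simp
  map_mul' a b := by rw [map_mul, lk_mul_of_pure (perm_xhom a)]; rfl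

theorem lk_xhom_last (v : F m) {j : ℕ} (hj : j ≤ m) : lk (xhom m v) j (m + 1) = 2 * (ex m j v).toAdd := by
  have : lkXhom m j (m + 1) = (ex m j) ^ 2 := by
    refine F_ext_xf fun k hk => ?_
    rw [MonoidHom.pow_apply, ex_xf hk]
    simp only [lkXhom, MonoidHom.coe_mk, OneHom.coe_mk, xhom_xf hk, lk_xb hk]
    by_cases h : j = k
    · rw [if_pos (by simp [h]), if_pos h]; rfl
    · rw [if_neg (by omega), if_neg h]; rfl
  have h := DFunLike.congr_fun this v
  rw [MonoidHom.pow_apply] at h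
  have h2 := congrArg Multiplicative.toAdd h
  simpa [lkXhom] using h2

theorem lk_xhom_of_le (v : F m) {j k : ℕ} (hj : j ≤ m) (hk : k ≤ m) : lk (xhom m v) j k = 0 := by
  have : lkXhom m j k = 1 := by
    refine F_ext_xf fun i hi => ?_
    simp only [lkXhom, MonoidHom.coe_mk, OneHom.coe_mk, xhom_xf hi, lk_xb hi, MonoidHom.one_apply]
    rw [if_neg (by omega)]; rfl
  have h := DFunLike.congr_fun this v
  exact congrArg Multiplicative.toAdd h

theorem perm_tl_last {t : ℕ} (ht : t ≤ m) : perm m (tl m t) m = t := by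
  have key : ∀ d t, t + d = m → perm m (tl m t) m = t := by
    intro d
    induction d with
    | zero => intro t ht; rw [tl_of_le (by omega)]; simp; omega
    | succ d ih =>
      intro t ht
      rw [tl_eq (by omega), map_mul, Equiv.Perm.mul_apply, ih (t + 1) (by omega), perm_sg (by omega)]
      simp
  exact key (m - t) t (by omega)

theorem perm_surjective (m : ℕ) (π : Equiv.Perm ℕ) (h : ∀ x, m < x → π x = x) : ∃ b, perm m b = π := by
  induction m generalizing π with
  | zero =>
    refine ⟨1, ?_⟩
    ext x
    rcases Nat.eq_zero_or_pos x with rfl | hx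
    · by_contra hne
      have h1 : π 0 ≠ 0 := by simpa [eq_comm] using hne
      have := h (π 0) (by omega)
      exact h1 (π.injective this)
    · rw [h x hx]; simp
  | succ m ih =>
    have hle : π (m + 1) ≤ m + 1 := by
      by_contra hlt
      have := π.injective (h _ (not_le.1 hlt))
      omega
    obtain ⟨b, hb⟩ := ih ((perm (m + 1) (tl (m + 1) (π (m + 1))))⁻¹ * π) (by
      intro x hx
      rw [Equiv.Perm.mul_apply, Equiv.Perm.inv_eq_iff_eq]
      rcases Nat.lt_or_ge (m + 1) x with h1 | h1
      · rw [h x h1, perm_apply_of_lt _ h1]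
      · obtain rfl : x = m + 1 := by omega
        rw [perm_tl_last hle])
    exact ⟨tl (m + 1) (π (m + 1)) * inc m b, by rw [map_mul, perm_inc, hb]; simp⟩

theorem exists_perm_pair {j k j' k' : ℕ} (h : j ≠ k) (h' : j' ≠ k') (hj : j ≤ m) (hk : k ≤ m) (hj' : j' ≤ m)
    (hk' : k' ≤ m) : ∃ b : Br m, perm m b j = j' ∧ perm m b k = k' := by
  obtain ⟨b, hb⟩ := perm_surjective m (Equiv.swap (Equiv.swap j j' k) k' * Equiv.swap j j') (by
    intro x hx
    have h1 : Equiv.swap j j' x = x := Equiv.swap_apply_of_ne_of_ne (by omega) (by omega)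
    have h2 : Equiv.swap j j' k ≤ m := by rw [Equiv.swap_apply_def]; split_ifs <;> omega
    rw [Equiv.Perm.mul_apply, h1, Equiv.swap_apply_of_ne_of_ne (by omega) (by omega)])
  refine ⟨b, ?_, ?_⟩
  · rw [hb, Equiv.Perm.mul_apply, Equiv.swap_apply_left]
    refine Equiv.swap_apply_of_ne_of_ne ?_ h'
    intro h1
    have : Equiv.swap j j' j = Equiv.swap j j' k := by rw [← h1]; simp
    exact h ((Equiv.swap j j').injective this)
  · rw [hb, Equiv.Perm.mul_apply, Equiv.swap_apply_left]

theorem sum_lk (b : Br m) : ∑ j ∈ Finset.range (m + 1), ∑ k ∈ Finset.range (m + 1), lk b j k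
    = 2 * (len m b).toAdd := by
  have reindex : ∀ (a b : Br m), ∑ j ∈ Finset.range (m + 1), ∑ k ∈ Finset.range (m + 1),
      lk b (perm m a j) (perm m a k) = ∑ j ∈ Finset.range (m + 1), ∑ k ∈ Finset.range (m + 1), lk b j k := by
    intro a b
    have hmem : ∀ x, x ∈ Finset.range (m + 1) ↔ perm m a x ∈ Finset.range (m + 1) := by
      intro x
      rw [Finset.mem_range, Finset.mem_range]
      constructor
      · intro hx; have := perm_apply_le a (show x ≤ m by omega); omega
      · intro hx
        have := perm_apply_le a⁻¹ (show perm m a x ≤ m by omega)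
        rw [map_inv, Equiv.Perm.inv_def, Equiv.symm_apply_apply] at this
        omega
    refine Finset.sum_equiv (perm m a) hmem fun j _ => ?_
    exact Finset.sum_equiv (perm m a) hmem fun k _ => rfl
  induction b using br_induction with
  | one => simp
  | sg i hi =>
    rw [len_sg hi]
    have : ∀ j ∈ Finset.range (m + 1), ∑ k ∈ Finset.range (m + 1), lk (sg m i) j k =
        (if j = i then 1 else 0) + (if j = i + 1 then 1 else 0) := by
      intro j _
      rw [Finset.sum_congr rfl fun k _ => (show lk (sg m i) j k = (if k = i + 1 then (if j = i then 1 else 0) else 0) +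
        (if k = i then (if j = i + 1 then 1 else 0) else 0) by
          rw [lk_sg hi]; split_ifs <;> omega)]
      rw [Finset.sum_add_distrib, Finset.sum_ite_eq', Finset.sum_ite_eq']
      rw [if_pos (Finset.mem_range.2 (by omega)), if_pos (Finset.mem_range.2 (by omega))]
    rw [Finset.sum_congr rfl this, Finset.sum_add_distrib, Finset.sum_ite_eq', Finset.sum_ite_eq',
      if_pos (Finset.mem_range.2 (by omega)), if_pos (Finset.mem_range.2 (by omega))]
    rfl
  | mul a b ha hb =>
    simp only [lk_mul, Finset.sum_add_distrib]
    have := reindex a⁻¹ b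
    rw [map_inv] at this
    rw [this, ha, hb, map_mul, toAdd_mul]; ring
  | inv a ha =>
    simp only [lk_inv, Finset.sum_neg_distrib]
    rw [reindex, ha, map_inv, toAdd_inv]; ring

/-- The full twist. -/
def Z (m : ℕ) : Br m := tl m 0 ^ (m + 1)

theorem tl_mul_tl {j : ℕ} (hj : j + 1 ≤ m) :
    tl m 0 * (tl m j * (sg m (m - 1))⁻¹) = tl m (j + 1) * tl m 0 := by
  have key : ∀ d j, j + 1 + d = m → tl m 0 * (tl m j * (sg m (m - 1))⁻¹) = tl m (j + 1) * tl m 0 := by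
    intro d
    induction d with
    | zero =>
      intro j hj
      rw [tl_eq (by omega : j < m), tl_of_le (by omega : m ≤ j + 1), show m - 1 = j by omega]
      simp
    | succ d ih =>
      intro j hj
      rw [tl_eq (by omega : j < m), mul_assoc (sg m j), ← mul_assoc (tl m 0),
        ← tl_shift (Nat.zero_le j) (by omega), mul_assoc, ih (j + 1) (by omega), tl_eq (by omega : j + 1 < m),
        mul_assoc]
  exact key (m - (j + 1)) j (by omega)

theorem tl_sq_sg (hm : 1 ≤ m) : tl m 0 ^ 2 * sg m (m - 1) = sg m 0 * tl m 0 ^ 2 := by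
  have h := tl_mul_tl hm
  have h1 := tl_eq (by omega : 0 < m)
  have h2 : sg m 0 * (tl m 0 * (tl m 0 * (sg m (m - 1))⁻¹)) = tl m 0 * tl m 0 := by
    rw [h, ← mul_assoc, ← h1]
  rw [← mul_assoc (tl m 0), ← mul_assoc, mul_inv_eq_iff_eq_mul, ← pow_two] at h2
  exact h2.symm

theorem sg_eq_conj {i : ℕ} (hi : i < m) : sg m i * tl m 0 ^ i = tl m 0 ^ i * sg m 0 := by
  induction i with
  | zero => simp
  | succ i ih =>
    rw [pow_succ', ← mul_assoc, tl_shift (Nat.zero_le i) hi, mul_assoc, ih (by omega), mul_assoc]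

theorem Z_commute (b : Br m) : Commute (Z m) b := by
  have h0 : ∀ i < m, Commute (Z m) (sg m i) := by
    intro i hi
    have hz : Commute (Z m) (sg m 0) := by
      have h1 := sg_eq_conj (by omega : m - 1 < m)
      have h2 := tl_sq_sg (by omega : 1 ≤ m)
      change Z m * _ = _ * Z m
      rw [Z, show m + 1 = 2 + (m - 1) by omega, pow_add, mul_assoc, ← h1, ← mul_assoc, h2, mul_assoc]
    have hd : Commute (Z m) (tl m 0 ^ i) := (Commute.refl (tl m 0)).pow_pow _ _
    have : sg m i = tl m 0 ^ i * sg m 0 * (tl m 0 ^ i)⁻¹ := by rw [← sg_eq_conj hi]; group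
    rw [this]
    exact (hd.mul_right hz).mul_right hd.inv_right
  have := mem_of_sg (Subgroup.centralizer {Z m}) (fun i hi => by
    rw [Subgroup.mem_centralizer_iff]
    rintro x rfl
    exact h0 i hi) b
  rw [Subgroup.mem_centralizer_iff] at this
  exact this _ rfl

theorem perm_tl_zero {x : ℕ} (hx : x < m) : perm m (tl m 0) x = x + 1 := by
  have key : ∀ d t, t + d = m → perm m (tl m t) x = if t ≤ x then x + 1 else x := by
    intro d
    induction d with
    | zero => intro t ht; rw [tl_of_le (by omega), if_neg (by omega)]; simp
    | succ d ih =>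
      intro t ht
      rw [tl_eq (by omega), map_mul, Equiv.Perm.mul_apply, ih (t + 1) (by omega), perm_sg (by omega),
        Equiv.swap_apply_def]
      split_ifs <;> omega
  rw [key m 0 (by omega), if_pos (Nat.zero_le x)]

theorem perm_Z : perm m (Z m) = 1 := by
  have key : ∀ k, ∀ x ≤ m, (perm m (tl m 0) ^ k) x = (x + k) % (m + 1) := by
    intro k
    induction k with
    | zero => intro x hx; simp; rw [Nat.mod_eq_of_lt (by omega)]
    | succ k ih =>
      intro x hx
      rw [pow_succ, Equiv.Perm.mul_apply]
      rcases Nat.lt_or_ge x m with h | h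
      · rw [perm_tl_zero h, ih _ (by omega)]; congr 1; omega
      · obtain rfl : x = m := by omega
        rw [perm_tl_last (Nat.zero_le x), ih 0 (by omega), show x + (k + 1) = k + (x + 1) by omega,
          Nat.add_mod_right]; simp
  ext x
  rcases Nat.lt_or_ge m x with h | h
  · rw [perm_apply_of_lt _ h]; rfl
  · rw [Z, map_pow, key _ x h, Nat.add_mod_right, Nat.mod_eq_of_lt (by omega)]; rfl

theorem lk_of_commute {w : Br m} (hw : ∀ b, Commute w b) (hp : perm m w = 1) {j k j' k' : ℕ} (h : j ≠ k)
    (h' : j' ≠ k') (hj : j ≤ m) (hk : k ≤ m) (hj' : j' ≤ m) (hk' : k' ≤ m) : lk w j k = lk w j' k' := by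
  obtain ⟨b, h1, h2⟩ := exists_perm_pair h h' hj hk hj' hk'
  have := lk_conj b hp j' k'
  rw [← (hw b).eq, mul_inv_cancel_right, ← h1, ← h2] at this
  simp only [Equiv.Perm.inv_def, Equiv.symm_apply_apply] at this
  rw [← h1, ← h2, this]

theorem sum_lk_const {w : Br m} {μ : ℤ} (h : ∀ j ≤ m, ∀ k ≤ m, j ≠ k → lk w j k = μ) :
    ((m : ℤ) + 1) * m * μ = 2 * (len m w).toAdd := by
  rw [← sum_lk]
  have : ∀ j ∈ Finset.range (m + 1), ∑ k ∈ Finset.range (m + 1), lk w j k = m * μ := by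
    intro j hj
    rw [← Finset.add_sum_erase _ _ hj, lk_self, zero_add,
      Finset.sum_congr rfl (fun k hk => (h j (by simp at hj; omega) k (by simp at hk; omega) (by simp at hk; omega)))]
    simp [Finset.card_erase_of_mem hj]
  rw [Finset.sum_congr rfl this]
  simp; ring

theorem len_Z : (len m (Z m)).toAdd = (m + 1) * m := by
  have : ∀ d t, t + d = m → (len m (tl m t)).toAdd = d := by
    intro d
    induction d with
    | zero => intro t ht; rw [tl_of_le (by omega)]; simp
    | succ d ih =>
      intro t ht
      rw [tl_eq (by omega), map_mul, toAdd_mul, ih (t + 1) (by omega), len_sg (by omega)]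
      simp; ring
  rw [Z, map_pow, toAdd_pow, this m 0 (by omega)]
  simp

theorem lk_Z {j k : ℕ} (h : j ≠ k) (hj : j ≤ m) (hk : k ≤ m) : lk (Z m) j k = 2 := by
  have h1 := sum_lk_const (w := Z m) (μ := lk (Z m) j k) fun j' hj' k' hk' h' =>
    lk_of_commute Z_commute perm_Z h' h hj' hk' hj hk
  rw [len_Z] at h1
  have h2 : 0 < (m : ℤ) := by omega
  have h3 : ((m : ℤ) + 1) * m ≠ 0 := by positivity
  apply mul_left_cancel₀ h3
  rw [h1]; ring

end Braid

namespace Braid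
variable {m : ℕ}

theorem perm_decomp (v : F m) (b : Br m) : perm (m + 1) (xhom m v * inc m b) = perm m b := by
  rw [map_mul, perm_xhom, perm_inc, one_mul]

theorem lk_decomp (v : F m) (b : Br m) {j k : ℕ} (hj : j ≤ m) (hk : k ≤ m) :
    lk (xhom m v * inc m b) j k = lk b j k := by
  rw [lk_mul_of_pure (perm_xhom v), lk_inc, lk_xhom_of_le v hj hk, zero_add]

theorem lk_decomp_last (v : F m) (b : Br m) {j : ℕ} (hj : j ≤ m) :
    lk (xhom m v * inc m b) j (m + 1) = 2 * (ex m j v).toAdd := by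
  rw [lk_mul_of_pure (perm_xhom v), lk_inc, lk_xhom_last v hj, lk_eq_zero_of_lt _ _ (by omega), add_zero]

theorem inc_mul_xhom (b : Br m) (v : F m) : inc m b * xhom m v = xhom m (act m b v) * inc m b := by
  rw [xhom_act]; group

theorem decomp_mul (u v : F m) (a b : Br m) :
    (xhom m u * inc m a) * (xhom m v * inc m b) = xhom m (u * act m a v) * inc m (a * b) := by
  rw [mul_assoc, ← mul_assoc (inc m a), inc_mul_xhom, map_mul, map_mul]; simp only [mul_assoc]

theorem eq_one_of_decomp {v : F m} {b : Br m} (h : xhom m v * inc m b = 1) : v = 1 ∧ b = 1 :=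
  decomp_inj (by rw [h]; simp : xhom m v * inc m b = xhom m 1 * inc m 1)

theorem fixes_of_pure {b : Br (m + 1)} (h : perm (m + 1) b = 1) : Fixes b := by simp [Fixes, h]

theorem exists_zpow_of_commute_last {v : F m} (h : Commute (gf m (m + 1)) v) : ∃ j : ℤ, v = gf m (m + 1) ^ j := by
  rw [gf_succ (by omega)] at *
  exact exists_zpow_of_commute_of _ v h

theorem F_central {v : F m} (hm : 1 ≤ m) (h : ∀ u, Commute u v) : v = 1 := by
  by_contra hne
  have := subsingleton_of_central hne h
  have := this.elim (⟨0, by omega⟩ : Fin (m + 1)) ⟨1, by omega⟩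
  simp at this

theorem Z_succ_of {hm : 1 ≤ m} (hC : ∀ w : Br m, perm m w = 1 → (∀ p, perm m p = 1 → Commute w p) →
    ∃ β : ℤ, w = Z m ^ β) : Z (m + 1) = xhom m (gf m (m + 1)) * inc m (Z m) := by
  obtain ⟨v, b, hb⟩ := exists_decomp (fixes_of_pure (perm_Z (m := m + 1)))
  have hbp : perm m b = 1 := by rw [← perm_decomp v b, ← hb, perm_Z]
  have hcomm : ∀ u p, u * act m p v = v * act m b u ∧ p * b = b * p := fun u p => by
    have := (Z_commute (xhom m u * inc m p)).eq
    rw [hb, decomp_mul, decomp_mul] at this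
    exact ⟨(decomp_inj this).1.symm, (decomp_inj this).2.symm⟩
  obtain ⟨β, rfl⟩ := hC b hbp fun p _ => (hcomm 1 p).2.symm
  have hβ : β = 1 := by
    have h1 := lk_decomp v (Z m ^ β) (Nat.zero_le m) hm
    rw [← hb, lk_Z (by omega) (by omega) (by omega), lk_zpow_of_pure perm_Z, lk_Z (by omega) (by omega) (by omega)] at h1
    omega
  subst hβ
  have h2 := (hcomm (gf m (m + 1)) 1).1
  rw [act_last, map_one, MulAut.one_apply] at h2
  obtain ⟨k, rfl⟩ := exists_zpow_of_commute_last h2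
  have hk : k = 1 := by
    have h1 := lk_decomp_last (gf m (m + 1) ^ k) (Z m ^ (1 : ℤ)) (Nat.zero_le m)
    rw [← hb, lk_Z (by omega) (by omega) (by omega), map_zpow, ex_gf le_rfl, if_pos (by omega), toAdd_zpow] at h1
    simp at h1
    omega
  subst hk
  rw [hb]; simp

theorem exists_Z_zpow_of_commute (m : ℕ) (w : Br m) (hw : perm m w = 1)
    (h : ∀ p, perm m p = 1 → Commute w p) : ∃ β : ℤ, w = Z m ^ β := by
  induction m with
  | zero =>
    refine ⟨0, ?_⟩
    have := mem_of_sg (⊥ : Subgroup (Br 0)) (fun i hi => by omega) w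
    simpa using this
  | succ m ih =>
    rcases Nat.eq_zero_or_pos m with rfl | hm
    · have h1 := mem_of_sg (Subgroup.zpowers (sg 1 0)) (fun i hi => by
        obtain rfl : i = 0 := by omega
        exact Subgroup.mem_zpowers _) w
      obtain ⟨k, rfl⟩ := Subgroup.mem_zpowers_iff.1 h1
      have hk : Even k := by
        rw [map_zpow, perm_sg (by omega)] at hw
        by_contra hodd
        obtain ⟨l, rfl⟩ := Int.not_even_iff_odd.1 hodd
        rw [zpow_add, zpow_mul, zpow_one] at hw
        have : (Equiv.swap 0 (0 + 1) : Equiv.Perm ℕ) ^ (2 : ℤ) = 1 := by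
          rw [zpow_two, Equiv.swap_mul_self]
        rw [this, one_zpow, one_mul] at hw
        have := congrArg (fun e : Equiv.Perm ℕ => e 0) hw
        simp at this
      obtain ⟨l, rfl⟩ := hk
      refine ⟨l, ?_⟩
      rw [Z, tl_eq (by omega), tl_of_le (by omega), mul_one, ← two_mul, zpow_mul]; rfl
    · have hZ := Z_succ_of (hm := hm) ih
      obtain ⟨v, b, rfl⟩ := exists_decomp (fixes_of_pure hw)
      rw [perm_decomp] at hw
      obtain ⟨β, rfl⟩ := ih b hw fun p hp => by
        have := (h (xhom m 1 * inc m p) (by rw [perm_decomp, hp])).eq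
        rw [decomp_mul, decomp_mul] at this
        exact (decomp_inj this).2
      refine ⟨β, ?_⟩
      have h1 : Z (m + 1) ^ β = xhom m (gf m (m + 1) ^ β) * inc m (Z m ^ β) := by
        rw [hZ, map_zpow, map_zpow]
        refine Commute.mul_zpow ?_ β
        change _ * _ = _ * _
        rw [inc_mul_xhom, act_last]
      have h2 : xhom m v * inc m (Z m ^ β) * (Z (m + 1) ^ β)⁻¹ = xhom m (v * (gf m (m + 1) ^ β)⁻¹) := by
        rw [h1, map_mul, map_inv]
        group
      have h3 : v * (gf m (m + 1) ^ β)⁻¹ = 1 := by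
        refine F_central hm fun u => ?_
        have h4 : Commute (xhom m v * inc m (Z m ^ β) * (Z (m + 1) ^ β)⁻¹) (xhom m u) :=
          (h (xhom m u) (perm_xhom u)).mul_left (((Z_commute _).zpow_left β).inv_left)
        rw [h2] at h4
        have h5 := h4.eq.symm
        rw [← map_mul, ← map_mul] at h5
        exact xhom_injective h5
      rw [h1, mul_inv_eq_one.1 h3]

theorem Z_succ (hm : 1 ≤ m) : Z (m + 1) = xhom m (gf m (m + 1)) * inc m (Z m) :=
  Z_succ_of (hm := hm) (exists_Z_zpow_of_commute m)

theorem act_Z (hm : 1 ≤ m) (u : F m) : act m (Z m) u = (gf m (m + 1))⁻¹ * u * gf m (m + 1) := by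
  have := (Z_commute (xhom m u * inc m 1)).eq
  rw [Z_succ hm, decomp_mul, decomp_mul] at this
  have := (decomp_inj this).1
  rw [map_one, MulAut.one_apply] at this
  rw [mul_assoc, ← this]; group

theorem eq_one_of_pow_eq_one {b : Br m} (hb : perm m b = 1) {k : ℕ} (hk : k ≠ 0) (h : b ^ k = 1) : b = 1 := by
  induction m with
  | zero =>
    have := mem_of_sg (⊥ : Subgroup (Br 0)) (fun i hi => by omega) b
    simpa using this
  | succ m ih =>
    obtain ⟨v, b, rfl⟩ := exists_decomp (fixes_of_pure hb)
    rw [perm_decomp] at hb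
    have key : ∀ n : ℕ, ∃ u, (xhom m v * inc m b) ^ n = xhom m u * inc m (b ^ n) := by
      intro n
      induction n with
      | zero => exact ⟨1, by simp⟩
      | succ n ih =>
        obtain ⟨u, hu⟩ := ih
        rw [pow_succ, hu, decomp_mul, pow_succ]
        exact ⟨_, rfl⟩
    obtain ⟨u, hu⟩ := key k
    rw [hu] at h
    obtain rfl := ih hb (eq_one_of_decomp h).2
    rw [map_one, mul_one, ← map_pow] at hu
    have h2 := xhom_injective (hu.trans (by rw [(eq_one_of_decomp h).1]; simp) : xhom m (v ^ k) = xhom m 1)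
    have h3 : v = 1 := by
      have h4 : v ^ k = 1 ^ k := by rw [h2, one_pow]
      exact pow_left_injective hk h4
    rw [h3]; simp

end Braid

namespace Braid
variable {m : ℕ}

/-- Endomorphisms which are standard up to conjugation, inversion and transvection. -/
def Std (ρ : Br m →* Br m) : Prop :=
  ∃ (c : Br m) (t : ℤ), (∀ i < m, ρ (sg m i) = c * sg m i * c⁻¹ * Z m ^ t) ∨
    (∀ i < m, ρ (sg m i) = c * (sg m i)⁻¹ * c⁻¹ * Z m ^ t)

def conjHom (c : Br m) (ρ : Br m →* Br m) : Br m →* Br m := (MulAut.conj c).toMonoidHom.comp ρ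

theorem conjHom_apply (c : Br m) (ρ : Br m →* Br m) (g : Br m) : conjHom c ρ g = c * ρ g * c⁻¹ := rfl

theorem Z_zpow_commute (t : ℤ) (b : Br m) : Z m ^ t * b = b * Z m ^ t := ((Z_commute b).zpow_left t).eq

theorem Std.of_conj {c : Br m} {ρ : Br m →* Br m} (h : Std (conjHom c ρ)) : Std ρ := by
  obtain ⟨d, t, h⟩ := h
  refine ⟨c⁻¹ * d, t, h.imp ?_ ?_⟩ <;>
  · intro h i hi
    have := h i hi
    rw [conjHom_apply, mul_inv_eq_iff_eq_mul, mul_assoc _ (Z m ^ t), Z_zpow_commute] at this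
    rw [eq_inv_mul_iff_mul_eq.2 this]
    group

/-- Transvection by the centre. -/
def tv (ρ : Br m →* Br m) (t : ℤ) : Br m →* Br m where
  toFun g := ρ g * Z m ^ (t * (len m g).toAdd)
  map_one' := by simp
  map_mul' a b := by
    rw [map_mul, map_mul, toAdd_mul, mul_add, add_comm, zpow_add, mul_assoc, mul_assoc]
    conv_rhs => rw [Z_zpow_commute, mul_assoc]

theorem tv_apply (ρ : Br m →* Br m) (t : ℤ) (g : Br m) : tv ρ t g = ρ g * Z m ^ (t * (len m g).toAdd) := rfl

theorem tv_sg (ρ : Br m →* Br m) (t : ℤ) {i : ℕ} (hi : i < m) : tv ρ t (sg m i) = ρ (sg m i) * Z m ^ t := by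
  rw [tv_apply, len_sg hi]; simp

theorem Std.of_tv {ρ : Br m →* Br m} {t : ℤ} (h : Std (tv ρ t)) : Std ρ := by
  obtain ⟨d, s, h⟩ := h
  refine ⟨d, s - t, h.imp ?_ ?_⟩ <;>
  · intro h i hi
    have := h i hi
    rw [tv_sg _ _ hi] at this
    rw [zpow_sub, ← mul_assoc, ← this]; group

theorem Std.of_chi {ρ : Br m →* Br m} (h : Std (ρ.comp (chi m))) : Std ρ := by
  obtain ⟨d, s, h⟩ := h
  refine ⟨d, -s, h.symm.imp ?_ ?_⟩ <;>
  · intro h i hi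
    have := h i hi
    rw [MonoidHom.comp_apply, chi_sg hi, map_inv, inv_eq_iff_eq_inv] at this
    rw [this]
    simp only [mul_inv_rev, ← zpow_neg, inv_inv, mul_assoc, Z_zpow_commute]

theorem perm_hom {ρ : Br m →* Br m} (h : ∀ i < m, perm m (ρ (sg m i)) = Equiv.swap i (i + 1)) (g : Br m) :
    perm m (ρ g) = perm m g := by
  have : (perm m).comp ρ = perm m := hom_ext fun i hi => by
    rw [MonoidHom.comp_apply, h i hi, perm_sg hi]
  exact DFunLike.congr_fun this g

theorem sg_eq {i : ℕ} (hi : i < m) : sg m i = tl m 0 ^ i * sg m 0 * (tl m 0 ^ i)⁻¹ := by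
  rw [← sg_eq_conj hi]; group

theorem isConj_act_xf (b : Br m) {j : ℕ} : IsConj (act m b (xf m j)) (xf m (perm m b j)) := by
  induction b using br_induction generalizing j with
  | one => simp only [map_one, MulAut.one_apply, Equiv.Perm.one_apply]; exact IsConj.refl _
  | sg i hi =>
    rw [perm_sg hi]
    rcases eq_or_ne j i with rfl | h1
    · rw [act_sg_xf_self hi, Equiv.swap_apply_left]
      exact isConj_iff.2 ⟨xf m j, by group⟩
    rcases eq_or_ne j (i + 1) with rfl | h2
    · rw [act_sg_xf_succ hi, Equiv.swap_apply_right]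
    · rw [act_sg_xf_of_ne hi h1 h2, Equiv.swap_apply_of_ne_of_ne h1 h2]
  | mul a b ha hb =>
    rw [map_mul, map_mul, MulAut.mul_apply, Equiv.Perm.mul_apply]
    exact ((act m a).toMonoidHom.map_isConj hb).trans ha
  | inv a ha =>
    have h := ((act m a⁻¹).toMonoidHom.map_isConj (ha (j := (perm m a)⁻¹ j))).symm
    have e : ∀ u, (act m a⁻¹).toMonoidHom (act m a u) = u := fun u => by simp
    rw [e] at h
    rw [map_inv (perm m)]
    simpa using h

/-- A pure braid with no linking which commutes with the first generators is trivial. -/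
theorem eq_one_of_commute_of_lk (hm : 2 ≤ m) {w : Br m} (hw : perm m w = 1)
    (hc : ∀ i, i + 1 < m → Commute w (sg m i)) (hl : ∀ j ≤ m, ∀ k ≤ m, lk w j k = 0) : w = 1 := by
  obtain ⟨k, rfl⟩ : ∃ k, m = k + 1 := ⟨m - 1, by omega⟩
  obtain ⟨v, b, rfl⟩ := exists_decomp (fixes_of_pure hw)
  have hcomm : ∀ p, v * act k b 1 = act k p v ∧ b * p = p * b := by
    intro p
    have h1 : xhom k v * inc k b * inc k p = inc k p * (xhom k v * inc k b) := by
      have := mem_of_sg ((Subgroup.centralizer {xhom k v * inc k b}).comap (inc k)) (fun i hi => by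
        rw [Subgroup.mem_comap, Subgroup.mem_centralizer_iff]
        rintro x rfl
        rw [inc_sg hi]
        exact hc i (by omega)) p
      rw [Subgroup.mem_comap, Subgroup.mem_centralizer_iff] at this
      exact this _ rfl
    have h2 := decomp_mul v 1 b p
    have h3 := decomp_mul 1 v p b
    rw [map_one, one_mul] at h2 h3
    rw [h2, h3, one_mul] at h1
    exact decomp_inj h1
  rw [perm_decomp] at hw
  obtain ⟨β, rfl⟩ := exists_Z_zpow_of_commute k b hw fun p _ => (hcomm p).2
  have hβ : β = 0 := by
    have h1 := hl 0 (by omega) 1 (by omega)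
    rw [lk_decomp _ _ (by omega) (by omega), lk_zpow_of_pure perm_Z, lk_Z (by omega) (by omega) (by omega)] at h1
    omega
  subst hβ
  have h2 := (hcomm (Z k)).1
  rw [map_one, mul_one, act_Z (by omega)] at h2
  obtain ⟨j, rfl⟩ := exists_zpow_of_commute_last (v := v) (by
    change _ * _ = _ * _
    nth_rewrite 1 [h2]
    group)
  have h1 := hl 0 (by omega) (k + 1) (by omega)
  rw [lk_decomp_last _ _ (by omega), map_zpow, ex_gf le_rfl, if_pos (by omega), toAdd_zpow] at h1
  simp at h1
  subst h1
  simp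

theorem lift_two_one (H : FreeGroup (Fin 2)) {G : Type*} [Group G] (c : G) :
    FreeGroup.lift ![1, c] H = c ^ (FreeGroup.lift ![1, Multiplicative.ofAdd (1 : ℤ)] H).toAdd := by
  have : FreeGroup.lift ![1, c] = (zpowersHom G c).comp (FreeGroup.lift ![1, Multiplicative.ofAdd (1 : ℤ)]) := by
    ext i
    fin_cases i <;> simp
  rw [this]; rfl

theorem hom_lift_two {G K : Type*} [Group G] [Group K] (f : G →* K) (a b : G) (H : FreeGroup (Fin 2)) :
    f (FreeGroup.lift ![a, b] H) = FreeGroup.lift ![f a, f b] H := by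
  have : f.comp (FreeGroup.lift ![a, b]) = FreeGroup.lift ![f a, f b] := by
    ext i
    fin_cases i <;> simp
  exact DFunLike.congr_fun this H

section Three
open FreeGroup

theorem exists_twist_of_relation (H : FreeGroup (Fin 2)) {x y c : FreeGroup (Fin 3)} (hx : x = of 0) (hy : y = of 1)
    (hc : c = of 2) {V : FreeGroup (Fin 3)} (hV : V = FreeGroup.lift ![x, c] H * x * (FreeGroup.lift ![x, c] H)⁻¹)
    (h : FreeGroup.lift ![x⁻¹ * y * x, c] H * (x⁻¹ * y * x) * (FreeGroup.lift ![x⁻¹ * y * x, c] H)⁻¹ =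
      V⁻¹ * (FreeGroup.lift ![y, c] H * y * (FreeGroup.lift ![y, c] H)⁻¹) * V) :
    ∃ q : ℤ, V = c ^ q * x * c ^ (-q) := by
  have h1 : FreeGroup.lift ![x⁻¹ * y * x, c] H = x⁻¹ * FreeGroup.lift ![y, x * c * x⁻¹] H * x := by
    have := hom_lift_two (MulAut.conj x⁻¹).toMonoidHom y (x * c * x⁻¹) H
    simp [mul_assoc] at this
    simp [mul_assoc, this]
  rw [h1] at h
  obtain ⟨i, hi⟩ := exists_zpow_of_commute_of (1 : Fin 3)
    ((FreeGroup.lift ![y, x * c * x⁻¹] H)⁻¹ * x * V⁻¹ * FreeGroup.lift ![y, c] H) (by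
      rw [← hy]
      generalize FreeGroup.lift ![y, x * c * x⁻¹] H = A at h ⊢
      generalize FreeGroup.lift ![y, c] H = B at h ⊢
      have h2 : A * y * A⁻¹ = x * V⁻¹ * (B * y * B⁻¹) * V * x⁻¹ := by
        calc A * y * A⁻¹ = x * (x⁻¹ * A * x * (x⁻¹ * y * x) * (x⁻¹ * A * x)⁻¹) * x⁻¹ := by group
          _ = _ := by rw [h]; group
      change _ = _
      calc y * (A⁻¹ * x * V⁻¹ * B) = A⁻¹ * (A * y * A⁻¹) * x * V⁻¹ * B := by group
        _ = _ := by rw [h2]; group)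
  let θ : FreeGroup (Fin 3) →* FreeGroup (Fin 3) := FreeGroup.lift ![of 0, 1, of 2]
  have tx : θ x = x := by simp [θ, hx]
  have ty : θ y = 1 := by simp [θ, hy]
  have tc : θ c = c := by simp [θ, hc]
  have tV : θ V = V := by
    rw [hV, _root_.map_mul, _root_.map_mul, _root_.map_inv, hom_lift_two, tx, tc]
  have h3 := congrArg θ hi
  simp only [_root_.map_mul, _root_.map_inv, map_zpow, hom_lift_two, ty, tx, tc, tV, ← hy, one_zpow] at h3
  rw [lift_two_one H c, lift_two_one H (x * c * x⁻¹)] at h3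
  refine ⟨(FreeGroup.lift ![1, Multiplicative.ofAdd (1 : ℤ)] H).toAdd, ?_⟩
  generalize (FreeGroup.lift ![1, Multiplicative.ofAdd (1 : ℤ)] H).toAdd = q at h3 ⊢
  rw [conj_zpow] at h3
  have h4 : V = c ^ q * ((x * c ^ q * x⁻¹)⁻¹ * x * V⁻¹ * c ^ q)⁻¹ * (x * c ^ q * x⁻¹)⁻¹ * x := by group
  rw [h3] at h4
  rw [h4]; group

end Three

/-- The embedding of a free group of rank three on the last two meridians and the boundary element. -/
def embThree (m : ℕ) : FreeGroup (Fin 3) →* F m :=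
  FreeGroup.lift ![xf m (m - 1), xf m m, gf m (m + 1)]

def retThree (m : ℕ) : F m →* FreeGroup (Fin 3) :=
  liftF fun k => if k = m + 1 then FreeGroup.of 2 else if k = m then (FreeGroup.of 1)⁻¹ * FreeGroup.of 2
    else if k + 1 = m then (FreeGroup.of 0)⁻¹ * (FreeGroup.of 1)⁻¹ * FreeGroup.of 2 else 1

theorem embThree_injective (hm : 2 ≤ m) : Function.Injective (embThree m) := by
  have : (retThree m).comp (embThree m) = MonoidHom.id _ := by
    have h1 : retThree m (gf m (m + 1)) = FreeGroup.of 2 := by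
      rw [retThree, liftF_gf _ (by omega) le_rfl, if_pos rfl]
    have h2 : retThree m (gf m m) = (FreeGroup.of 1)⁻¹ * FreeGroup.of 2 := by
      rw [retThree, liftF_gf _ (by omega) (by omega), if_neg (by omega), if_pos rfl]
    have h3 : retThree m (gf m (m - 1)) = (FreeGroup.of 0)⁻¹ * (FreeGroup.of 1)⁻¹ * FreeGroup.of 2 := by
      rw [retThree, liftF_gf _ (by omega) (by omega), if_neg (by omega), if_neg (by omega), if_pos (by omega)]
    ext i
    fin_cases i
    · simp [embThree, xf, h1, h2, h3, show m - 1 + 1 = m by omega]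
    · simp [embThree, xf, h1, h2, h3]
    · simp [embThree, h1]
  intro a b h
  have h' := congrArg (retThree m) h
  have e := fun u => DFunLike.congr_fun this u
  simp only [MonoidHom.comp_apply, MonoidHom.id_apply] at e
  rwa [e, e] at h'

theorem exists_lift_two (hm : 1 ≤ m) (h : F m) : ∃ H : FreeGroup (Fin 2), killLow m (m - 1) h =
    FreeGroup.lift ![xf m m, gf m (m + 1)] H := by
  refine ⟨liftF (fun k => if k = m + 1 then FreeGroup.of 1 else if k = m then
    (FreeGroup.of 0)⁻¹ * FreeGroup.of 1 else 1) h, ?_⟩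
  have : killLow m (m - 1) = (FreeGroup.lift ![xf m m, gf m (m + 1)]).comp (liftF (fun k => if k = m + 1 then FreeGroup.of 1 else if k = m then
    (FreeGroup.of 0)⁻¹ * FreeGroup.of 1 else 1)) := by
    refine F_ext fun k hk => ?_
    rw [MonoidHom.comp_apply, liftF_gf _ (by omega) (by omega), killLow_gf]
    by_cases h1 : k = m
    · subst h1; simp
    · by_cases h2 : k + 1 = m
      · subst h2
        simp [xf]
      · rw [if_pos (by omega), if_neg (by omega), if_neg h2]; simp
  rw [this]; rfl

/-- An element of the free group conjugate to the last meridian, fixed by the first generators and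
satisfying the meridian relation, is a boundary twist of the last meridian. -/
theorem eq_twist_of_relation (hm : 2 ≤ m) {v : F m} (hv : IsConj (xf m m) v)
    (hf : ∀ i, i + 1 < m → act m (sg m i) v = v)
    (hr : act m (sg m (m - 1)) (act m (sg m (m - 1)) v) =
      (act m (sg m (m - 1)) v)⁻¹ * v * act m (sg m (m - 1)) v) :
    ∃ q : ℤ, v = gf m (m + 1) ^ q * xf m m * gf m (m + 1) ^ (-q) := by
  obtain ⟨h, hh⟩ := isConj_iff.1 hv
  obtain ⟨H, hH⟩ := exists_lift_two (m := m) (by omega) h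
  have hkx : killLow m (m - 1) (xf m m) = xf m m := by
    rw [xf, map_mul, map_inv, killLow_gf, killLow_gf, if_neg (by omega), if_neg (by omega)]
  have hv2 : v = FreeGroup.lift ![xf m m, gf m (m + 1)] H * xf m m *
      (FreeGroup.lift ![xf m m, gf m (m + 1)] H)⁻¹ := by
    rw [← hH, ← killLow_of_fixed hf, ← hh]
    simp only [map_mul, map_inv, hkx]
  have s1 : act m (sg m (m - 1)) (xf m m) = xf m (m - 1) := by
    have := act_sg_xf_succ (by omega : m - 1 < m)
    rwa [show m - 1 + 1 = m by omega] at this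
  have s2 : act m (sg m (m - 1)) (xf m (m - 1)) = (xf m (m - 1))⁻¹ * xf m m * xf m (m - 1) := by
    have := act_sg_xf_self (by omega : m - 1 < m)
    rwa [show m - 1 + 1 = m by omega] at this
  have hs : ∀ a b, act m (sg m (m - 1)) (FreeGroup.lift ![a, b] H) =
    FreeGroup.lift ![act m (sg m (m - 1)) a, act m (sg m (m - 1)) b] H := fun a b =>
      hom_lift_two (act m (sg m (m - 1))).toMonoidHom a b H
  have e0 : xf m (m - 1) = embThree m (FreeGroup.of 0) := by simp [embThree]
  have e1 : xf m m = embThree m (FreeGroup.of 1) := by simp [embThree]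
  have e2 : gf m (m + 1) = embThree m (FreeGroup.of 2) := by simp [embThree]
  have hsv : act m (sg m (m - 1)) v = FreeGroup.lift ![xf m (m - 1), gf m (m + 1)] H * xf m (m - 1) *
      (FreeGroup.lift ![xf m (m - 1), gf m (m + 1)] H)⁻¹ := by
    rw [hv2]
    simp only [map_mul, map_inv, hs, s1, act_last]
  have hssv := congrArg (act m (sg m (m - 1))) hsv
  simp only [map_mul (act m (sg m (m - 1))), map_inv (act m (sg m (m - 1))), hs, s2, act_last] at hssv
  rw [hssv, hsv] at hr
  rw [hv2] at hr
  rw [e0, e1, e2] at hr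
  simp only [← map_mul, ← map_inv, ← hom_lift_two] at hr
  have hr' := embThree_injective hm hr
  simp only [map_inv] at hr'
  obtain ⟨q, hq⟩ := exists_twist_of_relation H rfl rfl rfl rfl hr'
  refine ⟨q, ?_⟩
  have h5 := congrArg (embThree m) hq
  simp only [map_mul, map_inv, hom_lift_two, map_zpow] at h5
  rw [← e0, ← e2, ← hsv] at h5
  apply (act m (sg m (m - 1))).injective
  rw [h5]
  simp only [map_mul, map_zpow, s1, act_last]

end Braid

namespace Braid
variable {m : ℕ}

theorem commute_decomp {v : F m} {w p : Br m} (h : Commute (xhom m v * inc m w) (inc m p)) :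
    act m p v = v ∧ Commute w p := by
  have h1 : xhom m v * inc m (w * p) = xhom m (act m p v) * inc m (p * w) := by
    rw [map_mul, ← mul_assoc, h.eq, ← mul_assoc, inc_mul_xhom, map_mul, mul_assoc]
  exact ⟨(decomp_inj h1).1.symm, (decomp_inj h1).2⟩

/-- `ρ` preserves the linking numbers of the pure braid `p`. -/
def KeepsLk (ρ : Br m →* Br m) (p : Br m) : Prop :=
  perm m p = 1 ∧ ∀ j k, lk (ρ p) j k = lk p j k

theorem KeepsLk.conj {ρ : Br m →* Br m} (hρ : ∀ i < m, perm m (ρ (sg m i)) = Equiv.swap i (i + 1))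
    {p : Br m} (h : KeepsLk ρ p) (g : Br m) : KeepsLk ρ (g * p * g⁻¹) := by
  refine ⟨perm_conj_pure g h.1, fun j k => ?_⟩
  rw [map_mul, map_mul, map_inv, lk_conj _ (by rw [perm_hom hρ, h.1]), lk_conj _ h.1, perm_hom hρ, h.2]

theorem KeepsLk.sq {ρ : Br m →* Br m} (hρ : ∀ i < m, perm m (ρ (sg m i)) = Equiv.swap i (i + 1))
    (h : KeepsLk ρ (sg m 0 ^ 2)) {i : ℕ} (hi : i < m) : KeepsLk ρ (sg m i ^ 2) := by
  rw [sg_eq hi, conj_pow]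
  exact h.conj hρ _

theorem std_of_fix_low (hm : 2 ≤ m) {ρ : Br (m + 1) →* Br (m + 1)}
    (hρ : ∀ i < m + 1, perm (m + 1) (ρ (sg (m + 1) i)) = Equiv.swap i (i + 1))
    (hfix : ∀ i < m, ρ (sg (m + 1) i) = sg (m + 1) i) : Std ρ := by
  have hinc : ∀ b, ρ (inc m b) = inc m b := by
    have : ρ.comp (inc m) = inc m := hom_ext fun i hi => by
      rw [MonoidHom.comp_apply, inc_sg hi, hfix i hi]
    exact DFunLike.congr_fun this
  have hx : KeepsLk ρ (xb m m) := by
    rw [xb_last]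
    refine KeepsLk.sq hρ ⟨perm_sq (by omega), fun j k => ?_⟩ (by omega)
    rw [map_pow, hfix 0 (by omega)]
  have hpx : perm (m + 1) (ρ (xb m m)) = 1 := by rw [perm_hom hρ, hx.1]
  obtain ⟨v, w, hvw⟩ := exists_decomp (fixes_of_pure hpx)
  have hcom : ∀ i, i + 1 < m → act m (sg m i) v = v ∧ Commute w (sg m i) := by
    intro i hi
    apply commute_decomp
    rw [← hvw, inc_sg (by omega), ← hfix i (by omega)]
    change _ * _ = _ * _
    rw [← map_mul, ← map_mul, sg_xb_of_ne (by omega) le_rfl (by omega) (by omega)]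
  have hw : w = 1 := by
    refine eq_one_of_commute_of_lk hm ?_ (fun i hi => (hcom i hi).2) fun j hj k hk => ?_
    · rw [← hpx, hvw, perm_decomp]
    · rw [← lk_decomp v w hj hk, ← hvw, hx.2, lk_xb le_rfl, if_neg (by omega)]
  subst hw
  rw [map_one, mul_one] at hvw
  have hconj : IsConj (xf m m) v := by
    obtain ⟨g, e1⟩ : ∃ g, xb m m = g * sg (m + 1) 0 ^ 2 * g⁻¹ :=
      ⟨tl (m + 1) 0 ^ m, by rw [xb_last, sg_eq (by omega), conj_pow]⟩
    have hp : perm (m + 1) (ρ g * g⁻¹) = 1 := by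
      rw [map_mul, perm_hom hρ, ← map_mul, mul_inv_cancel, map_one]
    obtain ⟨a, b, hab⟩ := exists_decomp (fixes_of_pure hp)
    have hb : perm m b = 1 := by rw [← hp, hab, perm_decomp]
    have e2 : ρ (xb m m) = (ρ g * g⁻¹) * xb m m * (ρ g * g⁻¹)⁻¹ := by
      rw [e1, map_mul, map_mul, map_inv, map_pow, hfix 0 (by omega)]; group
    have e3 : v = a * act m b (xf m m) * a⁻¹ := by
      apply xhom_injective
      rw [← hvw, e2, hab, ← xhom_xf le_rfl, map_mul, map_mul, map_inv, xhom_act]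
      group
    have := isConj_act_xf b (j := m)
    rw [hb, Equiv.Perm.one_apply] at this
    rw [e3]
    exact this.symm.trans (isConj_iff.2 ⟨a, rfl⟩)
  have hxs : xb m (m - 1) = sg (m + 1) (m - 1) * xb m m * (sg (m + 1) (m - 1))⁻¹ := by
    have := sg_xb_succ (m := m) (i := m - 1) (by omega)
    rw [show m - 1 + 1 = m by omega] at this
    rw [this]
  have hrel : act m (sg m (m - 1)) (act m (sg m (m - 1)) v) =
      (act m (sg m (m - 1)) v)⁻¹ * v * act m (sg m (m - 1)) v := by
    apply xhom_injective
    have e1 : ρ (xb m (m - 1)) = xhom m (act m (sg m (m - 1)) v) := by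
      rw [hxs, map_mul, map_mul, map_inv, hfix _ (by omega), hvw, xhom_act, inc_sg (by omega)]
    have := congrArg ρ (sg_xb_xb (m := m) (i := m - 1) (by omega))
    rw [show m - 1 + 1 = m by omega] at this
    rw [xhom_act, inc_sg (by omega), map_mul (xhom m), map_mul (xhom m), map_inv (xhom m), ← e1, ← hvw,
      ← hfix (m - 1) (by omega)]
    rw [← map_inv, ← map_inv, ← map_mul, ← map_mul, this, map_mul, map_mul]
  obtain ⟨q, hq⟩ := eq_twist_of_relation hm hconj (fun i hi => (hcom i hi).1) hrel
  set τ := conjHom (xhom m (gf m (m + 1) ^ (-q))) ρ with hτ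
  apply Std.of_conj (c := xhom m (gf m (m + 1) ^ (-q)))
  rw [← hτ]
  have tinc : ∀ b, τ (inc m b) = inc m b := by
    intro b
    rw [hτ, conjHom_apply, hinc, mul_inv_eq_iff_eq_mul, inc_mul_xhom, map_zpow (act m b), act_last]
  have txb : ∀ k ≤ m, τ (xb m (m - k)) = xb m (m - k) := by
    intro k
    induction k with
    | zero =>
      intro _
      rw [Nat.sub_zero, hτ, conjHom_apply, hvw, hq, ← map_mul, ← map_inv, ← map_mul, ← xhom_xf le_rfl]
      congr 1; group
    | succ k ih =>
      intro hk
      have := sg_xb_succ (m := m) (i := m - (k + 1)) (by omega)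
      rw [show m - (k + 1) + 1 = m - k by omega] at this
      rw [← this, map_mul, map_mul, map_inv, ih (by omega), ← inc_sg (by omega), tinc]
  have tx : ∀ v, τ (xhom m v) = xhom m v := by
    have : τ.comp (xhom m) = xhom m := F_ext_xf fun j hj => by
      have := txb (m - j) (by omega)
      rw [show m - (m - j) = j by omega] at this
      rw [MonoidHom.comp_apply, xhom_xf hj, this]
    exact DFunLike.congr_fun this
  have tfix : ∀ b, Fixes b → τ b = b := by
    intro b hb
    obtain ⟨v, b', rfl⟩ := exists_decomp hb
    rw [map_mul, tx, tinc]
  have tperm : ∀ i < m + 1, perm (m + 1) (τ (sg (m + 1) i)) = Equiv.swap i (i + 1) := by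
    intro i hi
    rw [hτ, conjHom_apply, map_mul, map_mul, map_inv, perm_xhom, hρ i hi]; simp
  have hd : perm (m + 1) ((sg (m + 1) m)⁻¹ * τ (sg (m + 1) m)) = 1 := by
    rw [map_mul, perm_hom tperm, map_inv, inv_mul_cancel]
  obtain ⟨t, ht⟩ := exists_Z_zpow_of_commute (m + 1) _ hd (by
    intro p hp
    have h1 := tfix p (fixes_of_pure hp)
    have h2 := tfix _ (fixes_of_pure (perm_conj_pure (sg (m + 1) m) hp))
    rw [map_mul, map_mul, map_inv, h1] at h2
    change _ = _
    have h3 : τ (sg (m + 1) m) * p = sg (m + 1) m * p * (sg (m + 1) m)⁻¹ * τ (sg (m + 1) m) := by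
      rw [← h2]; group
    rw [mul_assoc, h3]; group)
  have hs : τ (sg (m + 1) m) = sg (m + 1) m * Z (m + 1) ^ t := by rw [← ht]; group
  have ts : ∀ i < m, τ (sg (m + 1) i) = sg (m + 1) i := fun i hi => by
    rw [← inc_sg hi, tinc]
  have hbr := (isBraid_sg (m + 1)).braid (m - 1) (by omega)
  rw [show m - 1 + 1 = m by omega] at hbr
  have hbr2 := congrArg τ hbr
  simp only [map_mul, hs, ts (m - 1) (by omega)] at hbr2
  have hZ : Z (m + 1) ^ t = 1 := by
    have hc := Z_zpow_commute (m := m + 1) t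
    generalize Z (m + 1) ^ t = ζ at hbr2 hc
    have e1 := hc (sg (m + 1) (m - 1))
    have e2 := hc (sg (m + 1) m)
    generalize sg (m + 1) (m - 1) = a at hbr hbr2 e1
    generalize sg (m + 1) m = b at hbr hbr2 e1 e2
    have e3 : a * (b * ζ) * a = b * a * b * ζ := by
      rw [← hbr, mul_assoc a, mul_assoc b, e1]; group
    have e4 : b * ζ * a * (b * ζ) = b * a * b * ζ * ζ := by
      rw [mul_assoc b, e1, ← mul_assoc, ← mul_assoc, mul_assoc (b * a), e2, ← mul_assoc]
    rw [e3, e4] at hbr2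
    simpa using hbr2
  refine ⟨1, 0, Or.inl fun i hi => ?_⟩
  rcases Nat.lt_succ_iff_lt_or_eq.1 hi with h | rfl
  · rw [ts i h]; simp
  · rw [hs, hZ]; simp

end Braid

namespace Braid
variable {m : ℕ}

theorem exists_factor {A B C : Type*} [Group A] [Group B] [Group C] {f : A →* B}
    (hf : Function.Injective f) (g : C →* B) (h : ∀ c, g c ∈ f.range) :
    ∃ φ : C →* A, ∀ c, g c = f (φ c) := by
  choose φ hφ using h
  exact ⟨MonoidHom.mk' φ fun a b => hf (by rw [map_mul, hφ, hφ, hφ, map_mul]), fun c => (hφ c).symm⟩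

/-- The image of `ρ (sg i)` after deleting the last strand is `sg i`. -/
def Lower (ρ : Br (m + 1) →* Br (m + 1)) : Prop :=
  ∀ i < m, ∃ u, ρ (sg (m + 1) i) = xhom m u * inc m (sg m i)

theorem keepsLk_of_forall {ρ : Br m →* Br m} {p : Br m} (hp : perm m p = 1)
    (h : ∀ j k, j < k → k ≤ m → lk (ρ p) j k = lk p j k) : KeepsLk ρ p := by
  refine ⟨hp, fun j k => ?_⟩
  rcases lt_trichotomy j k with h1 | rfl | h1
  · rcases le_or_gt k m with h2 | h2
    · exact h j k h1 h2
    · rw [lk_eq_zero_of_lt _ _ h2, lk_eq_zero_of_lt _ _ h2]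
  · rw [lk_self, lk_self]
  · rw [lk_symm, lk_symm p]
    rcases le_or_gt j m with h2 | h2
    · exact h k j h1 h2
    · rw [lk_eq_zero_of_lt _ _ h2, lk_eq_zero_of_lt _ _ h2]

theorem xhom_range_conj {a g : Br (m + 1)} (ha : a ∈ (xhom m).range) (hg : Fixes g) :
    g * a * g⁻¹ ∈ (xhom m).range := by
  obtain ⟨v, rfl⟩ := ha
  obtain ⟨u, b, rfl⟩ := exists_decomp hg
  refine ⟨u * act m b v * u⁻¹, ?_⟩
  rw [map_mul, map_mul, map_inv, xhom_act]; group

theorem fixes_sg {i : ℕ} (hi : i < m) : Fixes (sg (m + 1) i) := by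
  rw [Fixes, perm_sg (by omega), Equiv.swap_apply_of_ne_of_ne (by omega) (by omega)]

section
variable {ρ : Br (m + 1) →* Br (m + 1)}

theorem Lower.keepsLk
    (hρ : ∀ i < m + 1, perm (m + 1) (ρ (sg (m + 1) i)) = Equiv.swap i (i + 1)) (hL : Lower ρ)
    (hm : 3 ≤ m) : KeepsLk ρ (sg (m + 1) 0 ^ 2) := by
  obtain ⟨u, hu⟩ := hL 0 (by omega)
  have hps : perm (m + 1) (sg (m + 1) 0 ^ 2) = 1 := perm_sq (by omega)
  have hp : perm (m + 1) (ρ (sg (m + 1) 0 ^ 2)) = 1 := by rw [perm_hom hρ, hps]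
  have h1 : ∀ j ≤ m, ∀ k ≤ m, lk (ρ (sg (m + 1) 0 ^ 2)) j k = lk (sg (m + 1) 0 ^ 2) j k := by
    intro j hj k hk
    rw [map_pow, hu, sq, decomp_mul, lk_decomp _ _ hj hk, ← sq, lk_sq (by omega), lk_sq (by omega)]
  have h2 : ∀ l, 2 ≤ l → l ≤ m → ∀ j k, lk (ρ (sg (m + 1) 0 ^ 2)) j k =
      lk (ρ (sg (m + 1) 0 ^ 2)) (Equiv.swap l (l + 1) j) (Equiv.swap l (l + 1) k) := by
    intro l hl hlm j k
    have hc : sg (m + 1) l * sg (m + 1) 0 ^ 2 * (sg (m + 1) l)⁻¹ = sg (m + 1) 0 ^ 2 := by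
      rw [mul_inv_eq_iff_eq_mul]
      have : Commute (sg (m + 1) 0) (sg (m + 1) l) := (isBraid_sg (m + 1)).comm 0 l (by omega) (by omega)
      exact (this.pow_left 2).eq.symm
    conv_lhs => rw [← hc, map_mul, map_mul, map_inv]
    rw [lk_conj _ hp, hρ l (by omega), Equiv.swap_inv]
  have h3 : ∀ j < m, lk (ρ (sg (m + 1) 0 ^ 2)) j (m + 1) = 0 := by
    intro j hj
    rw [h2 m (by omega) le_rfl, Equiv.swap_apply_right, Equiv.swap_apply_of_ne_of_ne (by omega) (by omega),
      h1 j hj.le m le_rfl, lk_sq (by omega), if_neg (by omega)]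
  refine keepsLk_of_forall hps fun j k hjk hk => ?_
  rcases hk.lt_or_eq with h | rfl
  · exact h1 j (by omega) k (by omega)
  rw [lk_sq (by omega), if_neg (by omega)]
  rcases (Nat.lt_succ_iff.1 hjk).lt_or_eq with h | rfl
  · exact h3 j h
  · obtain ⟨k, rfl⟩ : ∃ k, j = k + 1 := ⟨j - 1, by omega⟩
    rw [h2 k (by omega) (by omega), Equiv.swap_apply_right, Equiv.swap_apply_of_ne_of_ne (by omega) (by omega)]
    exact h3 k (by omega)

theorem Lower.exists_restrict
    (hρ : ∀ i < m + 1, perm (m + 1) (ρ (sg (m + 1) i)) = Equiv.swap i (i + 1)) (hL : Lower ρ)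
    (hm : 3 ≤ m) :
    ∃ φ : F m →* F m, (∀ v, ρ (xhom m v) = xhom m (φ v)) ∧ ∀ j ≤ m, ∀ v, ex m j (φ v) = ex m j v := by
  have hk := hL.keepsLk hρ hm
  have hx : KeepsLk ρ (xb m m) := by
    rw [xb_last]; exact hk.sq hρ (by omega)
  have hx' : ∀ k ≤ m, KeepsLk ρ (xb m (m - k)) ∧ ρ (xb m (m - k)) ∈ (xhom m).range := by
    intro k
    induction k with
    | zero =>
      intro _
      rw [Nat.sub_zero]
      refine ⟨hx, ?_⟩
      have hpx : perm (m + 1) (ρ (xb m m)) = 1 := by rw [perm_hom hρ, hx.1]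
      obtain ⟨v, w, hvw⟩ := exists_decomp (fixes_of_pure hpx)
      have hw : w = 1 := by
        refine eq_one_of_commute_of_lk (by omega) ?_ (fun i hi => ?_) fun j hj k hk => ?_
        · rw [← hpx, hvw, perm_decomp]
        · have h1 := congrArg ρ (sg_xb_of_ne (m := m) (i := i) (j := m) (by omega) le_rfl (by omega) (by omega))
          obtain ⟨u, hu⟩ := hL i (by omega)
          rw [map_mul, map_mul, hu, hvw, decomp_mul, decomp_mul] at h1
          exact (decomp_inj h1).2.symm
        · rw [← lk_decomp v w hj hk, ← hvw, hx.2, lk_xb le_rfl, if_neg (by omega)]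
      exact ⟨v, by rw [hvw, hw, map_one, mul_one]⟩
    | succ k ih =>
      intro hk
      obtain ⟨h1, h2⟩ := ih (by omega)
      have := sg_xb_succ (m := m) (i := m - (k + 1)) (by omega)
      rw [show m - (k + 1) + 1 = m - k by omega] at this
      rw [← this]
      refine ⟨h1.conj hρ _, ?_⟩
      rw [map_mul, map_mul, map_inv]
      refine xhom_range_conj h2 ?_
      rw [Fixes, perm_hom hρ]
      exact fixes_sg (by omega)
  have hxx : ∀ k ≤ m, KeepsLk ρ (xb m k) ∧ ρ (xb m k) ∈ (xhom m).range := by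
    intro k hk
    have := hx' (m - k) (by omega)
    rwa [show m - (m - k) = k by omega] at this
  obtain ⟨φ, hφ⟩ := exists_factor (xhom_injective (m := m)) (ρ.comp (xhom m)) (by
    have key : ∀ k ≤ m + 1, ρ (xhom m (gf m k)) ∈ (xhom m).range := by
      intro k
      induction k with
      | zero => intro _; rw [gf_zero, map_one, map_one]; exact one_mem _
      | succ k ih =>
        intro hk
        have : gf m (k + 1) = xf m k * gf m k := by rw [xf]; group
        rw [this, map_mul, map_mul, xhom_xf (by omega)]
        exact mul_mem (hxx k (by omega)).2 (ih (by omega))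
    intro v
    induction v using FreeGroup.induction_on with
    | C1 => rw [map_one]; exact one_mem _
    | of i => rw [of_eq_gf]; exact key _ (by omega)
    | inv_of i h => rw [_root_.map_inv]; exact inv_mem h
    | mul a b ha hb => rw [_root_.map_mul]; exact mul_mem ha hb)
  refine ⟨φ, hφ, fun j hj => ?_⟩
  have : (ex m j).comp φ = ex m j := F_ext_xf fun k hk => by
    have h1 := (hxx k hk).1.2 j (m + 1)
    rw [← xhom_xf hk] at h1
    have h2 := hφ (xf m k)
    rw [MonoidHom.comp_apply] at h2
    rw [h2, lk_xhom_last _ hj, lk_xhom_last _ hj] at h1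
    rw [MonoidHom.comp_apply]
    apply Multiplicative.toAdd.injective
    omega
  exact DFunLike.congr_fun this

theorem Lower.std
    (hρ : ∀ i < m + 1, perm (m + 1) (ρ (sg (m + 1) i)) = Equiv.swap i (i + 1)) (hL : Lower ρ)
    (hm : 3 ≤ m) : Std ρ := by
  obtain ⟨φ, hφ, hex⟩ := hL.exists_restrict hρ hm
  have hlast : ∀ v, lastExp m v = ex m m v := by
    have : lastExp m = ex m m := F_ext fun k hk => by
      rw [lastExp_gf, ex_gf (by omega)]
      exact if_congr (by omega) rfl rfl
    exact DFunLike.congr_fun this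
  have hK : IsConj (φ (gf m (m + 1))) (gf m (m + 1)) := by
    refine isConj_last (by omega) (fun i hi => ?_) ?_
    · obtain ⟨u, hu⟩ := hL i hi
      have h1 : inc m (sg m i) * xhom m (gf m (m + 1)) = xhom m (gf m (m + 1)) * inc m (sg m i) := by
        rw [inc_mul_xhom, act_last]
      have h2 := congrArg ρ h1
      rw [map_mul, map_mul, inc_sg hi, hu, hφ] at h2
      have h3 := decomp_mul u (φ (gf m (m + 1))) (sg m i) 1
      have h4 := decomp_mul (φ (gf m (m + 1))) u 1 (sg m i)
      simp only [map_one, mul_one, MulAut.one_apply, one_mul] at h3 h4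
      rw [h3, h4] at h2
      refine isConj_iff.2 ⟨u, ?_⟩
      rw [(decomp_inj h2).1]; group
    · rw [hlast, hex m le_rfl, ex_gf le_rfl, if_pos (by omega)]
  obtain ⟨h, hh⟩ := isConj_iff.1 hK
  set τ := conjHom (xhom m h) ρ with hτ
  apply Std.of_conj (c := xhom m h)
  rw [← hτ]
  have tperm : ∀ i < m + 1, perm (m + 1) (τ (sg (m + 1) i)) = Equiv.swap i (i + 1) := by
    intro i hi
    rw [hτ, conjHom_apply, map_mul, map_mul, map_inv, perm_xhom, hρ i hi]; simp
  have tL : Lower τ := by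
    intro i hi
    obtain ⟨u, hu⟩ := hL i hi
    refine ⟨h * u * act m (sg m i) h⁻¹, ?_⟩
    rw [hτ, conjHom_apply, hu, map_mul (xhom m), map_mul (xhom m), xhom_act, map_inv]
    group
  have tc : τ (xhom m (gf m (m + 1))) = xhom m (gf m (m + 1)) := by
    rw [hτ, conjHom_apply, hφ, ← map_inv, ← map_mul, ← map_mul, hh]
  have tk := tL.keepsLk tperm hm
  refine std_of_fix_low (by omega) tperm fun i hi => ?_
  obtain ⟨u, hu⟩ := tL i hi
  have h1 : inc m (sg m i) * xhom m (gf m (m + 1)) = xhom m (gf m (m + 1)) * inc m (sg m i) := by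
    rw [inc_mul_xhom, act_last]
  have h2 := congrArg τ h1
  rw [map_mul, map_mul, inc_sg hi, hu, tc] at h2
  have h3 := decomp_mul u (gf m (m + 1)) (sg m i) 1
  have h4 := decomp_mul (gf m (m + 1)) u 1 (sg m i)
  simp only [map_one, mul_one, MulAut.one_apply, one_mul, act_last] at h3 h4
  rw [h3, h4] at h2
  obtain ⟨k, rfl⟩ := exists_zpow_of_commute_last (show Commute _ _ from (decomp_inj h2).1.symm)
  have h5 := (tk.sq tperm (i := i) (by omega)).2 0 (m + 1)
  rw [map_pow, hu, sq, decomp_mul, lk_decomp_last _ _ (by omega), lk_sq (by omega), if_neg (by omega), map_zpow (act m _), act_last,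
    ← zpow_add, map_zpow, ex_gf le_rfl, if_pos (by omega), toAdd_zpow] at h5
  simp at h5
  have hk : k = 0 := by omega
  rw [hu, hk, zpow_zero, map_one, one_mul, inc_sg hi]

end

theorem perm_eq_one_of_commute (hm : 2 ≤ m) {π : Equiv.Perm ℕ} (h0 : ∀ x, m < x → π x = x)
    (h : ∀ b, Commute π (perm m b)) : π = 1 := by
  ext j
  rw [Equiv.Perm.one_apply]
  by_contra hj
  have hjm : j ≤ m := by
    by_contra hc
    exact hj (h0 j (by omega))
  obtain ⟨l, hl, h1, h2⟩ : ∃ l ≤ m, l ≠ j ∧ l ≠ π j := by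
    rcases eq_or_ne j 0 with rfl | h3
    · rcases eq_or_ne (π 0) 1 with h4 | h4
      · exact ⟨2, hm, by omega, by omega⟩
      · exact ⟨1, by omega, by omega, fun h => h4 h.symm⟩
    · rcases eq_or_ne (π j) 0 with h4 | h4
      · rcases eq_or_ne j 1 with rfl | h5
        · exact ⟨2, by omega, by omega, by omega⟩
        · exact ⟨1, by omega, h5.symm, by omega⟩
      · exact ⟨0, by omega, h3.symm, h4.symm⟩
  obtain ⟨b, hb⟩ := perm_surjective m (Equiv.swap j l) fun x hx =>
    Equiv.swap_apply_of_ne_of_ne (by omega) (by omega)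
  have h3 := DFunLike.congr_fun (h b).eq j
  rw [hb, Equiv.Perm.mul_apply, Equiv.Perm.mul_apply, Equiv.swap_apply_left,
    Equiv.swap_apply_of_ne_of_ne hj h2.symm] at h3
  exact h1 (π.injective h3)

/-- Deletion of the last strand of a braid fixing its position. -/
noncomputable def rgt (b : Br (m + 1)) : Br m := (comb b).right

theorem rgt_mul {a : Br (m + 1)} (ha : Fixes a) (b : Br (m + 1)) : rgt (a * b) = rgt a * rgt b := by
  rw [rgt, comb_mul ha]; rfl

theorem rgt_decomp (v : F m) (b : Br m) : rgt (xhom m v * inc m b) = b := by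
  have := comb_iota (⟨v, b⟩ : SD m)
  rw [iota_apply] at this
  rw [rgt, this]

theorem exists_eq_rgt {b : Br (m + 1)} (hb : Fixes b) : ∃ u, b = xhom m u * inc m (rgt b) := by
  obtain ⟨u, b', rfl⟩ := exists_decomp hb
  exact ⟨u, by rw [rgt_decomp]⟩

theorem perm_rgt {b : Br (m + 1)} (hb : Fixes b) : perm m (rgt b) = perm (m + 1) b := by
  obtain ⟨u, b', rfl⟩ := exists_decomp hb
  rw [rgt_decomp, perm_decomp]

theorem fixes_inc (b : Br m) : Fixes (inc m b) := by
  rw [Fixes, perm_inc, perm_apply_of_lt _ (by omega)]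

theorem rgt_inc (b : Br m) : rgt (inc m b) = b := by
  have := rgt_decomp 1 b
  rwa [map_one, one_mul] at this

theorem rgt_Z_zpow (hm : 1 ≤ m) (t : ℤ) : rgt (Z (m + 1) ^ t) = Z m ^ t := by
  have h : Commute (xhom m (gf m (m + 1))) (inc m (Z m)) := by
    change _ * _ = _ * _
    rw [inc_mul_xhom, act_last]
  rw [Z_succ hm, h.mul_zpow, ← map_zpow, ← map_zpow, rgt_decomp]

theorem std_succ (hm : 3 ≤ m)
    (ih : ∀ ρ : Br m →* Br m, (∀ i < m, perm m (ρ (sg m i)) = Equiv.swap i (i + 1)) → Std ρ)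
    {ρ : Br (m + 1) →* Br (m + 1)}
    (hρ : ∀ i < m + 1, perm (m + 1) (ρ (sg (m + 1) i)) = Equiv.swap i (i + 1)) : Std ρ := by
  have hfix : ∀ b, Fixes (ρ (inc m b)) := fun b => by
    rw [Fixes, perm_hom hρ, perm_inc, perm_apply_of_lt _ (by omega)]
  let ρ' : Br m →* Br m := MonoidHom.mk' (fun b => rgt (ρ (inc m b))) fun a b => by
    rw [map_mul, map_mul, rgt_mul (hfix a)]
  have hρ' : ∀ i < m, perm m (ρ' (sg m i)) = Equiv.swap i (i + 1) := fun i hi => by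
    change perm m (rgt (ρ (inc m (sg m i)))) = _
    rw [perm_rgt (hfix _), inc_sg hi, hρ i (by omega)]
  have hS := ih ρ' hρ'
  have hval : ∀ i < m, ∃ u, ρ (sg (m + 1) i) = xhom m u * inc m (ρ' (sg m i)) := fun i hi => by
    obtain ⟨u, hu⟩ := exists_eq_rgt (hfix (sg m i))
    refine ⟨u, ?_⟩
    rw [← inc_sg hi, hu]; rfl
  clear_value ρ'
  clear hfix
  wlog hpos : ∃ (c : Br m) (t : ℤ), ∀ i < m, ρ' (sg m i) = c * sg m i * c⁻¹ * Z m ^ t generalizing ρ ρ' with hw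
  · apply Std.of_chi
    obtain ⟨c, t, h⟩ := hS
    have h := h.resolve_left fun h => hpos ⟨c, t, h⟩
    have hch : ∀ i < m, (ρ'.comp (chi m)) (sg m i) = c * sg m i * c⁻¹ * Z m ^ (-t) := by
      intro i hi
      rw [MonoidHom.comp_apply, chi_sg hi, map_inv, h i hi]
      rw [mul_inv_rev, ← zpow_neg, Z_zpow_commute]; group
    refine hw (ρ := ρ.comp (chi (m + 1))) (ρ' := ρ'.comp (chi m)) ?_ ?_ ⟨c, -t, Or.inl hch⟩ ?_ ⟨c, -t, hch⟩
    · intro i hi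
      rw [MonoidHom.comp_apply, chi_sg hi, map_inv, map_inv, hρ i hi, Equiv.swap_inv]
    · intro i hi
      rw [MonoidHom.comp_apply, chi_sg hi, map_inv, map_inv, hρ' i hi, Equiv.swap_inv]
    · intro i hi
      obtain ⟨u, hu⟩ := hval i hi
      refine ⟨act m (ρ' (sg m i))⁻¹ u⁻¹, ?_⟩
      rw [MonoidHom.comp_apply, MonoidHom.comp_apply, chi_sg hi, chi_sg (by omega), map_inv, map_inv, hu,
        mul_inv_rev, ← map_inv (xhom m), ← map_inv (inc m), inc_mul_xhom, map_inv ρ', map_inv (act m _) u]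
  obtain ⟨c, t, hc⟩ := hpos
  have hpc : perm m c = 1 := by
    refine perm_eq_one_of_commute (by omega) (fun x hx => perm_apply_of_lt _ hx) fun b => ?_
    have := mem_of_sg ((Subgroup.centralizer {perm m c}).comap (perm m)) (fun i hi => by
        rw [Subgroup.mem_comap, Subgroup.mem_centralizer_iff]
        rintro x rfl
        have h2 := hρ' i hi
        rw [hc i hi, map_mul, map_mul, map_mul, map_inv, map_zpow, perm_Z, one_zpow, mul_one, ← perm_sg hi,
          mul_inv_eq_iff_eq_mul] at h2
        exact h2) b
    rw [Subgroup.mem_comap, Subgroup.mem_centralizer_iff] at this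
    exact this _ rfl
  apply Std.of_conj (c := inc m c⁻¹)
  apply Std.of_tv (t := -t)
  have key : Lower (tv (conjHom (inc m c⁻¹) ρ) (-t)) := by
    intro i hi
    obtain ⟨u, hu⟩ := hval i hi
    rw [tv_sg _ _ (by omega), conjHom_apply, hu, hc i hi]
    have hf : Fixes (xhom m u * inc m (c * sg m i * c⁻¹ * Z m ^ t)) := by
      rw [Fixes, perm_decomp, perm_apply_of_lt _ (by omega)]
    have hf2 := ((fixes_inc c⁻¹).mul hf).mul (fixes_inc c⁻¹).inv
    obtain ⟨w, hw⟩ := exists_eq_rgt (hf2.mul (fixes_of_pure (b := Z (m + 1) ^ (-t)) (by simp [perm_Z])))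
    refine ⟨w, hw.trans ?_⟩
    congr 2
    rw [rgt_mul hf2, rgt_mul ((fixes_inc c⁻¹).mul hf), rgt_mul (fixes_inc c⁻¹), rgt_decomp, ← map_inv, rgt_inc,
      rgt_inc, rgt_Z_zpow (by omega), inv_inv, mul_assoc _ c, ← Z_zpow_commute (-t) c]
    group
  refine key.std (fun i hi => ?_) hm
  rw [tv_sg _ _ hi, conjHom_apply]
  simp only [map_mul, map_inv, map_zpow, perm_inc, hpc, hρ i hi, perm_Z]
  simp

theorem std_of_three (h3 : ∀ ρ : Br 3 →* Br 3, (∀ i < 3, perm 3 (ρ (sg 3 i)) = Equiv.swap i (i + 1)) → Std ρ)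
    (m : ℕ) (hm : 3 ≤ m) : ∀ ρ : Br m →* Br m, (∀ i < m, perm m (ρ (sg m i)) = Equiv.swap i (i + 1)) → Std ρ := by
  induction m, hm using Nat.le_induction with
  | base => exact h3
  | succ m hm ih => exact fun ρ hρ => std_succ hm ih hρ

end Braid

namespace Braid
open FreeGroup

/-- The automorphisms of the free group of rank two induced by the two generators. -/
def twist (i : ℕ) : MulAut (FreeGroup (Fin 2)) :=
  if i = 0 then
    MonoidHom.toMulEquiv (FreeGroup.lift ![of 0, of 1 * (of 0)⁻¹]) (FreeGroup.lift ![of 0, of 1 * of 0])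
      (by ext i; fin_cases i <;> simp) (by ext i; fin_cases i <;> simp)
  else
    MonoidHom.toMulEquiv (FreeGroup.lift ![of 0 * of 1, of 1]) (FreeGroup.lift ![of 0 * (of 1)⁻¹, of 1])
      (by ext i; fin_cases i <;> simp) (by ext i; fin_cases i <;> simp)

theorem twist_zero_zero : twist 0 (of 0) = of 0 := by simp [twist]
theorem twist_zero_one : twist 0 (of 1) = of 1 * (of 0)⁻¹ := by simp [twist]
theorem twist_one_zero : twist 1 (of 0) = of 0 * of 1 := by simp [twist]
theorem twist_one_one : twist 1 (of 1) = of 1 := by simp [twist]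

theorem mulAut_ext_two {f g : MulAut (FreeGroup (Fin 2))} (h0 : f (of 0) = g (of 0)) (h1 : f (of 1) = g (of 1)) :
    f = g := by
  have : f.toMonoidHom = g.toMonoidHom := by
    ext i
    fin_cases i
    · exact h0
    · exact h1
  exact MulEquiv.ext fun x => DFunLike.congr_fun this x

theorem isBraid_twist : IsBraid 2 twist where
  braid i hi := by
    obtain rfl : i = 0 := by omega
    apply mulAut_ext_two
    · simp [twist_zero_zero, twist_zero_one, twist_one_zero, twist_one_one, mul_assoc]
    · simp [twist_zero_zero, twist_zero_one, twist_one_zero, twist_one_one]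
  comm i j h1 h2 := by omega

/-- The action of the three-strand braid group on the free group of rank two. -/
def actTwo : Br 2 →* MulAut (FreeGroup (Fin 2)) := lift twist isBraid_twist

theorem actTwo_sg {i : ℕ} (hi : i < 2) : actTwo (sg 2 i) = twist i := lift_sg _ hi

theorem isBraid_proj : IsBraid 3 (fun i => if i = 1 then sg 2 1 else sg 2 0) where
  braid i hi := by
    have h := (isBraid_sg 2).braid 0 (by omega)
    obtain rfl | rfl : i = 0 ∨ i = 1 := by omega
    · simpa using h
    · simpa using h.symm
  comm i j h1 h2 := by
    obtain ⟨rfl, rfl⟩ : i = 0 ∧ j = 2 := by omega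
    simp

/-- The exceptional projection of the four-strand braid group onto the three-strand braid group. -/
def proj : Br 3 →* Br 2 := lift _ isBraid_proj

theorem proj_zero : proj (sg 3 0) = sg 2 0 := by rw [proj, lift_sg _ (by omega)]; simp
theorem proj_one : proj (sg 3 1) = sg 2 1 := by rw [proj, lift_sg _ (by omega)]; simp
theorem proj_two : proj (sg 3 2) = sg 2 0 := by rw [proj, lift_sg _ (by omega)]; simp

theorem proj_inc (b : Br 2) : proj (inc 2 b) = b := by
  have : proj.comp (inc 2) = MonoidHom.id _ := hom_ext fun i hi => by
    rw [MonoidHom.comp_apply, inc_sg hi]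
    obtain rfl | rfl : i = 0 ∨ i = 1 := by omega
    · rw [proj_zero]; rfl
    · rw [proj_one]; rfl
  exact DFunLike.congr_fun this b

theorem len_proj (b : Br 3) : len 2 (proj b) = len 3 b := by
  have : (len 2).comp proj = len 3 := hom_ext fun i hi => by
    rw [MonoidHom.comp_apply, len_sg hi]
    obtain rfl | rfl | rfl : i = 0 ∨ i = 1 ∨ i = 2 := by omega
    · rw [proj_zero, len_sg (by omega)]
    · rw [proj_one, len_sg (by omega)]
    · rw [proj_two, len_sg (by omega)]
  exact DFunLike.congr_fun this b

/-- The kernel of the exceptional projection. -/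
def ker2 : FreeGroup (Fin 2) →* Br 3 :=
  FreeGroup.lift ![sg 3 0 * (sg 3 2)⁻¹, (sg 3 0 * (sg 3 2)⁻¹)⁻¹ * sg 3 1 * (sg 3 0 * (sg 3 2)⁻¹) * (sg 3 1)⁻¹]

theorem ker2_zero : ker2 (of 0) = sg 3 0 * (sg 3 2)⁻¹ := by simp [ker2]

theorem ker2_one : ker2 (of 1) =
    (sg 3 0 * (sg 3 2)⁻¹)⁻¹ * sg 3 1 * (sg 3 0 * (sg 3 2)⁻¹) * (sg 3 1)⁻¹ := by simp [ker2]

theorem commutator_relations {G : Type*} [Group G] {x y z : G} (h1 : x * y * x = y * x * y)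
    (h2 : y * z * y = z * y * z) (h3 : x * z = z * x) :
    y * ((x * z⁻¹)⁻¹ * y * (x * z⁻¹) * y⁻¹) = (x * z⁻¹)⁻¹ * y * (x * z⁻¹) * y⁻¹ * y ∧
    x * ((x * z⁻¹)⁻¹ * y * (x * z⁻¹) * y⁻¹) = (x * z⁻¹)⁻¹ * y * (x * z⁻¹) * y⁻¹ * z := by
  have e1 : (x * z⁻¹)⁻¹ * y * (x * z⁻¹) * y⁻¹ = z * y * x * y⁻¹ * z⁻¹ * y⁻¹ := by
    have : x⁻¹ * y * x = y * x * y⁻¹ := by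
      rw [eq_mul_inv_iff_mul_eq, mul_assoc, mul_assoc, inv_mul_eq_iff_eq_mul, ← mul_assoc, ← mul_assoc, h1]
    calc _ = z * (x⁻¹ * y * x) * z⁻¹ * y⁻¹ := by group
      _ = _ := by rw [this]; group
  have e2 : y⁻¹ * z⁻¹ * y⁻¹ = z⁻¹ * y⁻¹ * z⁻¹ := by
    have := congrArg (·⁻¹) h2
    simpa [mul_assoc] using this
  have e3 : x * z⁻¹ = z⁻¹ * x := by
    rw [mul_inv_eq_iff_eq_mul, mul_assoc, h3]; group
  have e4 : z * y * z⁻¹ = y⁻¹ * z * y := by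
    rw [mul_inv_eq_iff_eq_mul, mul_assoc, mul_assoc, eq_inv_mul_iff_mul_eq, ← mul_assoc, ← mul_assoc, h2]
  rw [e1]
  constructor
  · calc y * (z * y * x * y⁻¹ * z⁻¹ * y⁻¹) = y * (z * y * x * (y⁻¹ * z⁻¹ * y⁻¹)) := by group
      _ = y * (z * y * (x * z⁻¹) * y⁻¹ * z⁻¹) := by rw [e2]; group
      _ = y * ((z * y * z⁻¹) * x * y⁻¹ * z⁻¹) := by rw [e3]; group
      _ = _ := by rw [e4]; group
  · calc x * (z * y * x * y⁻¹ * z⁻¹ * y⁻¹) = (x * z) * y * x * (y⁻¹ * z⁻¹ * y⁻¹) := by group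
      _ = z * (x * y * x) * (z⁻¹ * y⁻¹ * z⁻¹) := by rw [h3, e2]; group
      _ = z * y * x * y * (z⁻¹ * y⁻¹ * z⁻¹) := by rw [h1]; group
      _ = z * y * x * z⁻¹ * y⁻¹ := by rw [← e2]; group
      _ = z * y * x * (z⁻¹ * y⁻¹ * z⁻¹) * z := by group
      _ = _ := by rw [← e2]; group

theorem ker2_act (b : Br 2) (v : FreeGroup (Fin 2)) :
    ker2 (actTwo b v) = inc 2 b * ker2 v * (inc 2 b)⁻¹ := by
  induction b using br_induction generalizing v with
  | one => simp
  | sg i hi =>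
    rw [actTwo_sg hi, inc_sg hi]
    have h := commutator_relations ((isBraid_sg 3).braid 0 (by omega)) ((isBraid_sg 3).braid 1 (by omega))
      ((isBraid_sg 3).comm 0 2 (by omega) (by omega))
    simp only [zero_add, Nat.reduceAdd] at h
    have : ker2.comp (twist i).toMonoidHom = (MulAut.conj (sg 3 i)).toMonoidHom.comp ker2 := by
      obtain rfl | rfl : i = 0 ∨ i = 1 := by omega
      · ext j
        fin_cases j
        · change ker2 (twist 0 (of 0)) = sg 3 0 * ker2 (of 0) * (sg 3 0)⁻¹
          have h3 : Commute (sg 3 0) (sg 3 2) := (isBraid_sg 3).comm 0 2 (by omega) (by omega)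
          rw [twist_zero_zero, ker2_zero, eq_mul_inv_iff_mul_eq]
          exact ((Commute.refl _).mul_right h3.inv_right).eq.symm
        · change ker2 (twist 0 (of 1)) = sg 3 0 * ker2 (of 1) * (sg 3 0)⁻¹
          rw [twist_zero_one, _root_.map_mul, _root_.map_inv, ker2_zero, ker2_one, h.2]
          group
      · ext j
        fin_cases j
        · change ker2 (twist 1 (of 0)) = sg 3 1 * ker2 (of 0) * (sg 3 1)⁻¹
          rw [twist_one_zero, _root_.map_mul, ker2_zero, ker2_one]
          group
        · change ker2 (twist 1 (of 1)) = sg 3 1 * ker2 (of 1) * (sg 3 1)⁻¹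
          rw [twist_one_one, eq_mul_inv_iff_mul_eq, ker2_one, h.1]
    exact DFunLike.congr_fun this v
  | mul a b ha hb => rw [_root_.map_mul, MulAut.mul_apply, ha, hb, _root_.map_mul]; group
  | inv a ha =>
    have := ha (actTwo a⁻¹ v)
    rw [← MulAut.mul_apply, ← _root_.map_mul, mul_inv_cancel, _root_.map_one, MulAut.one_apply] at this
    rw [this, _root_.map_inv (inc 2), inv_inv]
    simp only [mul_assoc, inv_mul_cancel_left, inv_mul_cancel, mul_one]

theorem inc_mul_ker2 (b : Br 2) (v : FreeGroup (Fin 2)) :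
    inc 2 b * ker2 v = ker2 (actTwo b v) * inc 2 b := by
  rw [ker2_act]; group

theorem proj_ker2 (v : FreeGroup (Fin 2)) : proj (ker2 v) = 1 := by
  have : proj.comp ker2 = 1 := by
    ext i
    fin_cases i
    · change proj (ker2 (of 0)) = 1
      rw [ker2_zero, _root_.map_mul, _root_.map_inv, proj_zero, proj_two, mul_inv_cancel]
    · change proj (ker2 (of 1)) = 1
      rw [ker2_one]
      simp [proj_zero, proj_two]
  exact DFunLike.congr_fun this v

theorem exists_ker2 (b : Br 3) : ∃ v, b = ker2 v * inc 2 (proj b) := by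
  induction b using br_induction with
  | one => exact ⟨1, by simp⟩
  | sg i hi =>
    obtain rfl | rfl | rfl : i = 0 ∨ i = 1 ∨ i = 2 := by omega
    · exact ⟨1, by rw [proj_zero, inc_sg (by omega), _root_.map_one, one_mul]⟩
    · exact ⟨1, by rw [proj_one, inc_sg (by omega), _root_.map_one, one_mul]⟩
    · exact ⟨(of 0)⁻¹, by rw [proj_two, inc_sg (by omega), _root_.map_inv, ker2_zero]; group⟩
  | mul a b ha hb =>
    obtain ⟨u, hu⟩ := ha
    obtain ⟨v, hv⟩ := hb
    refine ⟨u * actTwo (proj a) v, ?_⟩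
    rw [_root_.map_mul, _root_.map_mul, _root_.map_mul, mul_assoc, ← mul_assoc (ker2 (actTwo _ _)), ← inc_mul_ker2]
    conv_lhs => rw [hu, hv]
    group
  | inv a ha =>
    obtain ⟨u, hu⟩ := ha
    refine ⟨actTwo (proj a)⁻¹ u⁻¹, ?_⟩
    rw [_root_.map_inv proj, ← inc_mul_ker2, _root_.map_inv, _root_.map_inv, ← mul_inv_rev, ← hu]

theorem isBraid_split : IsBraid 3 (fun i => if i = 2 then
    (SemidirectProduct.inl (of 0)⁻¹ * SemidirectProduct.inr (sg 2 0) : FreeGroup (Fin 2) ⋊[actTwo] Br 2)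
    else SemidirectProduct.inr (sg 2 i)) where
  braid i hi := by
    have h := (isBraid_sg 2).braid 0 (by omega)
    obtain rfl | rfl : i = 0 ∨ i = 1 := by omega
    · simp only [zero_add, if_neg (show (0 : ℕ) ≠ 2 by omega), if_neg (show (1 : ℕ) ≠ 2 by omega)]
      rw [← _root_.map_mul, ← _root_.map_mul, ← _root_.map_mul, ← _root_.map_mul, h]
    · ext
      · simp [actTwo_sg, twist_zero_zero, twist_zero_one, twist_one_zero, twist_one_one, mul_assoc]
      · simpa using h.symm
  comm i j h1 h2 := by
    obtain ⟨rfl, rfl⟩ : i = 0 ∧ j = 2 := by omega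
    ext
    · simp [actTwo_sg, twist_zero_zero]
    · simp

/-- The splitting of the four-strand braid group as a semidirect product. -/
def split : Br 3 →* FreeGroup (Fin 2) ⋊[actTwo] Br 2 := lift _ isBraid_split

theorem split_zero : split (sg 3 0) = SemidirectProduct.inr (sg 2 0) := by
  rw [split, lift_sg _ (by omega)]; simp
theorem split_one : split (sg 3 1) = SemidirectProduct.inr (sg 2 1) := by
  rw [split, lift_sg _ (by omega)]; simp
theorem split_two : split (sg 3 2) = SemidirectProduct.inl (of 0)⁻¹ * SemidirectProduct.inr (sg 2 0) := by
  rw [split, lift_sg _ (by omega)]; simp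

theorem split_ker2 (v : FreeGroup (Fin 2)) : split (ker2 v) = SemidirectProduct.inl v := by
  have : split.comp ker2 = SemidirectProduct.inl := by
    have h0 : split (ker2 (of 0)) = SemidirectProduct.inl (of 0) := by
      rw [ker2_zero, _root_.map_mul, _root_.map_inv, split_zero, split_two]
      simp
    have h1 : split (ker2 (of 1)) = SemidirectProduct.inl (of 1) := by
      rw [ker2_one, ← ker2_zero, _root_.map_mul, _root_.map_mul, _root_.map_mul, _root_.map_inv, _root_.map_inv, h0,
        split_one]
      ext
      · simp [actTwo_sg, twist_one_zero]
      · simp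
    refine FreeGroup.ext_hom _ _ fun i => ?_
    fin_cases i
    · exact h0
    · exact h1
  exact DFunLike.congr_fun this v

theorem ker2_injective : Function.Injective ker2 := fun a b h =>
  SemidirectProduct.inl_injective (φ := actTwo) (by rw [← split_ker2, ← split_ker2, h])

end Braid

namespace Braid
open FreeGroup

/-- The abelianisation of the free group of rank two. -/
def vec (v : FreeGroup (Fin 2)) : Fin 2 → ℤ :=
  (FreeGroup.lift (fun i => Multiplicative.ofAdd (Pi.single i 1 : Fin 2 → ℤ)) v).toAdd

theorem vec_one : vec 1 = 0 := by simp [vec]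
theorem vec_of (i : Fin 2) : vec (of i) = Pi.single i 1 := by simp [vec]
theorem vec_mul (u v : FreeGroup (Fin 2)) : vec (u * v) = vec u + vec v := by simp [vec]
theorem vec_inv (u : FreeGroup (Fin 2)) : vec u⁻¹ = -vec u := by simp [vec]
theorem vec_zpow (u : FreeGroup (Fin 2)) (k : ℤ) : vec (u ^ k) = k • vec u := by simp [vec]

/-- The matrix of an endomorphism of the free group of rank two. -/
def mat (φ : FreeGroup (Fin 2) →* FreeGroup (Fin 2)) : Matrix (Fin 2) (Fin 2) ℤ :=
  Matrix.of fun i j => vec (φ (of j)) i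

theorem vec_map (φ : FreeGroup (Fin 2) →* FreeGroup (Fin 2)) (v : FreeGroup (Fin 2)) :
    vec (φ v) = (mat φ).mulVec (vec v) := by
  induction v using FreeGroup.induction_on with
  | C1 => simp [vec_one]
  | of i => rw [vec_of]; ext j; simp [mat]
  | inv_of i h => rw [_root_.map_inv, vec_inv, vec_inv, h, Matrix.mulVec_neg]
  | mul u v hu hv => rw [_root_.map_mul, vec_mul, vec_mul, hu, hv, Matrix.mulVec_add]

theorem mat_comp (φ ψ : FreeGroup (Fin 2) →* FreeGroup (Fin 2)) : mat (φ.comp ψ) = mat φ * mat ψ := by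
  ext i j
  simp only [mat, Matrix.of_apply, MonoidHom.comp_apply]
  rw [vec_map]
  simp [Matrix.mul_apply, Matrix.mulVec, dotProduct, mat]

/-- The two standard parabolic matrices. -/
def parab (i : ℕ) : Matrix.SpecialLinearGroup (Fin 2) ℤ :=
  if i = 0 then ⟨!![1, -1; 0, 1], by simp⟩ else ⟨!![1, 0; 1, 1], by simp⟩

theorem coe_parab_zero : (parab 0 : Matrix (Fin 2) (Fin 2) ℤ) = !![1, -1; 0, 1] := rfl
theorem coe_parab_one : (parab 1 : Matrix (Fin 2) (Fin 2) ℤ) = !![1, 0; 1, 1] := rfl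

theorem isBraid_parab : IsBraid 2 parab where
  braid i hi := by
    obtain rfl : i = 0 := by omega
    apply Subtype.ext
    simp only [Matrix.SpecialLinearGroup.coe_mul, coe_parab_zero, coe_parab_one, zero_add]
    ext i j
    fin_cases i <;> fin_cases j <;> simp
  comm i j h1 h2 := by omega

/-- The representation of the three-strand braid group by integral matrices. -/
def slm : Br 2 →* Matrix.SpecialLinearGroup (Fin 2) ℤ := lift parab isBraid_parab

theorem slm_zero : (slm (sg 2 0) : Matrix (Fin 2) (Fin 2) ℤ) = !![1, -1; 0, 1] := by
  rw [slm, lift_sg _ (by omega)]; rfl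
theorem slm_one : (slm (sg 2 1) : Matrix (Fin 2) (Fin 2) ℤ) = !![1, 0; 1, 1] := by
  rw [slm, lift_sg _ (by omega)]; rfl

theorem slm_eq_mat (b : Br 2) : (slm b : Matrix (Fin 2) (Fin 2) ℤ) = mat (actTwo b).toMonoidHom := by
  induction b using br_induction with
  | one =>
    ext i j
    fin_cases i <;> fin_cases j <;> simp [mat, vec_of]
  | sg i hi =>
    obtain rfl | rfl : i = 0 ∨ i = 1 := by omega
    · rw [slm_zero]
      ext i j
      fin_cases i <;> fin_cases j <;>
        simp [mat, actTwo_sg, twist_zero_zero, twist_zero_one, vec_mul, vec_inv, vec_of]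
    · rw [slm_one]
      ext i j
      fin_cases i <;> fin_cases j <;>
        simp [mat, actTwo_sg, twist_one_zero, twist_one_one, vec_mul, vec_inv, vec_of]
  | mul a b ha hb =>
    rw [_root_.map_mul, Matrix.SpecialLinearGroup.coe_mul, ha, hb, ← mat_comp]
    congr 1
    ext x
    simp
  | inv a ha =>
    have h1 : mat (actTwo a).toMonoidHom * mat (actTwo a⁻¹).toMonoidHom = 1 := by
      rw [← mat_comp]
      have : (actTwo a).toMonoidHom.comp (actTwo a⁻¹).toMonoidHom = MonoidHom.id _ := by
        ext x
        simp
      rw [this]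
      ext i j
      fin_cases i <;> fin_cases j <;> simp [mat, vec_of]
    have h2 : (slm a⁻¹ : Matrix (Fin 2) (Fin 2) ℤ) * slm a = 1 := by
      rw [← Matrix.SpecialLinearGroup.coe_mul, ← _root_.map_mul]
      simp
    rw [← ha] at h1
    exact left_inv_eq_right_inv h2 h1

theorem vec_actTwo (b : Br 2) (v : FreeGroup (Fin 2)) :
    vec (actTwo b v) = (slm b : Matrix (Fin 2) (Fin 2) ℤ).mulVec (vec v) := by
  rw [slm_eq_mat]
  exact vec_map (actTwo b).toMonoidHom v

theorem slm_surjective : Function.Surjective slm := by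
  rw [← MonoidHom.range_eq_top, eq_top_iff, ← SpecialLinearGroup.SL2Z_generators, Subgroup.closure_le]
  rintro _ (rfl | rfl)
  · refine ⟨sg 2 0 * sg 2 1 * sg 2 0, ?_⟩
    apply Subtype.ext
    rw [_root_.map_mul, _root_.map_mul, Matrix.SpecialLinearGroup.coe_mul, Matrix.SpecialLinearGroup.coe_mul,
      slm_zero, slm_one]
    ext i j
    fin_cases i <;> fin_cases j <;> simp [ModularGroup.S]
  · refine ⟨(sg 2 0)⁻¹, ?_⟩
    apply Subtype.ext
    rw [_root_.map_inv, Matrix.SpecialLinearGroup.coe_inv, slm_zero]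
    ext i j
    fin_cases i <;> fin_cases j <;> simp [ModularGroup.T, Matrix.adjugate_fin_two]

/-- The positive words in the two standard parabolic elements. -/
inductive Pos : Br 2 → Prop
  | one : Pos 1
  | left {w : Br 2} : Pos w → Pos ((sg 2 0)⁻¹ * w)
  | right {w : Br 2} : Pos w → Pos (sg 2 1 * w)

theorem Pos.entries {w : Br 2} (h : Pos w) : 1 ≤ (slm w) 0 0 ∧ 0 ≤ (slm w) 0 1 ∧ 0 ≤ (slm w) 1 0 ∧
    1 ≤ (slm w) 1 1 ∧ (w = 1 ∨ 1 ≤ (slm w) 0 1 + (slm w) 1 0) := by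
  induction h with
  | one => simp
  | @left w _ ih =>
    have : (slm ((sg 2 0)⁻¹ * w) : Matrix (Fin 2) (Fin 2) ℤ) = !![1, 1; 0, 1] * (slm w : Matrix (Fin 2) (Fin 2) ℤ) := by
      rw [_root_.map_mul, _root_.map_inv, Matrix.SpecialLinearGroup.coe_mul, Matrix.SpecialLinearGroup.coe_inv, slm_zero]
      simp [Matrix.adjugate_fin_two]
    rw [this]
    simp only [Matrix.mul_apply, Fin.sum_univ_two]
    simp
    omega
  | @right w _ ih =>
    have : (slm (sg 2 1 * w) : Matrix (Fin 2) (Fin 2) ℤ) = !![1, 0; 1, 1] * (slm w : Matrix (Fin 2) (Fin 2) ℤ) := by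
      rw [_root_.map_mul, Matrix.SpecialLinearGroup.coe_mul, slm_one]
    rw [this]
    simp only [Matrix.mul_apply, Fin.sum_univ_two]
    simp
    omega

theorem half_twist_relations : sg 2 0 = (tl 2 0)⁻¹ * (sg 2 0 * sg 2 1 * sg 2 0) ∧
    sg 2 1 = (sg 2 0 * sg 2 1 * sg 2 0) * (tl 2 0)⁻¹ ∧ (sg 2 0 * sg 2 1 * sg 2 0) ^ 2 = Z 2 := by
  have h := (isBraid_sg 2).braid 0 (by omega)
  have e : tl 2 0 = sg 2 0 * sg 2 1 := by
    rw [tl_eq (by omega), tl_eq (by omega), tl_of_le (by omega), mul_one]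
  simp only [zero_add] at h
  refine ⟨by rw [e]; group, ?_, ?_⟩
  · rw [e, h]; group
  · rw [Z, e]
    calc _ = (sg 2 0 * sg 2 1 * sg 2 0) * (sg 2 0 * sg 2 1 * sg 2 0) := by rw [pow_two]
      _ = (sg 2 0 * sg 2 1 * sg 2 0) * (sg 2 1 * sg 2 0 * sg 2 1) := by rw [← h]
      _ = _ := by simp [pow_succ, mul_assoc]

/-- The elements having a normal form. -/
def Normal (x y b : Br 2) : Prop := ∃ w, Pos w ∧ ∃ (i j : ℕ) (k : ℤ), i < 3 ∧ j < 2 ∧ b = y ^ i * w * x ^ j * Z 2 ^ k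

theorem normal_mul_left {x y : Br 2} (h0 : sg 2 0 = y⁻¹ * x) (h1 : sg 2 1 = x * y⁻¹) (hx : x ^ 2 = Z 2)
    (hy : y ^ 3 = Z 2) {b : Br 2} (h : Normal x y b) :
    Normal x y (y * b) ∧ Normal x y (x * b) ∧ ∀ k : ℤ, Normal x y (Z 2 ^ k * b) := by
  obtain ⟨w, hw, i, j, k, hi, hj, rfl⟩ := h
  have hZ : ∀ (t : ℤ) (a b c : Br 2), Normal x y (a * b * c * Z 2 ^ (k + t)) → ∀ d, d = Z 2 ^ t * (a * b * c * Z 2 ^ k) →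
      Normal x y d := by
    rintro t a b c h d rfl
    rwa [Z_zpow_commute, mul_assoc, ← zpow_add]
  have e1 : ∀ u : Br 2, x * u = Z 2 * (x⁻¹ * u) := by
    intro u; rw [← hx]; group
  refine ⟨?_, ?_, fun t => hZ t _ _ _ ⟨w, hw, i, j, k + t, hi, hj, rfl⟩ _ rfl⟩
  · by_cases h : i + 1 < 3
    · exact ⟨w, hw, i + 1, j, k, h, hj, by rw [pow_succ']; group⟩
    · obtain rfl : i = 2 := by omega
      refine hZ 1 1 w (x ^ j) ⟨w, hw, 0, j, k + 1, by omega, hj, by rw [pow_zero]⟩ _ ?_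
      rw [zpow_one, ← hy]; simp [pow_succ, mul_assoc]
  · obtain rfl | rfl | rfl : i = 0 ∨ i = 1 ∨ i = 2 := by omega
    · cases hw with
      | one =>
        obtain rfl | rfl : j = 0 ∨ j = 1 := by omega
        · exact ⟨1, .one, 0, 1, k, by omega, by omega, by simp⟩
        · refine hZ 1 1 1 1 ⟨1, .one, 0, 0, k + 1, by omega, by omega, by simp⟩ _ ?_
          rw [zpow_one, ← hx]; simp [pow_succ, mul_assoc]
      | @left w hw => exact ⟨w, hw, 1, j, k, by omega, hj, by rw [h0]; group⟩
      | @right w hw =>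
        refine ⟨w, hw, 2, j, k, by omega, hj, ?_⟩
        have : x * (x * y⁻¹) = y ^ 2 := by
          rw [← mul_assoc, ← pow_two, hx, ← hy]; group
        rw [h1, pow_zero, one_mul, ← this]
        simp only [mul_assoc]
    · refine hZ 1 1 ((sg 2 0)⁻¹ * w) (x ^ j) ⟨(sg 2 0)⁻¹ * w, .left hw, 0, j, k + 1, by omega, hj, by rw [pow_zero]⟩ _ ?_
      rw [zpow_one, ← hx, h0]; group
    · refine hZ 1 1 (sg 2 1 * w) (x ^ j) ⟨sg 2 1 * w, .right hw, 0, j, k + 1, by omega, hj, by rw [pow_zero]⟩ _ ?_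
      have : x * y ^ 2 = Z 2 * (x * y⁻¹) := by
        rw [← hy, hy, (Z_commute _).eq, ← hy]; group
      rw [zpow_one, h1, one_mul]
      simp only [← mul_assoc] at this ⊢
      rw [this]

theorem normal (b : Br 2) : Normal (sg 2 0 * sg 2 1 * sg 2 0) (tl 2 0) b := by
  obtain ⟨h0, h1, hx⟩ := half_twist_relations
  set x := sg 2 0 * sg 2 1 * sg 2 0
  set y := tl 2 0
  have hy : y ^ 3 = Z 2 := rfl
  have hx' : x⁻¹ = Z 2 ^ (-1 : ℤ) * x := by rw [← hx]; group
  have hy' : y⁻¹ = Z 2 ^ (-1 : ℤ) * y * y := by rw [← hy]; group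
  let S : Subgroup (Br 2) :=
    { carrier := {g | (∀ b, Normal x y b → Normal x y (g * b)) ∧ ∀ b, Normal x y b → Normal x y (g⁻¹ * b)}
      one_mem' := by constructor <;> intro b hb <;> simpa using hb
      mul_mem' := fun {g h} hg hh => ⟨fun b hb => by rw [mul_assoc]; exact hg.1 _ (hh.1 _ hb),
        fun b hb => by rw [mul_inv_rev, mul_assoc]; exact hh.2 _ (hg.2 _ hb)⟩
      inv_mem' := fun {g} hg => ⟨hg.2, fun b hb => by rw [inv_inv]; exact hg.1 _ hb⟩ }
  have hxS : x ∈ S := ⟨fun b hb => (normal_mul_left h0 h1 hx hy hb).2.1, fun b hb => by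
    rw [hx', mul_assoc]
    exact (normal_mul_left h0 h1 hx hy (normal_mul_left h0 h1 hx hy hb).2.1).2.2 _⟩
  have hyS : y ∈ S := ⟨fun b hb => (normal_mul_left h0 h1 hx hy hb).1, fun b hb => by
    rw [hy', mul_assoc, mul_assoc]
    exact (normal_mul_left h0 h1 hx hy (normal_mul_left h0 h1 hx hy (normal_mul_left h0 h1 hx hy hb).1).1).2.2 _⟩
  have : b ∈ S := mem_of_sg S (fun i hi => by
    obtain rfl | rfl : i = 0 ∨ i = 1 := by omega
    · rw [h0]; exact S.mul_mem (S.inv_mem hyS) hxS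
    · rw [h1]; exact S.mul_mem hxS (S.inv_mem hyS)) b
  have := this.1 1 ⟨1, .one, 0, 0, 0, by omega, by omega, by simp⟩
  rwa [mul_one] at this

theorem exists_zpow_of_slm_eq_one {b : Br 2} (hb : slm b = 1) : ∃ k : ℤ, b = Z 2 ^ (2 * k) := by
  obtain ⟨w, hw, i, j, k, hi, hj, rfl⟩ := normal b
  have hx : (slm (sg 2 0 * sg 2 1 * sg 2 0) : Matrix (Fin 2) (Fin 2) ℤ) = !![0, -1; 1, 0] := by
    simp [slm_zero, slm_one]
  have hy : (slm (tl 2 0) : Matrix (Fin 2) (Fin 2) ℤ) = !![0, -1; 1, 1] := by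
    rw [tl_eq (by omega), tl_eq (by omega), tl_of_le (by omega), mul_one]
    simp [slm_zero, slm_one]
  have hZ : slm (Z 2) = -1 := by
    rw [← half_twist_relations.2.2, _root_.map_pow]
    apply Subtype.ext
    rw [Matrix.SpecialLinearGroup.coe_pow, hx]
    ext i j
    fin_cases i <;> fin_cases j <;> simp [pow_two]
  have hk : slm (Z 2 ^ k) = 1 ∧ Even k ∨ slm (Z 2 ^ k) = -1 ∧ ¬ Even k := by
    rw [_root_.map_zpow, hZ]
    rcases Int.even_or_odd k with h | h
    · exact Or.inl ⟨h.neg_one_zpow, h⟩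
    · exact Or.inr ⟨h.neg_one_zpow, by simpa using h⟩
  obtain ⟨h1, h2, h3, h4, h5⟩ := hw.entries
  generalize sg 2 0 * sg 2 1 * sg 2 0 = x at hx hb ⊢
  have e := congrArg (fun A : Matrix.SpecialLinearGroup (Fin 2) ℤ => (A : Matrix (Fin 2) (Fin 2) ℤ)) hb
  simp only [_root_.map_mul, _root_.map_pow, Matrix.SpecialLinearGroup.coe_mul, Matrix.SpecialLinearGroup.coe_pow,
    hx, hy, Matrix.SpecialLinearGroup.coe_one] at e
  rw [Matrix.eta_fin_two (slm w : Matrix (Fin 2) (Fin 2) ℤ)] at e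
  have e00 := congrFun (congrFun e 0) 0
  have e01 := congrFun (congrFun e 0) 1
  have e10 := congrFun (congrFun e 1) 0
  have e11 := congrFun (congrFun e 1) 1
  rcases hk with ⟨hk, hev⟩ | ⟨hk, hev⟩ <;> simp only [hk] at e00 e01 e10 e11 <;>
  obtain rfl | rfl | rfl : i = 0 ∨ i = 1 ∨ i = 2 := by omega
  all_goals obtain rfl | rfl : j = 0 ∨ j = 1 := by omega
  all_goals simp [pow_two] at e00 e01 e10 e11
  all_goals first
    | (exfalso; omega)
    | skip
  obtain rfl : w = 1 := by rcases h5 with h | h; exacts [h, by omega]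
  obtain ⟨t, rfl⟩ := hev
  exact ⟨t, by simp [two_mul]⟩

end Braid

namespace Braid
open FreeGroup

theorem trace_eq_of_braid {A B : Matrix.SpecialLinearGroup (Fin 2) ℤ} (h : A * B * A = B * A * B) :
    A 0 0 + A 1 1 = B 0 0 + B 1 1 := by
  have h1 : B = (A * B) * A * (A * B)⁻¹ := by rw [h]; group
  have h2 : (B : Matrix (Fin 2) (Fin 2) ℤ).trace = (A : Matrix (Fin 2) (Fin 2) ℤ).trace := by
    conv_lhs => rw [h1]
    rw [Matrix.SpecialLinearGroup.coe_mul, Matrix.trace_mul_comm, ← Matrix.SpecialLinearGroup.coe_mul]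
    congr 2
    rw [inv_mul_cancel_left]
  simpa [Matrix.trace_fin_two] using h2.symm

theorem det_entries (A : Matrix.SpecialLinearGroup (Fin 2) ℤ) : A 0 0 * A 1 1 - A 0 1 * A 1 0 = 1 := by
  rw [← Matrix.det_fin_two]; exact A.2

theorem mul_entry (A B : Matrix.SpecialLinearGroup (Fin 2) ℤ) (i j : Fin 2) : (A * B) i j = A i 0 * B 0 j + A i 1 * B 1 j := by
  rw [Matrix.SpecialLinearGroup.coe_mul, Matrix.mul_apply, Fin.sum_univ_two]

theorem ext_entries {A B : Matrix.SpecialLinearGroup (Fin 2) ℤ} (h0 : A 0 0 = B 0 0) (h1 : A 0 1 = B 0 1) (h2 : A 1 0 = B 1 0)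
    (h3 : A 1 1 = B 1 1) : A = B := by
  ext i j
  fin_cases i <;> fin_cases j <;> assumption

theorem eq_or_trace_eq_one {A B : Matrix.SpecialLinearGroup (Fin 2) ℤ} (h : A * B * A = B * A * B) :
    A = B ∨ A 0 0 * B 0 0 + A 0 1 * B 1 0 + A 1 0 * B 0 1 + A 1 1 * B 1 1 = 1 := by
  have ht := trace_eq_of_braid h
  have dA := det_entries A
  have dB := det_entries B
  have e (i j : Fin 2) := congrArg (fun M : Matrix.SpecialLinearGroup (Fin 2) ℤ => M i j) h
  simp only [mul_entry] at e
  have e00 := e 0 0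
  have e01 := e 0 1
  have e10 := e 1 0
  have e11 := e 1 1
  rw [or_iff_not_imp_right]
  intro hc
  have hc' := sub_ne_zero.mpr hc
  apply ext_entries <;> rw [← sub_eq_zero] <;> apply (mul_eq_zero.mp _).resolve_left hc'
  · linear_combination e00 + B 1 1 * dA - A 1 1 * dB - ht
  · linear_combination e01 - B 0 1 * dA + A 0 1 * dB
  · linear_combination e10 - B 1 0 * dA + A 1 0 * dB
  · linear_combination e11 + B 0 0 * dA - A 0 0 * dB - ht

/-- Commuting matrices braiding with a common matrix agree. -/
theorem eq_of_braid_of_commute {A B C : Matrix.SpecialLinearGroup (Fin 2) ℤ} (h1 : A * B * A = B * A * B) (h2 : C * B * C = B * C * B)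
    (h3 : A * C = C * A) : A = C := by
  have key : ∀ {A C : Matrix.SpecialLinearGroup (Fin 2) ℤ}, A * C * A = C * A * C → A * C = C * A → A = C := by
    intro A C h h'
    rw [h'] at h
    exact (mul_left_cancel h)
  rcases eq_or_trace_eq_one h1 with h | tA
  · exact (key (by rw [h, h2]) h3.symm).symm
  rcases eq_or_trace_eq_one h2 with h | tC
  · exact key (by rw [h, h1]) h3
  have sA := trace_eq_of_braid h1
  have sC := trace_eq_of_braid h2
  have e (i j : Fin 2) := congrArg (fun M : Matrix.SpecialLinearGroup (Fin 2) ℤ => M i j) h3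
  simp only [mul_entry] at e
  have e00 := e 0 0
  have e01 := e 0 1
  have e10 := e 1 0
  clear e h1 h2 h3 key
  generalize B 0 0 = p at *
  generalize B 0 1 = q at *
  generalize B 1 0 = r at *
  generalize B 1 1 = s at *
  have hx : (2 : ℤ) - (p + s) ^ 2 ≠ 0 := by
    intro h
    have h' : (p + s) ^ 2 = 2 := by linarith
    have : (p + s) < 2 := by nlinarith
    have : -2 < (p + s) := by nlinarith
    generalize p + s = x at *
    interval_cases x <;> simp at h'
  apply ext_entries <;> rw [← sub_eq_zero] <;> apply (mul_eq_zero.mp _).resolve_left hx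
  · linear_combination (A 0 0 - A 1 1) * (tA - tC) - (A 0 0 - A 1 1) * s * (sA - sC) + r * e01 + r * A 0 1 * (sA - sC)
      - q * e10 + q * A 1 0 * (sA - sC) + (A 0 0 - C 0 0) * (-2 * tA + (p + s) * sA)
  · linear_combination 2 * A 0 1 * (tA - tC) - A 0 1 * (p + s) * (sA - sC) + (A 0 1 - C 0 1) * (-2 * tA + (p + s) * sA)
      - (p - s) * e01 + 2 * q * e00
  · linear_combination 2 * A 1 0 * (tA - tC) - A 1 0 * (p + s) * (sA - sC) + (A 1 0 - C 1 0) * (-2 * tA + (p + s) * sA)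
      + (p - s) * e10 - 2 * r * e00
  · linear_combination (2 - (p + s) ^ 2) * (sA - sC) - ((A 0 0 - A 1 1) * (tA - tC) - (A 0 0 - A 1 1) * s * (sA - sC)
      + r * e01 + r * A 0 1 * (sA - sC) - q * e10 + q * A 1 0 * (sA - sC)
      + (A 0 0 - C 0 0) * (-2 * tA + (p + s) * sA))

end Braid

namespace Braid
open FreeGroup

theorem len_map_sg (ρ : Br m →* Br m) {i : ℕ} (hi : i < m) : len m (ρ (sg m i)) = len m (ρ (sg m 0)) := by
  rw [sg_eq hi]
  simp only [_root_.map_mul, _root_.map_inv]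
  rw [mul_comm, inv_mul_cancel_left]

theorem proj_map_ker2 (ρ : Br 3 →* Br 3) (v : FreeGroup (Fin 2)) : proj (ρ (ker2 v)) = 1 := by
  have h : slm (proj (ρ (sg 3 0))) = slm (proj (ρ (sg 3 2))) := by
    have h0 := (isBraid_sg 3).braid 0 (by omega)
    have h1 := (isBraid_sg 3).braid 1 (by omega)
    have h2 := (isBraid_sg 3).comm 0 2 (by omega) (by omega)
    apply eq_of_braid_of_commute (B := slm (proj (ρ (sg 3 1))))
    · simpa using congrArg (fun b => slm (proj (ρ b))) h0
    · simpa using congrArg (fun b => slm (proj (ρ b))) h1.symm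
    · simpa using congrArg (fun b => slm (proj (ρ b))) h2
  have h0 : proj (ρ (ker2 (of 0))) = 1 := by
    obtain ⟨k, hk⟩ := exists_zpow_of_slm_eq_one (b := proj (ρ (ker2 (of 0)))) (by
      rw [ker2_zero]; simp [h])
    have hl : len 2 (proj (ρ (ker2 (of 0)))) = 1 := by
      rw [len_proj, ker2_zero, _root_.map_mul, _root_.map_mul, _root_.map_inv, _root_.map_inv, len_map_sg ρ (by omega : 2 < 3), mul_inv_cancel]
    rw [hk, _root_.map_zpow] at hl
    have := congrArg Multiplicative.toAdd hl
    rw [toAdd_zpow, len_Z] at this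
    simp at this
    rw [hk, this, mul_zero, zpow_zero]
  have : (proj.comp ρ).comp ker2 = 1 := by
    refine FreeGroup.ext_hom _ _ fun i => ?_
    fin_cases i
    · exact h0
    · change proj (ρ (ker2 (of 1))) = 1
      rw [ker2_one, ← ker2_zero]
      simp only [_root_.map_mul, _root_.map_inv, h0]
      simp
  exact DFunLike.congr_fun this v

theorem exists_ker2_map (ρ : Br 3 →* Br 3) :
    ∃ φ : FreeGroup (Fin 2) →* FreeGroup (Fin 2), ∀ v, ρ (ker2 v) = ker2 (φ v) := by
  apply exists_factor ker2_injective (ρ.comp ker2)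
  intro v
  obtain ⟨u, hu⟩ := exists_ker2 (ρ (ker2 v))
  rw [proj_map_ker2, _root_.map_one, mul_one] at hu
  exact ⟨u, hu.symm⟩

theorem map_actTwo {ρ : Br 3 →* Br 3} {φ : FreeGroup (Fin 2) →* FreeGroup (Fin 2)}
    (h : ∀ v, ρ (ker2 v) = ker2 (φ v)) {b : Br 2} {w : FreeGroup (Fin 2)}
    (hw : ρ (inc 2 b) = ker2 w * inc 2 (proj (ρ (inc 2 b)))) (v : FreeGroup (Fin 2)) :
    φ (actTwo b v) = w * actTwo (proj (ρ (inc 2 b))) (φ v) * w⁻¹ := by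
  apply ker2_injective
  rw [← h, ker2_act, _root_.map_mul, _root_.map_mul, _root_.map_inv, h, _root_.map_mul, _root_.map_mul, ker2_act,
    _root_.map_inv]
  conv_lhs => rw [hw]
  group

theorem mat_mul_slm {ρ : Br 3 →* Br 3} {φ : FreeGroup (Fin 2) →* FreeGroup (Fin 2)}
    (h : ∀ v, ρ (ker2 v) = ker2 (φ v)) (b : Br 2) :
    mat φ * (slm b : Matrix (Fin 2) (Fin 2) ℤ) =
      (slm (proj (ρ (inc 2 b))) : Matrix (Fin 2) (Fin 2) ℤ) * mat φ := by
  obtain ⟨w, hw⟩ := exists_ker2 (ρ (inc 2 b))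
  have h1 (v : FreeGroup (Fin 2)) := congrArg vec (map_actTwo h hw v)
  simp only [vec_mul, vec_inv, vec_actTwo, vec_map] at h1
  refine Matrix.ext_of_mulVec_single fun j => ?_
  have h2 := h1 (of j)
  rwa [vec_of, add_neg_cancel_comm, Matrix.mulVec_mulVec, Matrix.mulVec_mulVec] at h2

/-- Two permutations fixing all numbers from four on agree if they agree below four. -/
theorem perm_ext_four {π τ : Equiv.Perm ℕ} (h : ∀ x < 4, π x = τ x) (hπ : ∀ x, 4 ≤ x → π x = x)
    (hτ : ∀ x, 4 ≤ x → τ x = x) : π = τ := by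
  ext x
  by_cases hx : x < 4
  · exact h x hx
  · rw [hπ x (by omega), hτ x (by omega)]

theorem perm_ker2_zero : perm 3 (ker2 (of 0)) = Equiv.swap 0 1 * Equiv.swap 2 3 := by
  rw [ker2_zero, _root_.map_mul, _root_.map_inv, perm_sg (by omega), perm_sg (by omega), Equiv.swap_inv]

theorem perm_ker2_one : perm 3 (ker2 (of 1)) = Equiv.swap 0 3 * Equiv.swap 1 2 := by
  apply perm_ext_four
  · rw [ker2_one, ← ker2_zero]
    simp only [_root_.map_mul, _root_.map_inv]
    rw [perm_ker2_zero, perm_sg (by omega), mul_inv_rev, Equiv.swap_inv, Equiv.swap_inv, Equiv.swap_inv]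
    decide
  · intro x hx
    exact perm_apply_of_lt _ (by omega)
  · intro x hx
    simp [Equiv.swap_apply_of_ne_of_ne, show x ≠ 0 by omega, show x ≠ 1 by omega, show x ≠ 2 by omega,
      show x ≠ 3 by omega]

theorem perm_ker2 (v : FreeGroup (Fin 2)) : perm 3 (ker2 v) =
    perm 3 (ker2 (of 0)) ^ vec v 0 * perm 3 (ker2 (of 1)) ^ vec v 1 := by
  have hc : Commute (perm 3 (ker2 (of 0))) (perm 3 (ker2 (of 1))) := by
    apply perm_ext_four
    · rw [perm_ker2_zero, perm_ker2_one]; decide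
    · intro x hx
      rw [← _root_.map_mul]
      exact perm_apply_of_lt _ (by omega)
    · intro x hx
      rw [← _root_.map_mul]
      exact perm_apply_of_lt _ (by omega)
  induction v using FreeGroup.induction_on with
  | C1 => simp [vec_one]
  | of i => fin_cases i <;> simp [vec_of]
  | inv_of i h => fin_cases i <;> simp [vec_of, vec_inv]
  | mul u v hu hv =>
    rw [_root_.map_mul, _root_.map_mul, hu, hv, vec_mul, Pi.add_apply, Pi.add_apply, zpow_add, zpow_add]
    simp only [mul_assoc]
    congr 1
    simp only [← mul_assoc]
    rw [(hc.zpow_zpow _ _).eq]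

theorem zpow_eq_of_sq {G : Type*} [Group G] {g : G} (h : g ^ 2 = 1) (k : ℤ) :
    Even k ∧ g ^ k = 1 ∨ ¬ Even k ∧ g ^ k = g := by
  rcases Int.even_or_odd' k with ⟨j, rfl | rfl⟩
  · exact Or.inl ⟨by simp, by rw [zpow_mul]; simp [h]⟩
  · exact Or.inr ⟨by simp, by rw [zpow_add, zpow_mul]; simp [h]⟩

theorem perm_ker2_eq_one_iff (v : FreeGroup (Fin 2)) :
    perm 3 (ker2 v) = 1 ↔ Even (vec v 0) ∧ Even (vec v 1) := by
  have h0 : perm 3 (ker2 (of 0)) ^ 2 = 1 := by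
    rw [← _root_.map_pow]
    apply perm_ext_four
    · rw [_root_.map_pow, perm_ker2_zero]; decide
    · exact fun x hx => perm_apply_of_lt _ (by omega)
    · exact fun x hx => rfl
  have h1 : perm 3 (ker2 (of 1)) ^ 2 = 1 := by
    rw [← _root_.map_pow]
    apply perm_ext_four
    · rw [_root_.map_pow, perm_ker2_one]; decide
    · exact fun x hx => perm_apply_of_lt _ (by omega)
    · exact fun x hx => rfl
  rw [perm_ker2]
  rcases zpow_eq_of_sq h0 (vec v 0) with ⟨e0, h0⟩ | ⟨e0, h0⟩ <;>
  rcases zpow_eq_of_sq h1 (vec v 1) with ⟨e1, h1⟩ | ⟨e1, h1⟩ <;> rw [h0, h1] <;>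
  simp only [e0, e1, and_self, and_true, true_and, and_false, false_and, mul_one, one_mul, iff_true, iff_false] <;>
  intro h <;> have h' := DFunLike.congr_fun h 0 <;> revert h' <;>
  (try rw [perm_ker2_zero]) <;> (try rw [perm_ker2_one]) <;> decide

end Braid

namespace Braid
open FreeGroup

/-- An integral matrix conjugating the standard parabolic matrices to integral matrices is a
multiple of an invertible matrix. -/
theorem exists_smul_of_conj {S T : Matrix (Fin 2) (Fin 2) ℤ} (N : ℕ) : ∀ A : Matrix (Fin 2) (Fin 2) ℤ,
    A * !![1, -1; 0, 1] = S * A → A * !![1, 0; 1, 1] = T * A → A.det ≠ 0 → A.det.natAbs ≤ N →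
    ∃ (g : ℤ) (U : Matrix (Fin 2) (Fin 2) ℤ), A = g • U ∧ (U.det = 1 ∨ U.det = -1) := by
  induction N with
  | zero => intro A _ _ h h'; exact absurd (Int.natAbs_eq_zero.mp (by omega)) h
  | succ N ih =>
    intro A hS hT hd hN
    by_cases h1 : A.det.natAbs = 1
    · exact ⟨1, A, by simp, by omega⟩
    obtain ⟨l, hl, hlA⟩ := Nat.exists_prime_and_dvd h1
    have hl' : Prime (l : ℤ) := Nat.prime_iff_prime_int.mp hl
    replace hlA : (l : ℤ) ∣ A.det := Int.natCast_dvd.mpr hlA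
    have key : ∀ (M V : Matrix (Fin 2) (Fin 2) ℤ), A * M = V * A → ∀ i j, (l : ℤ) ∣ (A * M * A.adjugate) i j := by
      intro M V h i j
      rw [h, mul_assoc, Matrix.mul_adjugate, Matrix.mul_smul, mul_one, Matrix.smul_apply, smul_eq_mul]
      exact hlA.mul_right _
    have hS' := key _ _ hS
    have hT' := key _ _ hT
    have dd : (l : ℤ) ∣ A 0 0 * A 1 1 - A 0 1 * A 1 0 := by rwa [← Matrix.det_fin_two]
    have hp : (l : ℤ) ∣ A 0 0 := by
      apply hl'.dvd_of_dvd_pow (n := 2)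
      have := hS' 0 1
      simp [Matrix.mul_apply, Matrix.adjugate_fin_two, Fin.sum_univ_two] at this
      obtain ⟨k, hk⟩ := this
      exact ⟨-k, by linear_combination -hk⟩
    have hr : (l : ℤ) ∣ A 1 0 := by
      apply hl'.dvd_of_dvd_pow (n := 2)
      have := hS' 1 0
      simp [Matrix.mul_apply, Matrix.adjugate_fin_two, Fin.sum_univ_two] at this
      obtain ⟨k, hk⟩ := this
      exact ⟨k, by linear_combination hk⟩
    have hq : (l : ℤ) ∣ A 0 1 := by
      apply hl'.dvd_of_dvd_pow (n := 2)
      have := hT' 0 1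
      simp [Matrix.mul_apply, Matrix.adjugate_fin_two, Fin.sum_univ_two] at this
      obtain ⟨k, hk⟩ := this
      exact ⟨-k, by linear_combination -hk⟩
    have hs : (l : ℤ) ∣ A 1 1 := by
      apply hl'.dvd_of_dvd_pow (n := 2)
      have := hT' 1 0
      simp [Matrix.mul_apply, Matrix.adjugate_fin_two, Fin.sum_univ_two] at this
      obtain ⟨k, hk⟩ := this
      exact ⟨k, by linear_combination hk⟩
    obtain ⟨B, rfl⟩ : ∃ B : Matrix (Fin 2) (Fin 2) ℤ, A = (l : ℤ) • B := by
      obtain ⟨a, ha⟩ := hp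
      obtain ⟨b, hb⟩ := hq
      obtain ⟨c, hc⟩ := hr
      obtain ⟨d, hd⟩ := hs
      refine ⟨!![a, b; c, d], ?_⟩
      ext i j
      fin_cases i <;> fin_cases j <;> simp [ha, hb, hc, hd]
    have hl0 : (l : ℤ) ≠ 0 := hl'.ne_zero
    rw [Matrix.smul_mul, Matrix.mul_smul] at hS hT
    have e : ((l : ℤ) • B).det = l ^ 2 * B.det := by rw [Matrix.det_smul]; simp
    rw [e] at hN hd
    have hB : B.det ≠ 0 := right_ne_zero_of_mul hd
    obtain ⟨g, U, rfl, hU⟩ := ih B (smul_right_injective _ hl0 hS) (smul_right_injective _ hl0 hT) hB (by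
      rw [Int.natAbs_mul, Int.natAbs_pow, Int.natAbs_natCast] at hN
      have := Int.natAbs_pos.mpr hB
      have := Nat.mul_le_mul_right B.det.natAbs (Nat.pow_le_pow_left hl.two_le 2)
      omega)
    exact ⟨l * g, U, by rw [smul_smul], hU⟩

theorem perm_map_ker2 {ρ : Br 3 →* Br 3} (hρ : ∀ i < 3, perm 3 (ρ (sg 3 i)) = Equiv.swap i (i + 1))
    {φ : FreeGroup (Fin 2) →* FreeGroup (Fin 2)} (h : ∀ v, ρ (ker2 v) = ker2 (φ v)) (v : FreeGroup (Fin 2)) (i : Fin 2) :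
    Even (vec (φ v) i - vec v i) := by
  have : perm 3 (ker2 (φ v * v⁻¹)) = 1 := by
    rw [_root_.map_mul, _root_.map_mul, ← h, perm_hom hρ, _root_.map_inv, _root_.map_inv, mul_inv_cancel]
  rw [perm_ker2_eq_one_iff, vec_mul, vec_inv, ← sub_eq_add_neg] at this
  fin_cases i
  · exact this.1
  · exact this.2

theorem mat_parity {ρ : Br 3 →* Br 3} (hρ : ∀ i < 3, perm 3 (ρ (sg 3 i)) = Equiv.swap i (i + 1))
    {φ : FreeGroup (Fin 2) →* FreeGroup (Fin 2)} (h : ∀ v, ρ (ker2 v) = ker2 (φ v)) (i j : Fin 2) :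
    Even (mat φ i j - (1 : Matrix (Fin 2) (Fin 2) ℤ) i j) := by
  have := perm_map_ker2 hρ h (of j) i
  rwa [vec_of, show (Pi.single j 1 : Fin 2 → ℤ) i = (1 : Matrix (Fin 2) (Fin 2) ℤ) i j by
    rw [Matrix.one_apply, Pi.single_apply]] at this

theorem mat_det_odd {ρ : Br 3 →* Br 3} (hρ : ∀ i < 3, perm 3 (ρ (sg 3 i)) = Equiv.swap i (i + 1))
    {φ : FreeGroup (Fin 2) →* FreeGroup (Fin 2)} (h : ∀ v, ρ (ker2 v) = ker2 (φ v)) : Odd (mat φ).det := by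
  have e := mat_parity hρ h
  rw [Matrix.det_fin_two]
  have e00 := e 0 0
  have e01 := e 0 1
  have e10 := e 1 0
  have e11 := e 1 1
  simp at e00 e01 e10 e11
  obtain ⟨a, ha⟩ := e00
  obtain ⟨b, hb⟩ := e01
  obtain ⟨d, hd⟩ := e11
  refine ⟨a + d + 2 * a * d - b * mat φ 1 0, ?_⟩
  rw [hb, show mat φ 0 0 = 2 * a + 1 by omega, show mat φ 1 1 = 2 * d + 1 by omega]
  ring

theorem exists_smul_mat {ρ : Br 3 →* Br 3} (hρ : ∀ i < 3, perm 3 (ρ (sg 3 i)) = Equiv.swap i (i + 1))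
    {φ : FreeGroup (Fin 2) →* FreeGroup (Fin 2)} (h : ∀ v, ρ (ker2 v) = ker2 (φ v)) :
    ∃ (g : ℤ) (U : Matrix (Fin 2) (Fin 2) ℤ), mat φ = g • U ∧ (U.det = 1 ∨ U.det = -1) := by
  refine exists_smul_of_conj (S := slm (proj (ρ (inc 2 (sg 2 0))))) (T := slm (proj (ρ (inc 2 (sg 2 1))))) _ _ ?_ ?_ ?_ le_rfl
  · rw [← slm_zero]; exact mat_mul_slm h _
  · rw [← slm_one]; exact mat_mul_slm h _
  · intro h0
    have := mat_det_odd hρ h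
    rw [h0] at this
    simp at this

/-- The automorphism of the kernel of the exceptional projection induced by the inversion automorphism. -/
def chiKer : FreeGroup (Fin 2) →* FreeGroup (Fin 2) := FreeGroup.lift ![(of 0)⁻¹, of 0 * of 1 * (of 0)⁻¹]

theorem mat_chiKer : mat chiKer = !![-1, 0; 0, 1] := by
  ext i j
  fin_cases i <;> fin_cases j <;> simp [mat, chiKer, vec_mul, vec_inv, vec_of]

theorem chi_ker2 (v : FreeGroup (Fin 2)) : chi 3 (ker2 v) = ker2 (chiKer v) := by
  have h3 : Commute (sg 3 0) (sg 3 2) := (isBraid_sg 3).comm 0 2 (by omega) (by omega)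
  have h0 : chi 3 (ker2 (of 0)) = (ker2 (of 0))⁻¹ := by
    rw [ker2_zero, _root_.map_mul, _root_.map_inv, chi_sg (by omega), chi_sg (by omega), mul_inv_rev, inv_inv]
    exact h3.inv_left.eq
  have : (chi 3).comp ker2 = ker2.comp chiKer := by
    refine FreeGroup.ext_hom _ _ fun i => ?_
    fin_cases i
    · change chi 3 (ker2 (of 0)) = ker2 (chiKer (of 0))
      simp [chiKer, h0]
    · change chi 3 (ker2 (of 1)) = ker2 (chiKer (of 1))
      have e1 : (sg 3 1)⁻¹ * (ker2 (of 0))⁻¹ * sg 3 1 = ker2 (of 1) * (ker2 (of 0))⁻¹ := by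
        have := ker2_act (sg 2 1) (of 1 * (of 0)⁻¹)
        rw [actTwo_sg (by omega), inc_sg (by omega), _root_.map_mul, _root_.map_inv, twist_one_one, twist_one_zero,
          mul_inv_rev, mul_inv_cancel_left, _root_.map_inv, _root_.map_mul, _root_.map_inv] at this
        change (ker2 (of 0))⁻¹ = sg 3 1 * _ * (sg 3 1)⁻¹ at this
        conv_lhs => rw [this]
        group
      have e2 : chiKer (of 1) = of 0 * of 1 * (of 0)⁻¹ := by simp [chiKer]
      rw [ker2_one, ← ker2_zero]
      simp only [_root_.map_mul, _root_.map_inv, h0]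
      rw [chi_sg (by omega), inv_inv, inv_inv, e2, _root_.map_mul, _root_.map_mul, _root_.map_inv, mul_assoc, mul_assoc, ← mul_assoc _ _ (sg 3 1),
        e1, mul_assoc]
  exact DFunLike.congr_fun this v

end Braid

namespace Braid
open FreeGroup

theorem lk_ker2_kap : lk (ker2 kap) 0 2 = 2 ∧ lk (ker2 kap) 1 2 = 2 ∧ lk (ker2 kap) 0 3 = -2 ∧
    lk (ker2 kap) 1 3 = -2 := by
  rw [kap]
  simp only [_root_.map_mul, _root_.map_inv, ker2_zero, ker2_one, lk_mul, lk_inv, mul_inv_rev, inv_inv,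
    perm_sg (show 0 < 3 by omega), perm_sg (show 1 < 3 by omega), perm_sg (show 2 < 3 by omega),
    lk_sg (show 0 < 3 by omega), lk_sg (show 1 < 3 by omega), lk_sg (show 2 < 3 by omega),
    Equiv.swap_inv, Equiv.Perm.mul_apply]
  decide

theorem vec_kap : vec kap = 0 := by
  rw [kap]; simp only [vec_mul, vec_inv]; abel

theorem kap_ne_one : kap ≠ 1 := by
  intro h
  have := lk_ker2_kap.1
  rw [h, _root_.map_one, lk_one] at this
  omega

theorem twist_kap {i : ℕ} (hi : i < 2) : twist i kap = kap := by
  rw [kap]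
  interval_cases i
  · simp only [_root_.map_mul, _root_.map_inv, twist_zero_zero, twist_zero_one]; group
  · simp only [_root_.map_mul, _root_.map_inv, twist_one_zero, twist_one_one]; group

theorem exists_root_kap : ∃ (d : FreeGroup (Fin 2)) (e : ℤ), kap = d ^ e ∧ e ≠ 0 ∧ perm 3 (ker2 d) = 1 ∧
    ∀ u, Commute u kap → ∃ k : ℤ, u = d ^ k := by
  obtain ⟨d, hd⟩ := exists_root kap_ne_one
  obtain ⟨e, he⟩ := hd kap (Commute.refl _)
  have e0 : e ≠ 0 := by
    rintro rfl
    exact kap_ne_one (by rw [he, zpow_zero])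
  refine ⟨d, e, he, e0, ?_, hd⟩
  have h := vec_kap
  rw [he, vec_zpow] at h
  have h' : vec d = 0 := by
    rcases smul_eq_zero.mp h with h | h
    · exact absurd h e0
    · exact h
  rw [perm_ker2_eq_one_iff, h']
  exact ⟨by simp, by simp⟩

/-- The case of an endomorphism of the four strand braid group inducing the identity on the
quotient by the kernel of `proj`. -/
theorem std_of_proj_eq {ρ : Br 3 →* Br 3} (hρ : ∀ i < 3, perm 3 (ρ (sg 3 i)) = Equiv.swap i (i + 1))
    {φ : FreeGroup (Fin 2) →* FreeGroup (Fin 2)} (h : ∀ v, ρ (ker2 v) = ker2 (φ v)) (hφ : φ kap ≠ 1)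
    (hp : ∀ i < 2, proj (ρ (sg 3 i)) = sg 2 i) : Std ρ := by
  have hw : ∀ i, ∃ w, i < 2 → ρ (sg 3 i) = ker2 w * sg 3 i := by
    intro i
    obtain ⟨w, hw⟩ := exists_ker2 (ρ (sg 3 i))
    refine ⟨w, fun hi => ?_⟩
    rw [hp i hi, inc_sg hi] at hw
    exact hw
  choose w hw using hw
  have hconj : ∀ i < 2, IsConj ((twist i) (φ kap)) (φ kap) := by
    intro i hi
    have := map_actTwo h (b := sg 2 i) (w := w i) (by rw [inc_sg hi, hp i hi, inc_sg hi, hw i hi]) kap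
    rw [actTwo_sg hi, twist_kap hi, inc_sg hi, hp i hi, actTwo_sg hi] at this
    exact isConj_iff.mpr ⟨w i, this.symm⟩
  obtain ⟨j, hj⟩ := isConj_kap_pow (τ₁ := (twist 0).toMonoidHom) (τ₂ := (twist 1).toMonoidHom)
    twist_zero_zero twist_zero_one twist_one_zero twist_one_one (hconj 0 (by omega)) (hconj 1 (by omega))
  obtain ⟨g, hg⟩ := isConj_iff.mp hj
  have j0 : j ≠ 0 := by
    rintro rfl
    rw [zpow_zero, conj_eq_one_iff] at hg
    exact hφ hg
  apply Std.of_conj (c := ker2 g)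
  obtain ⟨d, e, hde, e0, hd1, hd⟩ := exists_root_kap
  have hk : ∀ i, ∃ k : ℤ, i < 2 → conjHom (ker2 g) ρ (sg 3 i) = ker2 d ^ k * sg 3 i := by
    intro i
    by_cases hi : i < 2
    swap
    · exact ⟨0, fun h => absurd h hi⟩
    have e1 : conjHom (ker2 g) ρ (sg 3 i) = ker2 (g * w i * (twist i g)⁻¹) * sg 3 i := by
      have := ker2_act (sg 2 i) g
      rw [actTwo_sg hi, inc_sg hi] at this
      rw [conjHom_apply, hw i hi, _root_.map_mul, _root_.map_mul, _root_.map_inv, this]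
      group
    have e2 : Commute (g * w i * (twist i g)⁻¹) (kap ^ j) := by
      have h1 : conjHom (ker2 g) ρ (ker2 kap) = ker2 (kap ^ j) := by
        rw [conjHom_apply, h, ← hg, _root_.map_mul, _root_.map_mul, _root_.map_inv]
      have h2 : ∀ u, sg 3 i * ker2 u * (sg 3 i)⁻¹ = ker2 (twist i u) := by
        intro u
        rw [← inc_sg hi, ← ker2_act, actTwo_sg hi]
      have h3 := congrArg (conjHom (ker2 g) ρ) (h2 kap)
      rw [twist_kap hi, _root_.map_mul, _root_.map_mul, _root_.map_inv, e1, h1, mul_inv_rev,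
        show ∀ a b c d : Br 3, a * b * c * (b⁻¹ * d) = a * (b * c * b⁻¹) * d from fun _ _ _ _ => by group,
        h2, _root_.map_zpow, twist_kap hi, ← _root_.map_inv ker2, ← _root_.map_mul, ← _root_.map_mul] at h3
      exact mul_inv_eq_iff_eq_mul.mp (ker2_injective h3)
    obtain ⟨k, hk⟩ := hd _ (eq_of_commute_zpow j0 e2)
    exact ⟨k, fun _ => by rw [e1, hk, _root_.map_zpow]⟩
  choose k hk using hk
  set ρ' := conjHom (ker2 g) ρ with hρ'
  have hpd : ∀ k : ℤ, perm 3 (ker2 d ^ k) = 1 := fun k => by rw [_root_.map_zpow, hd1, one_zpow]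
  have hρ1 : ∀ i < 2, perm 3 (ρ' (sg 3 i)) = Equiv.swap i (i + 1) := by
    intro i hi
    rw [hk i hi, _root_.map_mul, hpd, one_mul, perm_sg (by omega)]
  have hpg : perm 3 (ker2 g) = 1 := by
    have hs : ∀ i < 2, Equiv.swap (perm 3 (ker2 g) i) (perm 3 (ker2 g) (i + 1)) i = i + 1 := by
      intro i hi
      have := hρ1 i hi
      rw [hρ', conjHom_apply, _root_.map_mul, _root_.map_mul, _root_.map_inv, hρ i (by omega),
        ← Equiv.swap_apply_apply] at this
      rw [this, Equiv.swap_apply_left]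
    have h0 := hs 0 (by omega)
    have h1 := hs 1 (by omega)
    simp only [Equiv.swap_apply_def, zero_add, Nat.reduceAdd] at h0 h1
    have i01 := (perm 3 (ker2 g)).injective.ne (show 0 ≠ 1 by omega)
    have i12 := (perm 3 (ker2 g)).injective.ne (show 1 ≠ 2 by omega)
    have i02 := (perm 3 (ker2 g)).injective.ne (show 0 ≠ 2 by omega)
    have i03 := (perm 3 (ker2 g)).injective.ne (show 0 ≠ 3 by omega)
    have i13 := (perm 3 (ker2 g)).injective.ne (show 1 ≠ 3 by omega)
    have i23 := (perm 3 (ker2 g)).injective.ne (show 2 ≠ 3 by omega)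
    have := perm_apply_le (ker2 g) (show 3 ≤ 3 by omega)
    have g0 : perm 3 (ker2 g) 0 = 0 := by split_ifs at h0 h1 <;> omega
    have g1 : perm 3 (ker2 g) 1 = 1 := by split_ifs at h0 h1 <;> omega
    have g2 : perm 3 (ker2 g) 2 = 2 := by split_ifs at h0 h1 <;> omega
    refine perm_ext_four (fun x hx => ?_) (fun x hx => perm_apply_of_lt _ (by omega)) fun x hx => rfl
    interval_cases x
    · exact g0
    · exact g1
    · exact g2
    · change _ = 3
      omega
  have hρ2 : ∀ i < 3, perm 3 (ρ' (sg 3 i)) = Equiv.swap i (i + 1) := by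
    intro i hi
    rw [hρ', conjHom_apply, _root_.map_mul, _root_.map_mul, _root_.map_inv, hpg, hρ i hi]
    simp
  have hL : ∀ a b, lk (ker2 kap) a b = e * lk (ker2 d) a b := by
    intro a b
    rw [hde, _root_.map_zpow, lk_zpow_of_pure hd1]
  have hlk : ∀ i < 2, ∀ a b, lk (ρ' (sg 3 i ^ 2)) a b = k i * (lk (ker2 d) a b +
      lk (ker2 d) (Equiv.swap i (i + 1) a) (Equiv.swap i (i + 1) b)) + lk (sg 3 i ^ 2) a b := by
    intro i hi a b
    rw [_root_.map_pow, hk i hi, pow_two, lk_mul, lk_mul_of_pure (hpd _), lk_mul_of_pure (hpd _), _root_.map_mul, hpd, one_mul,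
      perm_sg (by omega), Equiv.swap_inv, lk_zpow_of_pure hd1, lk_zpow_of_pure hd1, pow_two, lk_mul, perm_sg (by omega), Equiv.swap_inv]
    ring
  obtain ⟨l02, l12, l03, l13⟩ := lk_ker2_kap
  rw [hL] at l02 l12 l03 l13
  have k0 : k 0 = 0 := by
    have h1 := lk_conj (ρ' (sg 3 2)) (p := ρ' (sg 3 0 ^ 2)) (by rw [perm_hom hρ2, perm_sq (by omega)]) 0 2
    rw [← _root_.map_inv, ← _root_.map_mul, ← _root_.map_mul,
      show sg 3 2 * sg 3 0 ^ 2 * (sg 3 2)⁻¹ = sg 3 0 ^ 2 by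
        rw [mul_inv_eq_iff_eq_mul]
        exact (show Commute (sg 3 2) (sg 3 0 ^ 2) from
          Commute.pow_right ((isBraid_sg 3).comm 0 2 (by omega) (by omega)).symm 2),
      hρ2 2 (by omega), Equiv.swap_inv, hlk 0 (by omega), hlk 0 (by omega)] at h1
    simp only [lk_sq (show 0 < 3 by omega), show Equiv.swap 2 (2 + 1) 0 = 0 by decide, show Equiv.swap 2 (2 + 1) 2 = 3 by decide,
      show Equiv.swap 0 (0 + 1) 0 = 1 by decide, show Equiv.swap 0 (0 + 1) 2 = 2 by decide,
      show Equiv.swap 0 (0 + 1) 3 = 3 by decide] at h1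
    norm_num at h1
    rcases h1 with h1 | h1
    · exfalso
      have := congrArg (e * ·) h1
      simp only [mul_add] at this
      omega
    · exact h1
  have f0 : ρ' (sg 3 0) = sg 3 0 := by rw [hk 0 (by omega), k0, zpow_zero, one_mul]
  have k1 : k 1 = 0 := by
    have h1 := (KeepsLk.sq hρ2 ⟨perm_sq (by omega), fun a b => by rw [_root_.map_pow, f0]⟩ (show 1 < 3 by omega)).2 0 3
    rw [hlk 1 (by omega), show Equiv.swap 1 (1 + 1) 0 = 0 by decide, show Equiv.swap 1 (1 + 1) 3 = 3 by decide,
      add_eq_right, mul_eq_zero] at h1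
    rcases h1 with h1 | h1
    · exact h1
    · exfalso
      rw [show lk (ker2 d) 0 3 = 0 by omega] at l03
      omega
  refine std_of_fix_low (m := 2) le_rfl hρ2 fun i hi => ?_
  interval_cases i
  · exact f0
  · rw [hk 1 (by omega), k1, zpow_zero, one_mul]

end Braid

namespace Braid
open FreeGroup

theorem map_kap_ne_one {φ : FreeGroup (Fin 2) →* FreeGroup (Fin 2)} (h : (mat φ).det ≠ 0) : φ kap ≠ 1 := by
  intro hk
  apply h
  have e : ∀ i j, mat φ i j = vec (φ (of j)) i := fun i j => rfl
  rw [Matrix.det_fin_two, e, e, e, e]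
  by_cases h1 : φ (of 0) = 1
  · simp [h1, vec_one]
  obtain ⟨r, hr⟩ := exists_root h1
  obtain ⟨p, hp⟩ := hr _ (Commute.refl _)
  obtain ⟨q, hq⟩ := hr (φ (of 1)) (by
    rw [kap] at hk
    simp only [_root_.map_mul, _root_.map_inv] at hk
    rw [mul_inv_eq_one, mul_inv_eq_iff_eq_mul] at hk
    exact hk.symm)
  rw [hp, hq, vec_zpow, vec_zpow]
  simp only [Pi.smul_apply, smul_eq_mul]
  ring

theorem proj_Z : proj (Z 3) = Z 2 ^ 2 := by
  have e : proj (tl 3 0) = sg 2 0 * sg 2 1 * sg 2 0 := by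
    rw [tl_eq (by omega), tl_eq (by omega), tl_eq (by omega), tl_of_le (by omega)]
    simp [proj_zero, proj_one, proj_two, mul_assoc]
  rw [← half_twist_relations.2.2, Z, _root_.map_pow, e, ← pow_mul]

theorem len_ker2 (v : FreeGroup (Fin 2)) : len 3 (ker2 v) = 1 := by
  rw [← len_proj, proj_ker2, _root_.map_one]

theorem perm_tv {ρ : Br 3 →* Br 3} (t : ℤ) (g : Br 3) : perm 3 (tv ρ t g) = perm 3 (ρ g) := by
  rw [tv_apply, _root_.map_mul, _root_.map_zpow, perm_Z, one_zpow, mul_one]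

theorem std_of_mat_smul_one {ρ : Br 3 →* Br 3} (hρ : ∀ i < 3, perm 3 (ρ (sg 3 i)) = Equiv.swap i (i + 1))
    {φ : FreeGroup (Fin 2) →* FreeGroup (Fin 2)} (h : ∀ v, ρ (ker2 v) = ker2 (φ v)) {g : ℤ}
    (hg : mat φ = g • 1) : Std ρ := by
  have hdet : (mat φ).det ≠ 0 := by
    intro h0
    have := mat_det_odd hρ h
    rw [h0] at this
    simp at this
  have g0 : g ≠ 0 := by
    rintro rfl
    rw [hg, zero_smul, Matrix.det_fin_two] at hdet
    simp at hdet
  have hs : ∀ i < 2, ∃ k : ℤ, proj (ρ (sg 3 i)) = Z 2 ^ (2 * k) * sg 2 i := by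
    intro i hi
    have := mat_mul_slm h (sg 2 i)
    rw [hg, Matrix.smul_mul, Matrix.mul_smul, one_mul, mul_one, inc_sg hi] at this
    have := Matrix.SpecialLinearGroup.ext _ _ fun a b => congrFun₂ (smul_right_injective _ g0 this) a b
    obtain ⟨k, hk⟩ := exists_zpow_of_slm_eq_one (b := proj (ρ (sg 3 i)) * (sg 2 i)⁻¹) (by
      rw [_root_.map_mul, _root_.map_inv, this, mul_inv_cancel])
    exact ⟨k, mul_inv_eq_iff_eq_mul.mp hk⟩
  obtain ⟨k, hk⟩ := hs 0 (by omega)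
  obtain ⟨k', hk'⟩ := hs 1 (by omega)
  obtain rfl : k = k' := by
    have := congrArg (fun b => (len 2 b).toAdd) hk
    have h' := congrArg (fun b => (len 2 b).toAdd) hk'
    simp only [len_proj, _root_.map_mul, _root_.map_zpow, toAdd_mul, toAdd_zpow, len_Z, len_sg (show 0 < 2 by omega),
      len_sg (show 1 < 2 by omega), len_map_sg ρ (show 1 < 3 by omega)] at this h'
    rw [this] at h'
    simp at h'
    exact h'
  apply Std.of_tv (t := -k)
  refine std_of_proj_eq (fun i hi => by rw [perm_tv, hρ i hi]) (φ := φ) (fun v => ?_) (map_kap_ne_one hdet) fun i hi => ?_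
  · rw [tv_apply, len_ker2]; simp [h]
  · rw [tv_sg _ _ (by omega), _root_.map_mul, _root_.map_zpow, proj_Z, ← zpow_natCast, ← zpow_mul]
    interval_cases i
    · rw [hk, mul_assoc, ← Z_zpow_commute, ← mul_assoc, ← zpow_add]
      simp
    · rw [hk', mul_assoc, ← Z_zpow_commute, ← mul_assoc, ← zpow_add]
      simp

theorem even_of_entries {a b c d x y z w g u : ℤ} (hx : x = g * u) (hx' : ¬ Even x) (h2 : Even y) (h3 : Even z)
    (hw' : ¬ Even w) (k1 : a * x + b * z = g) (k2 : a * y + b * w = 0) (k3 : c * x + d * z = 0)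
    (k4 : c * y + d * w = g) (v v' : ℤ) : Even (a * v + b * v' - v) ∧ Even (c * v + d * v' - v') := by
  have hg : ¬ Even g := fun h => hx' (hx ▸ h.mul_right u)
  have hb : Even b := by
    have := congrArg Even k2
    simpa [Int.even_add, Int.even_mul, h2, hw'] using this
  have hc : Even c := by
    have := congrArg Even k3
    simpa [Int.even_add, Int.even_mul, h3, hx'] using this
  have ha : ¬ Even a := by
    have := congrArg Even k1
    simpa [Int.even_add, Int.even_mul, h3, hx', hg] using this
  have hd : ¬ Even d := by
    have := congrArg Even k4
    simpa [Int.even_add, Int.even_mul, h2, hw', hg] using this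
  simp [Int.even_sub, Int.even_add, Int.even_mul, ha, hb, hc, hd]

theorem std_of_mat_smul_det_one {ρ : Br 3 →* Br 3} (hρ : ∀ i < 3, perm 3 (ρ (sg 3 i)) = Equiv.swap i (i + 1))
    {φ : FreeGroup (Fin 2) →* FreeGroup (Fin 2)} (h : ∀ v, ρ (ker2 v) = ker2 (φ v)) {g : ℤ}
    {U : Matrix (Fin 2) (Fin 2) ℤ} (hU : U.det = 1) (hg : mat φ = g • U) : Std ρ := by
  obtain ⟨b, hb⟩ := slm_surjective (⟨U, hU⟩ : Matrix.SpecialLinearGroup (Fin 2) ℤ)⁻¹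
  have hb' : (slm b : Matrix (Fin 2) (Fin 2) ℤ) * U = 1 := by
    have := congrArg (fun A : Matrix.SpecialLinearGroup (Fin 2) ℤ => (A : Matrix (Fin 2) (Fin 2) ℤ) * U) hb
    exact this.trans ((Matrix.adjugate_mul U).trans (by rw [hU, one_smul]))
  have key : ∀ v, Even (vec (actTwo b v) 0 - vec v 0) ∧ Even (vec (actTwo b v) 1 - vec v 1) := by
    intro v
    have e := mat_parity hρ h
    have e00 := e 0 0
    have e01 := e 0 1
    have e10 := e 1 0
    have e11 := e 1 1
    have f : (slm b : Matrix (Fin 2) (Fin 2) ℤ) * mat φ = g • 1 := by rw [hg, Matrix.mul_smul, hb']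
    have f00 := congrFun₂ f 0 0
    have f01 := congrFun₂ f 0 1
    have f10 := congrFun₂ f 1 0
    have f11 := congrFun₂ f 1 1
    have hg0 : mat φ 0 0 = g * U 0 0 := by rw [hg]; rfl
    rw [vec_actTwo]
    simp [Matrix.mul_apply, Matrix.mulVec, dotProduct, Fin.sum_univ_two] at e00 e01 e10 e11 f00 f01 f10 f11 ⊢
    exact even_of_entries hg0 (Int.not_even_iff_odd.2 e00) e01 e10 (Int.not_even_iff_odd.2 e11) f00 f01 f10 f11 _ _
  have hpb : perm 3 (inc 2 b) = 1 := by
    have hc : ∀ v, perm 3 (inc 2 b) * perm 3 (ker2 v) = perm 3 (ker2 v) * perm 3 (inc 2 b) := by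
      intro v
      have : perm 3 (ker2 (actTwo b v * v⁻¹)) = 1 := by
        rw [perm_ker2_eq_one_iff, vec_mul, vec_inv]
        exact key v
      rwa [_root_.map_mul, ker2_act, _root_.map_inv, _root_.map_mul, _root_.map_mul, _root_.map_mul,
        _root_.map_inv, _root_.map_inv, mul_inv_eq_one, mul_inv_eq_iff_eq_mul] at this
    have h3 : perm 3 (inc 2 b) 3 = 3 := by
      rw [perm_inc]
      exact perm_apply_of_lt _ (by omega)
    have c0 := hc (of 0)
    have c1 := hc (of 1)
    rw [perm_ker2_zero] at c0
    rw [perm_ker2_one] at c1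
    have e0 := fun x => Equiv.congr_fun c0 x
    have e1 := fun x => Equiv.congr_fun c1 x
    simp only [Equiv.Perm.mul_apply] at e0 e1
    have g2 : perm 3 (inc 2 b) 2 = 2 := by
      have := e0 3
      rw [h3] at this
      exact this
    have g0 : perm 3 (inc 2 b) 0 = 0 := by
      have := e1 3
      rw [h3] at this
      exact this
    have g1 : perm 3 (inc 2 b) 1 = 1 := by
      have := e0 0
      rw [g0] at this
      exact this
    refine perm_ext_four (fun x hx => ?_) (fun x hx => perm_apply_of_lt _ (by omega)) fun x hx => rfl
    interval_cases x <;> assumption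
  apply Std.of_conj (c := inc 2 b)
  refine std_of_mat_smul_one (fun i hi => ?_) (φ := (actTwo b).toMonoidHom.comp φ) (fun v => ?_) (g := g) ?_
  · rw [conjHom_apply, _root_.map_mul, _root_.map_mul, _root_.map_inv, hpb, hρ i hi]
    simp
  · rw [conjHom_apply, h, MonoidHom.comp_apply]
    exact (ker2_act _ _).symm
  · rw [mat_comp, ← slm_eq_mat, hg, Matrix.mul_smul, hb']

theorem std_three {ρ : Br 3 →* Br 3} (hρ : ∀ i < 3, perm 3 (ρ (sg 3 i)) = Equiv.swap i (i + 1)) : Std ρ := by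
  obtain ⟨φ, h⟩ := exists_ker2_map ρ
  obtain ⟨g, U, hg, hU | hU⟩ := exists_smul_mat hρ h
  · exact std_of_mat_smul_det_one hρ h hU hg
  · apply Std.of_chi
    refine std_of_mat_smul_det_one (fun i hi => ?_) (φ := φ.comp chiKer) (fun v => ?_) (g := g) (U := U * !![-1, 0; 0, 1]) ?_ ?_
    · rw [MonoidHom.comp_apply, perm_hom hρ, (lk_chi _ 0 0).2, perm_sg hi]
    · rw [MonoidHom.comp_apply, chi_ker2, h, MonoidHom.comp_apply]
    · rw [Matrix.det_mul, hU]; simp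
    · rw [mat_comp, mat_chiKer, hg, Matrix.smul_mul]

end Braid

namespace Braid

theorem odd_lk_of_swap (b : Br m) {j k : ℕ} (hjk : j ≠ k) (h : perm m b j = k) (h' : perm m b k = j) :
    Odd (lk b j k) := by
  rw [← Int.not_even_iff_odd, even_lk_iff b hjk, ← Equiv.Perm.eq_inv_iff_eq.mpr h, ← Equiv.Perm.eq_inv_iff_eq.mpr h']
  omega

theorem conj_tl_sq : tl 3 0 ^ 2 * sg 3 0 * (tl 3 0 ^ 2)⁻¹ = sg 3 2 ∧
    tl 3 0 ^ 2 * sg 3 2 * (tl 3 0 ^ 2)⁻¹ = sg 3 0 := by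
  have h := (sg_eq (show 2 < 3 by omega)).symm
  refine ⟨h, ?_⟩
  rw [← h, mul_inv_eq_iff_eq_mul, ← mul_assoc, ← mul_assoc, mul_inv_eq_iff_eq_mul, ← pow_add]
  have := Z_commute (m := 3) (sg 3 0)
  rw [mul_assoc, ← pow_add]
  exact this

/-- The images of the two outer generators under a homomorphism to the six strand braid group
cannot induce distinct fixed point free involutions. -/
theorem perm_eq_of_fixed_point_free (f : Br 3 →* Br 5)
    (h0 : ∀ x, perm 5 (f (sg 3 0)) (perm 5 (f (sg 3 0)) x) = x)
    (h2 : ∀ x, perm 5 (f (sg 3 2)) (perm 5 (f (sg 3 2)) x) = x)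
    (f0 : ∀ x ≤ 5, perm 5 (f (sg 3 0)) x ≠ x) (f2 : ∀ x ≤ 5, perm 5 (f (sg 3 2)) x ≠ x) :
    perm 5 (f (sg 3 0)) = perm 5 (f (sg 3 2)) := by
  set s := f (sg 3 0) with hs
  set r := f (sg 3 2) with hr
  set e := f (tl 3 0 ^ 2) with he
  have hsr : s * r = r * s := by
    rw [hs, hr, ← map_mul, ← map_mul, (isBraid_sg 3).comm 0 2 (by omega) (by omega)]
  have her : e * s * e⁻¹ = r := by rw [he, hs, hr, ← map_inv, ← map_mul, ← map_mul, conj_tl_sq.1]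
  have hes : e * r * e⁻¹ = s := by rw [he, hs, hr, ← map_inv, ← map_mul, ← map_mul, conj_tl_sq.2]
  have hc : ∀ x, perm 5 s (perm 5 r x) = perm 5 r (perm 5 s x) := fun x => by
    rw [← Equiv.Perm.mul_apply, ← Equiv.Perm.mul_apply, ← map_mul, hsr, map_mul]
  by_contra hne
  obtain ⟨x, hx⟩ : ∃ x, perm 5 s x ≠ perm 5 r x := by
    by_contra! h
    exact hne (Equiv.ext h)
  have hx5 : x ≤ 5 := by
    by_contra h
    rw [perm_apply_of_lt s (by omega), perm_apply_of_lt r (by omega)] at hx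
    exact hx rfl
  set p := perm 5 s with hp
  set q := perm 5 r with hq
  have ps : perm 5 (s ^ 2) = 1 := by
    ext y; rw [map_pow, pow_two, Equiv.Perm.mul_apply]; exact h0 y
  have pr : perm 5 (r ^ 2) = 1 := by
    ext y; rw [map_pow, pow_two, Equiv.Perm.mul_apply]; exact h2 y
  have hL : ∀ j k, lk (r ^ 2) j k = lk (s ^ 2) ((perm 5 e)⁻¹ j) ((perm 5 e)⁻¹ k) := by
    intro j k
    rw [← lk_conj e ps, ← her, conj_pow]
  have hL0 : ∀ j k, lk (s ^ 2) (p j) (p k) = lk (s ^ 2) j k := by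
    intro j k
    have := lk_conj s ps (p j) (p k)
    rwa [show s * s ^ 2 * s⁻¹ = s ^ 2 by group, Equiv.Perm.inv_def, Equiv.symm_apply_apply, Equiv.symm_apply_apply] at this
  set y := p (q x) with hy
  have hxy : x ≠ y := by
    intro h
    apply hx
    have := congrArg p h
    rwa [hy, h0] at this
  have hyx : p (q y) = x := by rw [hy, hc, h0, h2]
  have hodd : Odd (lk (s * r) x y) := by
    apply odd_lk_of_swap _ hxy
    · rw [map_mul]; rfl
    · rw [map_mul]; exact hyx
  have hsum : lk (s ^ 2) x y + lk (r ^ 2) x y = 2 * lk (s * r) x y := by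
    have e1 : s ^ 2 * r ^ 2 = s * r * (s * r) := by
      rw [← (show Commute s r from hsr).mul_pow, pow_two]
    have i1 : (perm 5 (s * r))⁻¹ x = y := by
      rw [Equiv.Perm.inv_eq_iff_eq, map_mul]
      exact hyx.symm
    have i2 : (perm 5 (s * r))⁻¹ y = x := by
      rw [Equiv.Perm.inv_eq_iff_eq, map_mul]
      rfl
    rw [← lk_mul_of_pure ps, e1, lk_mul, i1, i2, lk_symm _ y x]
    ring
  have heven := even_lk_of_pure ps x y
  have hL1 : lk (r ^ 2) x y = lk (s ^ 2) x y := by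
    rw [hL]
    set a := (perm 5 e)⁻¹ x with ha
    have hea : perm 5 e a = x := by rw [ha]; simp
    have pe : ∀ z, perm 5 e (p z) = q (perm 5 e z) := fun z => by
      have := congrArg (fun b => perm 5 b z) (show e * s = r * e by rw [← her, inv_mul_cancel_right])
      simpa only [map_mul (perm 5), Equiv.Perm.mul_apply] using this
    have qe : ∀ z, perm 5 e (q z) = p (perm 5 e z) := fun z => by
      have := congrArg (fun b => perm 5 b z) (show e * r = s * e by rw [← hes, inv_mul_cancel_right])
      simpa only [map_mul (perm 5), Equiv.Perm.mul_apply] using this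
    have hb : (perm 5 e)⁻¹ y = p (q a) := by
      rw [Equiv.Perm.inv_eq_iff_eq, pe, qe, hea, ← hc]
    rw [hb]
    have ha5 : a ≤ 5 := by
      by_contra h
      rw [perm_apply_of_lt e (by omega)] at hea
      omega
    have hpqa : p a ≠ q a := by
      intro h
      have := congrArg (perm 5 e) h
      rw [pe, qe, hea] at this
      exact hx this.symm
    by_cases c1 : a = x
    · rw [c1]
    by_cases c2 : a = y
    · rw [c2, hyx, lk_symm]
    by_cases c3 : a = p x
    · rw [c3, ← hc, hL0]
    by_cases c4 : a = q x
    · rw [c4, h2, ← hL0, h0, lk_symm, lk_symm _ x y]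
    exfalso
    have bp : ∀ z ≤ 5, p z ≤ 5 := fun z hz => perm_apply_le s hz
    have bq : ∀ z ≤ 5, q z ≤ 5 := fun z hz => perm_apply_le r hz
    have hcard : ({x, p x, q x, y, a, p a, q a, p (q a)} : Finset ℕ).card ≤ 6 := by
      refine (Finset.card_le_card (t := Finset.range 6) ?_).trans_eq (Finset.card_range 6)
      intro z hz
      simp only [Finset.mem_insert, Finset.mem_singleton] at hz
      rw [Finset.mem_range]
      have b1 := bp x hx5
      have b2 := bq x hx5
      have b3 := bp a ha5
      have b4 := bq a ha5
      have b5 := bp _ b2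
      have b6 := bp _ b4
      omega
    have n1 := f0 x hx5
    have n2 := f2 x hx5
    have n3 := f0 a ha5
    have n4 := f2 a ha5
    have hnd : ({x, p x, q x, y, a, p a, q a, p (q a)} : Finset ℕ).card = 8 := by
      have := List.toFinset_card_of_nodup (l := [x, p x, q x, y, a, p a, q a, p (q a)]) (by
        clear_value p q a y
        simp only [List.nodup_cons, List.mem_cons, List.not_mem_nil, not_or, or_false, not_false_eq_true, List.nodup_nil, and_true]
        refine ⟨⟨?_, ?_, ?_, ?_, ?_, ?_, ?_⟩, ⟨?_, ?_, ?_, ?_, ?_, ?_⟩, ⟨?_, ?_, ?_, ?_, ?_⟩, ⟨?_, ?_, ?_, ?_⟩, ⟨?_, ?_, ?_⟩, ⟨?_, ?_⟩, ?_⟩ <;> grind)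
      simpa using this
    omega
  rw [hL1] at hsum
  rw [← Int.not_even_iff_odd] at hodd
  apply hodd
  rwa [show lk (s * r) x y = lk (s ^ 2) x y by omega]

end Braid

namespace Braid

/-- The permutation of a braid, acting on the finite set of its end points. -/
def permF (m : ℕ) : Br m →* Equiv.Perm (Fin (m + 1)) where
  toFun b :=
    { toFun x := ⟨perm m b x, Nat.lt_succ_of_le (perm_apply_le b (Nat.le_of_lt_succ x.2))⟩
      invFun x := ⟨perm m b⁻¹ x, Nat.lt_succ_of_le (perm_apply_le b⁻¹ (Nat.le_of_lt_succ x.2))⟩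
      left_inv x := by simp
      right_inv x := by simp }
  map_one' := by ext; simp
  map_mul' a b := by ext; simp

theorem permF_apply {m : ℕ} (b : Br m) (x : Fin (m + 1)) : (permF m b x : ℕ) = perm m b x := rfl

theorem perm_eq_of_permF {m : ℕ} {a b : Br m} (h : permF m a = permF m b) : perm m a = perm m b := by
  ext x
  by_cases hx : x ≤ m
  · exact congrArg (fun π : Equiv.Perm (Fin (m + 1)) => (π ⟨x, Nat.lt_succ_of_le hx⟩ : ℕ)) h
  · rw [perm_apply_of_lt a (by omega), perm_apply_of_lt b (by omega)]

theorem permF_eq_of_perm {m : ℕ} {a b : Br m} (h : perm m a = perm m b) : permF m a = permF m b := by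
  ext x
  rw [permF_apply, permF_apply, h]

theorem permF_eq_one_iff {m : ℕ} {b : Br m} : permF m b = 1 ↔ perm m b = 1 := by
  constructor
  · intro h
    rw [← map_one (perm m)]
    exact perm_eq_of_permF (h.trans (map_one _).symm)
  · intro h
    rw [← map_one (permF m)]
    exact permF_eq_of_perm (h.trans (map_one _).symm)

theorem perm_eq_swap {m : ℕ} {b : Br m} {x y : Fin (m + 1)} (h : permF m b = Equiv.swap x y) :
    perm m b = Equiv.swap (x : ℕ) y := by
  ext z
  by_cases hz : z ≤ m
  · have := congrArg (fun π : Equiv.Perm (Fin (m + 1)) => (π ⟨z, Nat.lt_succ_of_le hz⟩ : ℕ)) h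
    simp only [permF_apply] at this
    rw [this]
    simp only [Equiv.swap_apply_def, Fin.ext_iff]
    split_ifs <;> rfl
  · rw [perm_apply_of_lt b (by omega), Equiv.swap_apply_of_ne_of_ne] <;> omega

theorem permF_sg {m i : ℕ} (hi : i < m) :
    permF m (sg m i) = Equiv.swap ⟨i, by omega⟩ ⟨i + 1, by omega⟩ := by
  ext x
  rw [permF_apply, perm_sg hi]
  simp only [Equiv.swap_apply_def, Fin.ext_iff]
  split_ifs <;> rfl

theorem sign_permF {m : ℕ} (b : Br m) :
    Equiv.Perm.sign (permF m b) = 1 ↔ Even (len m b).toAdd := by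
  have h : Equiv.Perm.sign (permF m b) = (-1) ^ (len m b).toAdd := by
    induction b using br_induction with
    | one => simp
    | sg i hi =>
      rw [permF_sg hi, len_sg hi, Equiv.Perm.sign_swap (by simp [Fin.ext_iff])]
      simp
    | mul a b ha hb => rw [map_mul, map_mul, map_mul, ha, hb, toAdd_mul, zpow_add]
    | inv a ha => rw [map_inv, map_inv, map_inv, ha, toAdd_inv, zpow_neg]
  rw [h]
  constructor
  · intro h1
    by_contra h2
    rw [Int.not_even_iff_odd] at h2
    rw [h2.neg_one_zpow] at h1
    exact absurd h1 (by decide)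
  · exact fun h => h.neg_one_zpow

theorem len_map {m : ℕ} (ρ : Br m →* Br m) (b : Br m) :
    (len m (ρ b)).toAdd = (len m b).toAdd * (len m (ρ (sg m 0))).toAdd := by
  induction b using br_induction with
  | one => simp
  | sg i hi => rw [len_map_sg ρ hi, len_sg hi]; simp
  | mul a b ha hb => rw [map_mul ρ, map_mul (len m), map_mul (len m), toAdd_mul, toAdd_mul, ha, hb, add_mul]
  | inv a ha => rw [map_inv ρ, map_inv (len m), map_inv (len m), toAdd_inv, toAdd_inv, ha, neg_mul]

/-- Conjugating an endomorphism so that generators induce the standard transpositions. -/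
theorem exists_conj_of_permF_swap {m : ℕ} {ρ : Br m →* Br m} {e : ℕ → Fin (m + 1)}
    (he : ∀ i ≤ m, ∀ j ≤ m, e i = e j → i = j)
    (h : ∀ i < m, permF m (ρ (sg m i)) = Equiv.swap (e i) (e (i + 1))) :
    ∃ c, ∀ i < m, perm m (c * ρ (sg m i) * c⁻¹) = Equiv.swap i (i + 1) := by
  have hbij : Function.Bijective fun i : Fin (m + 1) => e i := by
    rw [← Finite.injective_iff_bijective]
    intro i j hij
    exact Fin.ext (he i (by omega) j (by omega) hij)
  let f : ℕ → ℕ := fun x => if x ≤ m then e x else x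
  have hf : Function.Bijective f := by
    constructor
    · intro x y hxy
      have hx := (e x).2
      have hy := (e y).2
      simp only [f] at hxy
      split_ifs at hxy with h1 h2 h2
      · exact he x h1 y h2 (Fin.ext hxy)
      · omega
      · omega
      · exact hxy
    · intro y
      by_cases hy : y ≤ m
      · obtain ⟨i, hi⟩ := hbij.2 ⟨y, Nat.lt_succ_of_le hy⟩
        refine ⟨i, ?_⟩
        simp only [f, if_pos (Nat.le_of_lt_succ i.2)]
        exact congrArg Fin.val hi
      · exact ⟨y, if_neg hy⟩
  obtain ⟨b, hb⟩ := perm_surjective m (Equiv.ofBijective f hf) (fun x hx => if_neg (by omega))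
  have hb' : ∀ i ≤ m, perm m b i = e i := fun i hi => by
    rw [hb]; exact if_pos hi
  refine ⟨b⁻¹, fun i hi => ?_⟩
  rw [map_mul, map_mul, inv_inv, perm_eq_swap (h i hi), ← hb' i (by omega), ← hb' (i + 1) (by omega), map_inv]
  have := Equiv.swap_apply_apply (perm m b) i (i + 1)
  rw [this]
  group

end Braid

namespace Braid
open FreeGroup Equiv

theorem perm_four_cases : ∀ g P : Perm (Fin 4), g ^ 2 ≠ 1 →
    P * (g * P * g⁻¹) * P = g * P * g⁻¹ * P * (g * P * g⁻¹) →
    P * (g * (g * P * g⁻¹) * g⁻¹) = g * (g * P * g⁻¹) * g⁻¹ * P →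
    P * (g * P * g⁻¹) * (g * (g * P * g⁻¹) * g⁻¹) = g → (P * g) ^ 3 = 1 → P * g ≠ 1 →
    (∃ k, P = swap k (g k) ∧ k ≠ g k ∧ k ≠ g (g k) ∧ k ≠ g (g (g k)) ∧ g (g (g (g k))) = k) ∨
    (Perm.sign P ≠ 1 ∧ (P * (g * P * g⁻¹)) ^ 3 = 1 ∧ (∃ x, g (P (g⁻¹ (P (P x)))) = P (g (P (g⁻¹ x)))) ∧
      ∀ j k, j = k ∨ k = P j ∨ k = P (P j) ∨ j = P k ∧ k = P (P (P j))) := by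
  decide +kernel

theorem exists_invariant_pair : ∀ g : Perm (Fin 4), g ^ 2 = 1 →
    ∃ j k, j ≠ k ∧ (g j = j ∧ g k = k ∨ g j = k ∧ g k = j) := by
  decide +kernel

theorem slm_proj_ne {ρ : Br 3 →* Br 3} (hρ : Function.Injective ρ) :
    slm (proj (ρ (sg 3 0))) ≠ slm (proj (ρ (sg 3 1))) := by
  intro h
  obtain ⟨φ, hφ⟩ := exists_ker2_map ρ
  have hk : φ kap ≠ 1 := by
    intro hk
    apply kap_ne_one
    apply ker2_injective
    apply hρ
    rw [hφ, hk, _root_.map_one, _root_.map_one]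
  have hw : ∀ w : Br 2, slm (proj (ρ (inc 2 w))) = 1 → len 2 w = 1 → Commute (inc 2 w) (ker2 kap) →
      ∃ v, ρ (inc 2 w) = ker2 v ∧ Commute v (φ kap) := by
    intro w h1 h2 h3
    obtain ⟨k, hk⟩ := exists_zpow_of_slm_eq_one h1
    have h4 : (len 3 (ρ (inc 2 w))).toAdd = 0 := by
      have : len 3 (inc 2 w) = 1 := by rw [← len_proj, proj_inc, h2]
      rw [len_map, this]
      simp
    have h5 := congrArg (fun b => (len 2 b).toAdd) hk
    simp only [len_proj, h4, _root_.map_zpow, toAdd_zpow, len_Z] at h5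
    obtain rfl : k = 0 := by
      simp only [smul_eq_mul] at h5
      push_cast at h5
      omega
    obtain ⟨v, hv⟩ := exists_ker2 (ρ (inc 2 w))
    rw [hk] at hv
    simp only [mul_zero, zpow_zero, _root_.map_one, mul_one] at hv
    refine ⟨v, hv, ?_⟩
    apply ker2_injective
    rw [_root_.map_mul, _root_.map_mul, ← hφ, ← hv, ← _root_.map_mul, ← _root_.map_mul, h3.eq]
  have hc : ∀ w : Br 2, Commute (inc 2 w) (ker2 kap) := by
    intro w
    have : actTwo w kap = kap := by
      induction w using br_induction with
      | one => simp
      | sg i hi => rw [actTwo_sg hi, twist_kap hi]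
      | mul a b ha hb => rw [_root_.map_mul, MulAut.mul_apply, hb, ha]
      | inv a ha =>
        rw [_root_.map_inv, MulAut.inv_apply, MulEquiv.symm_apply_eq, ha]
    have h2 := ker2_act w kap
    rw [this, eq_mul_inv_iff_mul_eq] at h2
    exact h2.symm
  have l0 : len 2 (sg 2 0) = Multiplicative.ofAdd 1 := len_sg (by omega)
  have l1 : len 2 (sg 2 1) = Multiplicative.ofAdd 1 := len_sg (by omega)
  obtain ⟨v, hv, hv'⟩ := hw (sg 2 0 * (sg 2 1)⁻¹) (by
    simp only [_root_.map_mul, _root_.map_inv, inc_sg (show 0 < 2 by omega), inc_sg (show 1 < 2 by omega), h,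
      mul_inv_cancel]) (by simp [l0, l1]) (hc _)
  obtain ⟨u, hu, hu'⟩ := hw ((sg 2 0)⁻¹ * sg 2 1) (by
    simp only [_root_.map_mul, _root_.map_inv, inc_sg (show 0 < 2 by omega), inc_sg (show 1 < 2 by omega), h,
      inv_mul_cancel]) (by simp [l0, l1]) (hc _)
  have huv := commute_trans hk hu' hv'
  have h6 : (sg 2 0)⁻¹ * sg 2 1 * (sg 2 0 * (sg 2 1)⁻¹) = sg 2 0 * (sg 2 1)⁻¹ * ((sg 2 0)⁻¹ * sg 2 1) := by
    apply inc_injective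
    apply hρ
    rw [_root_.map_mul, _root_.map_mul, hu, hv, ← _root_.map_mul, huv.eq, _root_.map_mul, ← hu, ← hv, ← _root_.map_mul,
      ← _root_.map_mul]
  have h7 := congrArg (fun b => (slm b : Matrix (Fin 2) (Fin 2) ℤ) 0 1) h6
  simp only [_root_.map_mul, _root_.map_inv, Matrix.SpecialLinearGroup.coe_mul, Matrix.SpecialLinearGroup.coe_inv, slm_zero,
    slm_one] at h7
  revert h7
  decide

theorem pow_six_of_trace_eq_one {M : Matrix.SpecialLinearGroup (Fin 2) ℤ} (h : M 0 0 + M 1 1 = 1) : M ^ 6 = 1 := by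
  have hd := det_entries M
  have h3 : M ^ 3 = -1 := by
    have hd' : M 1 1 = 1 - M 0 0 := by omega
    rw [hd'] at hd
    rw [pow_succ, pow_two]
    apply ext_entries <;> simp only [mul_entry, hd', Matrix.SpecialLinearGroup.coe_neg, Matrix.SpecialLinearGroup.coe_one,
      Matrix.neg_apply, Matrix.one_apply_eq, ne_eq, zero_ne_one, one_ne_zero, not_false_eq_true, Matrix.one_apply_ne] <;>
      grind
  rw [show 6 = 3 * 2 by rfl, pow_mul, h3, neg_one_sq]

/-- An injective endomorphism of the four strand braid group maps the full twist to a power of itself. -/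
theorem map_Z_three {ρ : Br 3 →* Br 3} (hρ : Function.Injective ρ) :
    ρ (Z 3) = Z 3 ^ (len 3 (ρ (sg 3 0))).toAdd := by
  have hne := slm_proj_ne hρ
  have hbr : slm (proj (ρ (sg 3 0))) * slm (proj (ρ (sg 3 1))) * slm (proj (ρ (sg 3 0))) =
      slm (proj (ρ (sg 3 1))) * slm (proj (ρ (sg 3 0))) * slm (proj (ρ (sg 3 1))) := by
    simp only [← _root_.map_mul, (isBraid_sg 3).braid 0 (by omega)]
  have htr := (eq_or_trace_eq_one hbr).resolve_left hne
  have h6 : (slm (proj (ρ (sg 3 0))) * slm (proj (ρ (sg 3 1)))) ^ 6 = 1 := by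
    apply pow_six_of_trace_eq_one
    rw [mul_entry, mul_entry]
    linarith
  obtain ⟨φ, hφ⟩ := exists_ker2_map ρ
  have hS : slm (proj (ρ (Z 3))) = 1 := by
    obtain ⟨v, hv⟩ := exists_ker2 (Z 3)
    rw [hv, _root_.map_mul, _root_.map_mul, proj_map_ker2, one_mul, proj_Z, Z, tl_eq (by omega), tl_eq (by omega),
      tl_of_le (by omega), mul_one, ← pow_mul]
    simpa only [_root_.map_pow, _root_.map_mul, inc_sg (show 0 < 2 by omega), inc_sg (show 1 < 2 by omega)] using h6
  obtain ⟨k, hk⟩ := exists_zpow_of_slm_eq_one hS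
  obtain ⟨f, hf⟩ := exists_ker2 (ρ (Z 3) * Z 3 ^ (-k))
  have hp : proj (ρ (Z 3) * Z 3 ^ (-k)) = 1 := by
    rw [_root_.map_mul, hk, _root_.map_zpow, proj_Z, ← zpow_natCast, ← zpow_mul, ← zpow_add]
    convert zpow_zero _ using 2
    push_cast
    ring
  rw [hp, _root_.map_one, mul_one] at hf
  have hcf : ∀ v, Commute (φ v) f := by
    intro v
    apply ker2_injective
    rw [_root_.map_mul, _root_.map_mul, ← hφ, ← hf]
    have h1 : Commute (ρ (ker2 v)) (ρ (Z 3)) := (Z_commute (ker2 v)).symm.map ρ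
    have h2 : Commute (ρ (ker2 v)) (Z 3 ^ (-k)) := ((Z_commute _).symm).zpow_right _
    exact (h1.mul_right h2).eq
  have hf1 : f = 1 := by
    by_contra hf1
    have h1 := commute_trans hf1 (hcf (of 0)) (hcf (of 1))
    apply kap_ne_one
    apply ker2_injective
    apply hρ
    rw [hφ, kap]
    simp only [_root_.map_mul φ, _root_.map_inv φ, h1.eq]
    simp
  rw [hf1, _root_.map_one, zpow_neg, mul_inv_eq_one] at hf
  rw [hf]
  congr 1
  have := congrArg (fun b => (len 3 b).toAdd) hf
  simp only [len_map ρ (Z 3), _root_.map_zpow, toAdd_zpow, len_Z, smul_eq_mul] at this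
  push_cast at this
  omega

end Braid

namespace Braid
open Equiv

theorem tl_three : tl 3 0 = sg 3 0 * sg 3 1 * sg 3 2 := by
  rw [tl_eq (by omega), tl_eq (by omega), tl_eq (by omega), tl_of_le (by omega)]
  simp [mul_assoc]

theorem sg_mul_tl_pow_three : (sg 3 0 * tl 3 0) ^ 3 = Z 3 := by
  have h1 := sg_eq_conj (m := 3) (i := 1) (by omega)
  have h2 := sg_eq_conj (m := 3) (i := 2) (by omega)
  rw [pow_one] at h1
  calc (sg 3 0 * tl 3 0) ^ 3 = sg 3 0 * (tl 3 0 * sg 3 0) * (tl 3 0 * sg 3 0) * tl 3 0 := by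
        simp only [pow_succ, pow_zero, one_mul, mul_assoc]
    _ = sg 3 0 * sg 3 1 * (tl 3 0 ^ 2 * sg 3 0) * tl 3 0 := by
        nth_rw 1 [← h1]
        simp only [pow_two, mul_assoc]
    _ = sg 3 0 * sg 3 1 * sg 3 2 * tl 3 0 ^ 3 := by
        rw [← h2]
        simp only [pow_succ, pow_zero, one_mul, mul_assoc]
    _ = Z 3 := by rw [← tl_three, Z, ← pow_succ']

theorem sg_ne {m i j : ℕ} (hi : i < m) (hj : j < m) (hij : i ≠ j) : sg m i ≠ sg m j := by
  intro h
  have h1 := congrArg (fun b => (perm m b i, perm m b j)) h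
  simp only [perm_sg hi, perm_sg hj, Prod.mk.injEq, swap_apply_left, swap_apply_def] at h1
  split_ifs at h1 <;> omega

/-- If the image of `b` has central power in the pure braid group with the right linking number,
then `b` is central. -/
theorem commute_of_pow_eq {ρ : Br 3 →* Br 3} (hρ : Function.Injective ρ) {b : Br 3} {k : ℕ} {a : ℤ} (hk : k ≠ 0)
    (hp : perm 3 (ρ b) = 1) (h : ρ b ^ k = Z 3 ^ (k * a)) (g : Br 3) : Commute b g := by
  have hc : Commute (ρ b) (Z 3 ^ (-a)) := ((Z_commute _).symm).zpow_right _
  have h1 : ρ b * Z 3 ^ (-a) = 1 := by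
    apply eq_one_of_pow_eq_one (m := 3) (k := k)
    · rw [map_mul, hp, map_zpow, perm_Z, one_zpow, one_mul]
    · exact hk
    · rw [hc.mul_pow, h, ← zpow_natCast, ← zpow_mul, ← zpow_add]
      convert zpow_zero _ using 2
      ring
  rw [zpow_neg, mul_inv_eq_one] at h1
  apply hρ
  rw [map_mul, map_mul, h1]
  exact Z_zpow_commute a _

theorem permF_tl_sq_ne {ρ : Br 3 →* Br 3} (hρ : Function.Injective ρ) : permF 3 (ρ (tl 3 0)) ^ 2 ≠ 1 := by
  intro h
  set g := ρ (tl 3 0) with hg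
  have hg4 : g ^ 4 = Z 3 ^ (len 3 (ρ (sg 3 0))).toAdd := by rw [← map_Z_three hρ, hg, ← map_pow, Z]
  set L := (len 3 (ρ (sg 3 0))).toAdd with hL
  have hp2 : perm 3 (g ^ 2) = 1 := permF_eq_one_iff.1 (by rw [map_pow, h])
  obtain ⟨j, k, hjk, hinv⟩ := exists_invariant_pair _ h
  have hjk' : (j : ℕ) ≠ k := fun e => hjk (Fin.ext e)
  have h1 : lk (g ^ 2) j k = 2 * lk g j k := by
    rw [pow_two, lk_mul]
    rcases hinv with ⟨e1, e2⟩ | ⟨e1, e2⟩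
    · have e1' := congrArg Fin.val e1
      have e2' := congrArg Fin.val e2
      rw [permF_apply] at e1' e2'
      rw [← Perm.eq_inv_iff_eq.mpr e1', ← Perm.eq_inv_iff_eq.mpr e2']
      ring
    · have e1' := congrArg Fin.val e1
      have e2' := congrArg Fin.val e2
      rw [permF_apply] at e1' e2'
      rw [← Perm.eq_inv_iff_eq.mpr e1', ← Perm.eq_inv_iff_eq.mpr e2', lk_symm g k j]
      ring
  have h2 : lk (g ^ 4) j k = 2 * lk (g ^ 2) j k := by
    rw [show g ^ 4 = (g ^ 2) ^ 2 by rw [← pow_mul], lk_pow_of_pure hp2]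
    rfl
  have h3 : lk (g ^ 4) j k = L * 2 := by
    rw [hg4, lk_zpow_of_pure perm_Z, lk_Z hjk' (by omega) (by omega)]
  have h4 := commute_of_pow_eq hρ (b := tl 3 0 ^ 2) (k := 2) (a := lk g j k) (by omega) (by rw [map_pow, hp2])
    (by rw [map_pow, ← pow_mul, ← hg, hg4]; congr 1; push_cast; omega) (sg 3 0)
  have h5 := conj_tl_sq.1
  rw [h4.eq, mul_inv_cancel_right] at h5
  exact sg_ne (by omega) (by omega) (by omega) h5

theorem permF_sg_mul_tl_ne {ρ : Br 3 →* Br 3} (hρ : Function.Injective ρ) : permF 3 (ρ (sg 3 0 * tl 3 0)) ≠ 1 := by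
  intro h
  have hp := permF_eq_one_iff.1 h
  have h3 : ρ (sg 3 0 * tl 3 0) ^ 3 = Z 3 ^ (len 3 (ρ (sg 3 0))).toAdd := by
    rw [← map_pow, sg_mul_tl_pow_three, map_Z_three hρ]
  have h1 : lk (ρ (sg 3 0 * tl 3 0) ^ 3) 0 1 = 3 * lk (ρ (sg 3 0 * tl 3 0)) 0 1 := by
    rw [lk_pow_of_pure hp]; rfl
  rw [h3, lk_zpow_of_pure perm_Z, lk_Z (by omega) (by omega) (by omega)] at h1
  have h4 := commute_of_pow_eq hρ (b := sg 3 0 * tl 3 0) (k := 3) (a := (len 3 (ρ (sg 3 0))).toAdd / 3) (by omega) hp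
    (by rw [h3]; congr 1; push_cast; omega) (sg 3 0)
  have h5 : tl 3 0 * sg 3 0 = sg 3 0 * tl 3 0 := by
    have := h4.eq
    rw [mul_assoc] at this
    exact mul_left_cancel this
  have h6 := sg_eq_conj (m := 3) (i := 1) (by omega)
  rw [pow_one, h5, mul_left_inj] at h6
  exact sg_ne (by omega) (by omega) (by omega) h6

theorem exists_conj_perm_three {ρ : Br 3 →* Br 3} (hρ : Function.Injective ρ) :
    ∃ c, ∀ i < 3, perm 3 (c * ρ (sg 3 i) * c⁻¹) = swap i (i + 1) := by
  set g := permF 3 (ρ (tl 3 0)) with hg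
  set P := permF 3 (ρ (sg 3 0)) with hP
  have e1 : permF 3 (ρ (sg 3 1)) = g * P * g⁻¹ := by
    rw [sg_eq (show 1 < 3 by omega), pow_one]
    simp only [map_mul, map_inv]
    rfl
  have e2 : permF 3 (ρ (sg 3 2)) = g * (g * P * g⁻¹) * g⁻¹ := by
    rw [sg_eq (show 2 < 3 by omega)]
    simp only [map_mul, map_inv, map_pow]
    rw [← hg, ← hP, pow_two, mul_inv_rev]
    simp only [mul_assoc]
  have hb := (isBraid_sg 3).map ((permF 3).comp ρ)
  have h1 := hb.braid 0 (by omega)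
  have h2 := hb.comm 0 2 (by omega) (by omega)
  have h3 : permF 3 (ρ (tl 3 0)) = permF 3 (ρ (sg 3 0)) * permF 3 (ρ (sg 3 1)) * permF 3 (ρ (sg 3 2)) := by
    rw [tl_three]; simp only [map_mul]
  have h4 : (P * g) ^ 3 = 1 := by
    rw [hP, hg, ← map_mul, ← map_mul, ← map_pow, ← map_pow, sg_mul_tl_pow_three, permF_eq_one_iff, map_Z_three hρ,
      map_zpow, perm_Z, one_zpow]
  have h5 : P * g ≠ 1 := by
    rw [hP, hg, ← map_mul, ← map_mul]
    exact permF_sg_mul_tl_ne hρ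
  simp only [MonoidHom.comp_apply, zero_add, e1, e2] at h1 h2
  rw [e1, e2] at h3
  rcases perm_four_cases g P (permF_tl_sq_ne hρ) h1 h2 h3.symm h4 h5 with
    ⟨k, hk, k1, k2, k3, k4⟩ | ⟨s1, s2, ⟨x, s3⟩, s4⟩
  · refine exists_conj_of_permF_swap (e := fun i => (g ^ i) k) ?_ ?_
    · have n1 : g k ≠ g (g k) := fun e => k1 (g.injective e)
      have n2 : g k ≠ g (g (g k)) := fun e => k2 (g.injective e)
      have n3 : g (g k) ≠ g (g (g k)) := fun e => n1 (g.injective e)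
      intro i hi j hj hij
      interval_cases i <;> interval_cases j <;> simp [pow_succ] at hij ⊢ <;> first | exact absurd hij ‹_› | exact absurd hij.symm ‹_›
    · have hs (π : Perm (Fin 4)) (a b : Fin 4) : π * swap a b * π⁻¹ = swap (π a) (π b) := (swap_apply_apply π a b).symm
      intro i hi
      interval_cases i
      · simpa using hk
      · rw [e1, hk, hs]; simp [pow_succ]
      · rw [e2, hk, hs, hs]; simp [pow_succ]
  · exfalso
    set ζ := ρ (sg 3 0 * sg 3 1) ^ 3 with hζ
    have hζp : perm 3 ζ = 1 := by
      rw [← permF_eq_one_iff, hζ, map_pow, map_mul, map_mul, e1]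
      exact s2
    have hζi : ζ = ρ (inc 2 (Z 2)) := by
      rw [hζ, ← map_pow, Z, tl_eq (by omega), tl_eq (by omega), tl_of_le (by omega)]
      simp [inc_sg]
    have hinv : ∀ b : Br 2, ∀ j k : Fin 4,
        lk ζ (permF 3 (ρ (inc 2 b)) j) (permF 3 (ρ (inc 2 b)) k) = lk ζ j k := by
      intro b j k
      have h := lk_conj (ρ (inc 2 b)) hζp (permF 3 (ρ (inc 2 b)) j) (permF 3 (ρ (inc 2 b)) k)
      have hc : ρ (inc 2 b) * ζ * (ρ (inc 2 b))⁻¹ = ζ := by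
        rw [hζi, ← map_mul, ← map_mul, ← (Z_commute b).eq, map_mul, map_mul, mul_inv_cancel_right]
      rw [hc, permF_apply, permF_apply, Perm.inv_def, symm_apply_apply, symm_apply_apply] at h
      exact h
    have hi0 : ∀ j k : Fin 4, lk ζ (P j) (P k) = lk ζ j k := fun j k => by
      have := hinv (sg 2 0) j k
      rwa [inc_sg (by omega)] at this
    have hi1 : ∀ j k : Fin 4, lk ζ ((g * P * g⁻¹) j) ((g * P * g⁻¹) k) = lk ζ j k := fun j k => by
      have := hinv (sg 2 1) j k
      rwa [inc_sg (by omega), e1] at this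
    have a1 : ∀ j : Fin 4, lk ζ j (P j) = lk ζ (0 : Fin 4) (P 0) := by
      intro j
      rcases s4 0 j with rfl | rfl | rfl | ⟨-, rfl⟩
      · rfl
      · rw [hi0]
      · rw [hi0, hi0]
      · rw [hi0, hi0, hi0]
    have a2 : ∀ j : Fin 4, lk ζ j (P (P j)) = lk ζ (0 : Fin 4) (P (P 0)) := by
      intro j
      rcases s4 0 j with rfl | rfl | rfl | ⟨-, rfl⟩
      · rfl
      · rw [hi0]
      · rw [hi0, hi0]
      · rw [hi0, hi0, hi0]
    have a3 : lk ζ (0 : Fin 4) (P (P 0)) = lk ζ (0 : Fin 4) (P 0) := by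
      rw [← a2 x, ← hi1 x, ← a1 ((g * P * g⁻¹) x)]
      simp only [Perm.mul_apply, s3]
    have hconst : ∀ j ≤ 3, ∀ k ≤ 3, j ≠ k → lk ζ j k = lk ζ (0 : Fin 4) (P 0) := by
      intro j hj k hk hjk
      obtain ⟨j, rfl⟩ : ∃ j' : Fin 4, j = j' := ⟨⟨j, by omega⟩, rfl⟩
      obtain ⟨k, rfl⟩ : ∃ k' : Fin 4, k = k' := ⟨⟨k, by omega⟩, rfl⟩
      rcases s4 j k with rfl | rfl | rfl | ⟨h, -⟩
      · exact absurd rfl hjk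
      · exact a1 j
      · rw [a2, a3]
      · rw [lk_symm, h, a1]
    have hsum := sum_lk_const hconst
    have hev := even_lk_of_pure hζp (0 : Fin 4) (P 0)
    have hlen : (len 3 ζ).toAdd = 6 * (len 3 (ρ (sg 3 0))).toAdd := by
      rw [hζ, ← map_pow, len_map, map_pow, map_mul, len_sg (by omega), len_sg (by omega)]
      rfl
    rw [hP, ne_eq, sign_permF] at s1
    rw [hlen] at hsum
    apply s1
    convert hev using 1
    push_cast at hsum
    omega

end Braid

namespace Braid
open scoped commutatorElement

section tuple
variable {G : Type*} [Group G] {m : ℕ} {t : ℕ → G}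

theorem IsBraid.eq_of_commute (ht : IsBraid m t) {i : ℕ} (hi : i + 1 < m) (h : Commute (t i) (t (i + 1))) :
    t i = t (i + 1) := by
  have h1 := ht.braid i hi
  rw [h.eq, mul_assoc, mul_assoc] at h1
  exact mul_left_cancel (mul_left_cancel h1)

theorem IsBraid.eq_conj (ht : IsBraid m t) : ∃ d, ∀ i < m, t i = d ^ i * t 0 * (d ^ i)⁻¹ := by
  refine ⟨lift t ht (tl m 0), fun i hi => ?_⟩
  have := congrArg (lift t ht) (sg_eq hi)
  simpa only [map_mul, map_inv, map_pow, lift_sg ht hi, lift_sg ht (Nat.zero_lt_of_lt hi)] using this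

theorem IsBraid.eq_zero (ht : IsBraid m t) (h : t 0 = t 1) {i : ℕ} (hi : i < m) : t i = t 0 := by
  obtain ⟨d, hd⟩ := ht.eq_conj
  rcases Nat.lt_or_ge 1 m with hm | hm
  · have h1 : Commute d (t 0) := by
      have := hd 1 hm
      rw [← h, pow_one, eq_mul_inv_iff_mul_eq] at this
      exact this.symm
    rw [hd i hi, (h1.pow_left i).eq, mul_inv_cancel_right]
  · obtain rfl : i = 0 := by omega
    rfl

theorem IsBraid.zero_eq_one (ht : IsBraid m t) {i : ℕ} (hi : i + 1 < m) (h : t i = t (i + 1)) : t 0 = t 1 := by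
  obtain ⟨d, hd⟩ := ht.eq_conj
  have h1 := hd 1 (by omega)
  rw [hd i (by omega), hd (i + 1) hi, pow_succ] at h
  have h2 : d ^ i * t 0 * (d ^ i)⁻¹ = d ^ i * (d * t 0 * d⁻¹) * (d ^ i)⁻¹ := by rw [h]; group
  rw [mul_left_inj, mul_right_inj] at h2
  rw [h1, h2, pow_one]
  rw [← h2, ← h2]

theorem IsBraid.pow_eq_one (ht : IsBraid m t) {i j k : ℕ} (hi : i < m) (hj : j < m) (h : t i ^ k = 1) :
    t j ^ k = 1 := by
  obtain ⟨d, hd⟩ := ht.eq_conj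
  rw [hd i hi, conj_pow, conj_eq_one_iff] at h
  rw [hd j hj, conj_pow, h, mul_one, mul_inv_cancel]

theorem IsBraid.zero_eq_one_of_commute (ht : IsBraid m t) (hm : 4 ≤ m)
    (h : Commute (t 1 * (t 0)⁻¹) (t 3 * (t 0)⁻¹)) : t 0 = t 1 := by
  have h30 : Commute (t 0) (t 3) := ht.comm 0 3 (by omega) (by omega)
  have h31 : Commute (t 1) (t 3) := ht.comm 1 3 (by omega) (by omega)
  have h1 : t 3 * (t 1 * (t 0)⁻¹ * (t 0)⁻¹) = t 3 * ((t 0)⁻¹ * t 1 * (t 0)⁻¹) := by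
    calc t 3 * (t 1 * (t 0)⁻¹ * (t 0)⁻¹) = t 1 * (t 0)⁻¹ * (t 3 * (t 0)⁻¹) := by
          rw [← mul_assoc, ← mul_assoc, ← h31.eq, ← mul_assoc, mul_assoc (t 1) (t 0)⁻¹, (h30.inv_left).eq, ← mul_assoc]
      _ = t 3 * ((t 0)⁻¹ * t 1 * (t 0)⁻¹) := by
          rw [h.eq]
          simp only [mul_assoc]
  have h2 := mul_right_cancel (mul_left_cancel h1)
  refine ht.eq_of_commute (i := 0) (by omega) ?_
  have : Commute (t 1) (t 0)⁻¹ := h2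
  exact (Commute.inv_right_iff.1 this).symm

end tuple

theorem commutator_perfect {m : ℕ} (hm : 4 ≤ m) : commutator (commutator (Br m)) = ⊤ := by
  let N : Subgroup (Br m) := ⁅commutator (Br m), commutator (Br m)⁆
  have hN : N.Normal := Subgroup.commutator_normal _ _
  let q := QuotientGroup.mk' N
  have hb := (isBraid_sg m).map q
  have hmem : ∀ i < m, sg m i * (sg m 0)⁻¹ ∈ commutator (Br m) := by
    intro i hi
    rw [sg_eq hi, commutator_def]
    exact Subgroup.commutator_mem_commutator (Subgroup.mem_top _) (Subgroup.mem_top _)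
  have h01 : q (sg m 0) = q (sg m 1) := by
    refine hb.zero_eq_one_of_commute hm ?_
    rw [← map_inv, ← map_mul, ← map_mul]
    have h1 : ⁅sg m 1 * (sg m 0)⁻¹, sg m 3 * (sg m 0)⁻¹⁆ ∈ N :=
      Subgroup.commutator_mem_commutator (hmem 1 (by omega)) (hmem 3 (by omega))
    rw [← QuotientGroup.eq_one_iff] at h1
    have h2 : ⁅q (sg m 1 * (sg m 0)⁻¹), q (sg m 3 * (sg m 0)⁻¹)⁆ = 1 := by
      rw [← map_commutatorElement]; exact h1
    exact commutatorElement_eq_one_iff_commute.1 h2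
  have hall : ∀ b : Br m, ∃ k : ℤ, q b = q (sg m 0) ^ k := by
    intro b
    have := mem_of_sg ((Subgroup.zpowers (q (sg m 0))).comap q) (fun i hi => by
      rw [Subgroup.mem_comap, hb.eq_zero h01 hi]
      exact Subgroup.mem_zpowers _) b
    obtain ⟨k, hk⟩ := Subgroup.mem_zpowers_iff.1 (Subgroup.mem_comap.1 this)
    exact ⟨k, hk.symm⟩
  have hle : commutator (Br m) ≤ N := by
    rw [commutator_def, Subgroup.commutator_le]
    intro a _ b _
    obtain ⟨k, hk⟩ := hall a
    obtain ⟨l, hl⟩ := hall b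
    rw [← QuotientGroup.eq_one_iff]
    change q _ = 1
    rw [map_commutatorElement, commutatorElement_eq_one_iff_commute, hk, hl]
    exact (Commute.refl _).zpow_zpow _ _
  rw [eq_top_iff, ← Subgroup.map_subtype_le_map_subtype, Subgroup.map_subtype_commutator]
  intro x hx
  obtain ⟨y, -, rfl⟩ := hx
  exact hle y.2

/-- A perfect group has no nontrivial homomorphism to a pure braid group. -/
theorem eq_one_of_perfect {P : Type*} [Group P] (hP : commutator P = ⊤) (k : ℕ) (f : P →* Br k)
    (hf : ∀ p, perm k (f p) = 1) (p : P) : f p = 1 := by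
  induction k generalizing p with
  | zero =>
    have := mem_of_sg (⊥ : Subgroup (Br 0)) (fun i hi => by omega) (f p)
    simpa using this
  | succ k ih =>
    choose v b hvb using fun p => exists_decomp (fixes_of_pure (hf p))
    have hmul : ∀ p q, v (p * q) = v p * act k (b p) (v q) ∧ b (p * q) = b p * b q := by
      intro p q
      apply decomp_inj
      rw [← hvb, map_mul, ← decomp_mul, ← hvb, ← hvb]
    have hb : ∀ p, b p = 1 := by
      refine ih (MonoidHom.mk' b fun p q => (hmul p q).2) fun p => ?_
      have := hf p
      rwa [hvb, perm_decomp] at this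
    have hv : ∀ p, v p = 1 := hom_eq_one_of_perfect hP (MonoidHom.mk' v fun p q => by
      rw [(hmul p q).1, hb, map_one, MulAut.one_apply])
    rw [hvb, hv, hb, map_one, map_one, mul_one]

theorem perm_map_ne {m : ℕ} (hm : 4 ≤ m) {ρ : Br m →* Br m} (hρ : Function.Injective ρ) :
    permF m (ρ (sg m 0)) ≠ permF m (ρ (sg m 1)) := by
  intro h
  have hb := (isBraid_sg m).map ((permF m).comp ρ)
  have hall : ∀ b : Br m, ∃ k : ℤ, permF m (ρ b) = permF m (ρ (sg m 0)) ^ k := by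
    intro b
    have := mem_of_sg ((Subgroup.zpowers (permF m (ρ (sg m 0)))).comap ((permF m).comp ρ)) (fun i hi => by
      rw [Subgroup.mem_comap, hb.eq_zero h hi]
      exact Subgroup.mem_zpowers _) b
    obtain ⟨k, hk⟩ := Subgroup.mem_zpowers_iff.1 (Subgroup.mem_comap.1 this)
    exact ⟨k, hk.symm⟩
  have hle : commutator (Br m) ≤ ((permF m).comp ρ).ker := by
    rw [commutator_def, Subgroup.commutator_le]
    intro a _ b _
    obtain ⟨k, hk⟩ := hall a
    obtain ⟨l, hl⟩ := hall b
    rw [MonoidHom.mem_ker, map_commutatorElement, commutatorElement_eq_one_iff_commute, MonoidHom.comp_apply,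
      MonoidHom.comp_apply, hk, hl]
    exact (Commute.refl _).zpow_zpow _ _
  have hmem : sg m 1 * (sg m 0)⁻¹ ∈ commutator (Br m) := by
    rw [sg_eq (show 1 < m by omega), commutator_def]
    exact Subgroup.commutator_mem_commutator (Subgroup.mem_top _) (Subgroup.mem_top _)
  have h1 := eq_one_of_perfect (commutator_perfect hm) m (ρ.comp (commutator (Br m)).subtype)
    (fun p => permF_eq_one_iff.1 (hle p.2)) ⟨_, hmem⟩
  have h2 : ρ (sg m 1 * (sg m 0)⁻¹) = ρ 1 := by rw [map_one]; exact h1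
  exact sg_ne (by omega) (by omega) (by omega) (mul_inv_eq_one.1 (hρ h2))

end Braid

namespace Braid
open Equiv

section centralizer
variable {α : Type*}

/-- The action of the centralizer of a permutation on its fixed points. -/
def fixHom (τ : Perm α) : Subgroup.centralizer {τ} →* Perm {x // τ x = x} where
  toFun u := u.1.subtypePerm fun x => by
    have h := Subgroup.mem_centralizer_singleton_iff.1 u.2
    have h' : u.1 (τ x) = τ (u.1 x) := by
      rw [← Perm.mul_apply, ← Perm.mul_apply, h]
    rw [← h', u.1.injective.eq_iff]
  map_one' := rfl
  map_mul' _ _ := rfl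

variable {τ : Perm α} {u v : Subgroup.centralizer {τ}}

theorem centralizer_zpow_apply (u : Subgroup.centralizer {τ}) (k : ℤ) (x : α) :
    u.1 ((τ ^ k) x) = (τ ^ k) (u.1 x) := by
  have h : Commute u.1 τ := Subgroup.mem_centralizer_singleton_iff.1 u.2
  rw [← Perm.mul_apply, ← Perm.mul_apply, (h.zpow_right k).eq]

theorem fixHom_apply {u : Subgroup.centralizer {τ}} {x : α} (hx : τ x = x) : u.1 x = (fixHom τ u ⟨x, hx⟩ : α) := rfl

variable [Fintype α] [DecidableEq α]

/-- The action of the centralizer of a permutation on its cycles. -/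
abbrev cycHom (τ : Perm α) : Subgroup.centralizer {τ} →* Perm τ.cycleFactorsFinset :=
  Perm.OnCycleFactors.toPermHom τ

theorem sameCycle_of_cycHom (hu : cycHom τ u = 1) {x : α} (hx : τ x ≠ x) : τ.SameCycle x (u.1 x) := by
  have h := (Perm.OnCycleFactors.mem_ker_toPermHom_iff τ u).1 (MonoidHom.mem_ker.2 hu) (τ.cycleOf x)
    (Perm.cycleOf_mem_cycleFactorsFinset_iff.2 (Perm.mem_support.2 hx))
  have h1 : u.1 x ∈ (τ.cycleOf x).support := by
    rw [Perm.mem_support]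
    have h2 : τ.cycleOf x (u.1 x) = u.1 (τ.cycleOf x x) := by
      rw [← Perm.mul_apply, ← Perm.mul_apply, h.eq]
    rw [h2, Perm.cycleOf_apply_self, u.1.injective.ne_iff]
    exact hx
  exact (Perm.mem_support_cycleOf_iff.1 h1).1

theorem commute_of_cycHom (hu : cycHom τ u = 1) (hv : cycHom τ v = 1) (h : Commute (fixHom τ u) (fixHom τ v)) :
    Commute u v := by
  apply Subtype.ext
  ext x
  change u.1 (v.1 x) = v.1 (u.1 x)
  by_cases hx : τ x = x
  · have := congrArg (fun π : Perm {x // τ x = x} => (π ⟨x, hx⟩ : α)) h.eq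
    exact this
  · obtain ⟨a, ha⟩ := sameCycle_of_cycHom hu hx
    obtain ⟨b, hb⟩ := sameCycle_of_cycHom hv hx
    rw [← ha, ← hb, centralizer_zpow_apply, centralizer_zpow_apply, ← ha, ← hb, ← Perm.mul_apply, ← Perm.mul_apply,
      ← zpow_add, ← zpow_add, add_comm]

theorem card_fixed_add (τ : Perm α) : Fintype.card {x // τ x = x} + τ.support.card = Fintype.card α := by
  rw [Fintype.card_subtype, ← Finset.card_univ, ← Finset.card_filter_add_card_filter_not (s := Finset.univ) fun x => τ x = x]
  rfl

theorem two_mul_card_cycle_le (τ : Perm α) : 2 * τ.cycleFactorsFinset.card ≤ τ.support.card := by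
  have h := Multiset.card_nsmul_le_sum (s := τ.cycleType) (a := 2) fun x hx => Perm.two_le_of_mem_cycleType hx
  rw [Perm.sum_cycleType, Perm.cycleType_def, Multiset.card_map, smul_eq_mul, mul_comm] at h
  exact h

theorem card_mul_le {ℓ : ℕ} (h : ∀ c ∈ τ.cycleFactorsFinset, c.support.card = ℓ) :
    ℓ * τ.cycleFactorsFinset.card = τ.support.card ∧ τ ^ ℓ = 1 := by
  have h1 : τ.cycleType = Multiset.replicate τ.cycleFactorsFinset.card ℓ := by
    rw [Multiset.eq_replicate, Perm.cycleType_def]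
    refine ⟨by simp, fun b hb => ?_⟩
    obtain ⟨c, hc, rfl⟩ := Multiset.mem_map.1 hb
    exact h c hc
  constructor
  · rw [← Perm.sum_cycleType, h1]
    simp [mul_comm]
  · rw [← orderOf_dvd_iff_pow_eq_one, ← Perm.lcm_cycleType, h1, Multiset.lcm_dvd]
    intro b hb
    rw [Multiset.eq_of_mem_replicate hb]

theorem perm_commute_of_card_le_two {β : Type*} [Fintype β] [DecidableEq β] (h : Fintype.card β ≤ 2) (p q : Perm β) :
    Commute p q ∧ p ^ 2 = 1 := by
  have h1 : Nat.card (Perm β) ≤ 2 := by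
    rw [Nat.card_eq_fintype_card, Fintype.card_perm]
    exact (Nat.factorial_le h).trans (by decide)
  have h2 : 0 < Nat.card (Perm β) := Nat.card_pos
  have h3 : ∀ r : Perm β, r ^ 2 = 1 := fun r => by
    rcases (show Nat.card (Perm β) = 1 ∨ Nat.card (Perm β) = 2 by omega) with h4 | h4
    · have := pow_card_eq_one' (x := r)
      rw [h4, pow_one] at this
      rw [this, one_pow]
    · have := pow_card_eq_one' (x := r)
      rwa [h4] at this
  refine ⟨?_, h3 p⟩
  have hp := h3 p
  have hq := h3 q
  have hpq := h3 (p * q)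
  rw [pow_two] at hp hq hpq
  have : p * q = (p * q)⁻¹ := eq_inv_of_mul_eq_one_left hpq
  rw [mul_inv_rev, ← eq_inv_of_mul_eq_one_left hp, ← eq_inv_of_mul_eq_one_left hq] at this
  exact this

theorem perm_commute_of_pow_three {β : Type*} [Fintype β] [DecidableEq β] (h : Fintype.card β = 3) {p q : Perm β}
    (hp : p ^ 3 = 1) (hq : q ^ 3 = 1) : Commute p q := by
  have key : ∀ p q : Perm (Fin 3), p ^ 3 = 1 → q ^ 3 = 1 → p * q = q * p := by decide +kernel
  let e := (Fintype.equivFinOfCardEq h).permCongrHom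
  apply e.injective
  rw [map_mul, map_mul]
  exact key _ _ (by rw [← map_pow, hp, map_one]) (by rw [← map_pow, hq, map_one])

end centralizer

end Braid

namespace Braid
open Equiv

section swaps
variable {α : Type*} [DecidableEq α]

theorem eq_of_commute_swap {a b c : α} (hb : a ≠ b) (hc : a ≠ c) (h : Commute (swap a b) (swap a c)) : b = c := by
  by_contra hbc
  have h1 := congrArg (fun π : Perm α => π a) h.eq
  simp only [Perm.mul_apply, swap_apply_left] at h1
  rw [swap_apply_of_ne_of_ne hc.symm (Ne.symm hbc), swap_apply_of_ne_of_ne hb.symm hbc] at h1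
  exact hbc h1.symm

theorem exists_swap_of_not_commute {a b : α} {s : Perm α} (hs : s.IsSwap) (h : ¬ Commute s (swap a b)) :
    ∃ c, c ≠ a ∧ c ≠ b ∧ (s = swap b c ∨ s = swap a c) := by
  obtain ⟨x, y, hxy, rfl⟩ := hs
  have h1 : ¬ (swap x y = swap a b) := fun h1 => h (h1 ▸ Commute.refl _)
  have h2 : x = a ∨ x = b ∨ y = a ∨ y = b := by
    by_contra h2
    push Not at h2
    refine h (Perm.Disjoint.commute fun z => ?_)
    by_cases hz : z = x ∨ z = y
    · right
      rcases hz with rfl | rfl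
      · exact swap_apply_of_ne_of_ne h2.1 h2.2.1
      · exact swap_apply_of_ne_of_ne h2.2.2.1 h2.2.2.2
    · push Not at hz
      exact Or.inl (swap_apply_of_ne_of_ne hz.1 hz.2)
  rcases h2 with rfl | rfl | rfl | rfl
  · exact ⟨y, hxy.symm, fun h => h1 (by rw [h]), Or.inr rfl⟩
  · exact ⟨y, fun h => h1 (by rw [h, swap_comm]), hxy.symm, Or.inl rfl⟩
  · exact ⟨x, hxy, fun h => h1 (by rw [h, swap_comm]), Or.inr (swap_comm _ _)⟩
  · exact ⟨x, fun h => h1 (by rw [h]), hxy, Or.inl (swap_comm _ _)⟩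

/-- Pairwise distinct transpositions satisfying the braid relations form a path. -/
theorem IsBraid.exists_swap_path {m : ℕ} {t : ℕ → Perm α} (ht : IsBraid m t) (hm : 4 ≤ m) (h01 : t 0 ≠ t 1)
    (hs : ∀ i < m, (t i).IsSwap) :
    ∃ e : ℕ → α, (∀ i ≤ m, ∀ j ≤ m, e i = e j → i = j) ∧ ∀ i < m, t i = swap (e i) (e (i + 1)) := by
  have hnc : ∀ i, i + 1 < m → ¬ Commute (t i) (t (i + 1)) := fun i hi h =>
    h01 (ht.zero_eq_one hi (ht.eq_of_commute hi h))
  suffices H : ∀ k, 2 ≤ k → k ≤ m → ∃ e : ℕ → α, (∀ i ≤ k, ∀ j ≤ k, e i = e j → i = j) ∧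
      ∀ i < k, t i = swap (e i) (e (i + 1)) from H m (by omega) le_rfl
  intro k hk
  induction k, hk using Nat.le_induction with
  | base =>
    intro _
    have key : ∀ a b c : α, a ≠ b → c ≠ a → c ≠ b → t 0 = swap a b → t 1 = swap b c →
        ∃ e : ℕ → α, (∀ i ≤ 2, ∀ j ≤ 2, e i = e j → i = j) ∧ ∀ i < 2, t i = swap (e i) (e (i + 1)) := by
      intro a b c hab hca hcb h0 h1
      refine ⟨fun i => if i = 0 then a else if i = 1 then b else c, ?_, ?_⟩
      · intro i hi j hj h
        interval_cases i <;> interval_cases j <;> simp_all [eq_comm]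
      · intro i hi
        interval_cases i
        · simpa using h0
        · simpa using h1
    obtain ⟨a, b, hab, h0⟩ := hs 0 (by omega)
    have h1 : ¬ Commute (t 1) (swap a b) := fun h => hnc 0 (by omega) (h0 ▸ h.symm)
    obtain ⟨c, hca, hcb, h2 | h2⟩ := exists_swap_of_not_commute (hs 1 (by omega)) h1
    · exact key a b c hab hca hcb h0 h2
    · exact key b a c hab.symm hcb hca (by rw [h0, swap_comm]) h2
  | succ k hk ih =>
    intro hkm
    obtain ⟨e, he, h⟩ := ih (by omega)
    obtain ⟨k, rfl⟩ := Nat.exists_eq_add_of_le' hk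
    have hne : ∀ i ≤ k + 2, ∀ j ≤ k + 2, i ≠ j → e i ≠ e j := fun i hi j hj hij h => hij (he i hi j hj h)
    have h1 : ¬ Commute (t (k + 2)) (swap (e (k + 1)) (e (k + 2))) := fun h' =>
      hnc (k + 1) (by omega) (by rw [h (k + 1) (by omega)]; exact h'.symm)
    obtain ⟨c, hc1, hc2, h2 | h2⟩ := exists_swap_of_not_commute (hs (k + 2) (by omega)) h1
    · have hc : ∀ i ≤ k + 2, e i ≠ c := by
        intro i hi hic
        rcases (show i = k + 2 ∨ i = k + 1 ∨ i ≤ k by omega) with rfl | rfl | hik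
        · exact hc2 hic.symm
        · exact hc1 hic.symm
        · have h3 := ht.comm i (k + 2) (by omega) (by omega)
          rw [h i (by omega), h2, ← hic, swap_comm (e (k + 2))] at h3
          have := eq_of_commute_swap (hne i (by omega) (i + 1) (by omega) (by omega))
            (hne i (by omega) (k + 2) (by omega) (by omega)) h3
          exact hne (i + 1) (by omega) (k + 2) (by omega) (by omega) this
      refine ⟨fun i => if i ≤ k + 2 then e i else c, ?_, ?_⟩
      · intro i hi j hj hij
        dsimp only at hij
        split_ifs at hij with h3 h4 h4
        · exact he i h3 j h4 hij
        · exact absurd hij (hc i h3)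
        · exact absurd hij.symm (hc j h4)
        · omega
      · intro i hi
        rcases (show i = k + 2 ∨ i < k + 2 by omega) with rfl | hik
        · simpa using h2
        · dsimp only
          rw [if_pos (by omega), if_pos (by omega)]
          exact h i hik
    · exfalso
      have h3 := ht.comm k (k + 2) (by omega) (by omega)
      rw [h k (by omega), h2, swap_comm (e k)] at h3
      have h4 := eq_of_commute_swap (hne (k + 1) (by omega) k (by omega) (by omega)) hc1.symm h3
      have h5 : t (k + 2) = t k := by rw [h2, ← h4, h k (by omega), swap_comm]
      rcases (show k + 3 < m ∨ k + 3 = m by omega) with h6 | h6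
      · refine hnc (k + 2) h6 ?_
        rw [h5]
        exact ht.comm k (k + 3) (by omega) h6
      · obtain ⟨k, rfl⟩ : ∃ l, k = l + 1 := ⟨k - 1, by omega⟩
        refine hnc k (by omega) ?_
        rw [← h5]
        exact ht.comm k (k + 1 + 2) (by omega) (by omega)

end swaps

end Braid

namespace Braid
open Equiv

section classify
universe u
variable {α : Type u} {m : ℕ} {t : ℕ → Perm α}

open Classical in
/-- The generators far from the last one, as elements of its centralizer. -/
noncomputable def centralTuple (m : ℕ) (t : ℕ → Perm α) (i : ℕ) : Subgroup.centralizer {t (m - 1)} :=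
  if h : t i ∈ Subgroup.centralizer {t (m - 1)} ∧ i + 3 ≤ m then ⟨t i, h.1⟩ else 1

theorem IsBraid.centralTuple_val (ht : IsBraid m t) {i : ℕ} (hi : i + 3 ≤ m) :
    (centralTuple m t i).1 = t i := by
  have h := ht.comm i (m - 1) (by omega) (by omega)
  rw [centralTuple, dif_pos ⟨Subgroup.mem_centralizer_singleton_iff.2 h, hi⟩]

theorem IsBraid.centralTuple (ht : IsBraid m t) : IsBraid (m - 2) (centralTuple m t) where
  braid i hi := by
    apply Subtype.ext
    simp only [Subgroup.coe_mul, ht.centralTuple_val (show i + 3 ≤ m by omega),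
      ht.centralTuple_val (show i + 1 + 3 ≤ m by omega)]
    exact ht.braid i (by omega)
  comm i j hij hj := by
    apply Subtype.ext
    simp only [Subgroup.coe_mul, ht.centralTuple_val (show i + 3 ≤ m by omega),
      ht.centralTuple_val (show j + 3 ≤ m by omega)]
    exact ht.comm i j hij (by omega)

variable [Fintype α] [DecidableEq α]

theorem IsBraid.card_support_eq (ht : IsBraid m t) {i j : ℕ} (hi : i < m) (hj : j < m) :
    (t i).support.card = (t j).support.card := by
  obtain ⟨d, hd⟩ := ht.eq_conj
  rw [hd i hi, hd j hj, Perm.card_support_conj, Perm.card_support_conj]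

theorem IsBraid.eq_of_cycHom_eq_one (ht : IsBraid m t) (hm : 4 ≤ m)
    (hf : fixHom _ (Braid.centralTuple m t 1) = fixHom _ (Braid.centralTuple m t 0))
    (h0 : cycHom _ (Braid.centralTuple m t 0) = 1) (h1 : cycHom _ (Braid.centralTuple m t 1) = 1) :
    t 0 = t 1 := by
  have h2 : Commute (Braid.centralTuple m t 0) (Braid.centralTuple m t 1) := by
    refine commute_of_cycHom h0 h1 ?_
    rw [hf]
  refine ht.eq_of_commute (i := 0) (by omega) ?_
  have := congrArg Subtype.val h2.eq
  simpa only [Subgroup.coe_mul, ht.centralTuple_val (show 0 + 3 ≤ m by omega),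
    ht.centralTuple_val (show 1 + 3 ≤ m by omega), commute_iff_eq] using this

theorem IsBraid.eq_of_centralTuple_eq (ht : IsBraid m t) (hm : 6 ≤ m)
    (hf : ∀ i < m - 2, fixHom _ (Braid.centralTuple m t i) = fixHom _ (Braid.centralTuple m t 0))
    (hc : ∀ i < m - 2, cycHom _ (Braid.centralTuple m t i) = cycHom _ (Braid.centralTuple m t 0)) :
    t 0 = t 1 := by
  refine ht.zero_eq_one_of_commute (by omega) ?_
  have h2 : Commute (Braid.centralTuple m t 1 * (Braid.centralTuple m t 0)⁻¹)
      (Braid.centralTuple m t 3 * (Braid.centralTuple m t 0)⁻¹) := by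
    refine commute_of_cycHom ?_ ?_ ?_
    · rw [map_mul, map_inv, hc 1 (by omega), mul_inv_cancel]
    · rw [map_mul, map_inv, hc 3 (by omega), mul_inv_cancel]
    · rw [map_mul, map_inv, hf 1 (by omega), mul_inv_cancel]
      exact Commute.one_left _
  have := congrArg Subtype.val h2.eq
  simpa only [Subgroup.coe_mul, Subgroup.coe_inv, ht.centralTuple_val (show 0 + 3 ≤ m by omega),
    ht.centralTuple_val (show 1 + 3 ≤ m by omega), ht.centralTuple_val (show 3 + 3 ≤ m by omega), commute_iff_eq] using this

theorem IsBraid.eq_of_card_le_two (ht : IsBraid m t) (hm : 4 ≤ m)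
    (hX : Fintype.card {x // t (m - 1) x = x} ≤ 2) (hQ : (t (m - 1)).cycleFactorsFinset.card ≤ 2)
    (hs : 3 ≤ (t (m - 1)).support.card) (hs' : (t (m - 1)).support.card ≤ 6) : t 0 = t 1 := by
  have hb := ht.centralTuple
  have v0 := ht.centralTuple_val (show 0 + 3 ≤ m by omega)
  have v1 := ht.centralTuple_val (show 1 + 3 ≤ m by omega)
  have hQ' : Fintype.card (t (m - 1)).cycleFactorsFinset ≤ 2 := by rwa [Fintype.card_coe]
  have hf := ((hb.map (fixHom _)).eq_of_commute (i := 0) (by omega) (perm_commute_of_card_le_two hX _ _).1).symm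
  have hc := ((hb.map (cycHom _)).eq_of_commute (i := 0) (by omega) (perm_commute_of_card_le_two hQ' _ _).1).symm
  by_cases h0 : cycHom _ (Braid.centralTuple m t 0) = 1
  · exact ht.eq_of_cycHom_eq_one hm hf h0 (hc.trans h0)
  set u := Braid.centralTuple m t 0 with hu
  obtain ⟨c, hcne⟩ : ∃ c, cycHom _ u c ≠ c := by
    by_contra h
    push Not at h
    exact h0 (Perm.ext h)
  have hcard2 : ({c, cycHom _ u c} : Finset _).card = 2 := Finset.card_pair hcne.symm
  have huniv : ({c, cycHom _ u c} : Finset _) = Finset.univ := by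
    apply Finset.eq_univ_of_card
    have := Finset.card_le_univ ({c, cycHom _ u c} : Finset _)
    omega
  have hQ2 : (t (m - 1)).cycleFactorsFinset.card = 2 := by
    rw [← Fintype.card_coe, ← Finset.card_univ, ← huniv, hcard2]
  obtain ⟨h1, h2⟩ := card_mul_le (τ := t (m - 1)) (ℓ := (c : Perm α).support.card) fun d hd => by
    have h3 : (⟨d, hd⟩ : (t (m - 1)).cycleFactorsFinset) ∈ ({c, cycHom _ u c} : Finset _) := by
      rw [huniv]; exact Finset.mem_univ _
    rcases Finset.mem_insert.1 h3 with h4 | h4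
    · rw [← h4]
    · have h5 := congrArg Subtype.val (Finset.mem_singleton.1 h4)
      rw [Perm.OnCycleFactors.coe_toPermHom] at h5
      change d = _ at h5
      rw [h5, Perm.card_support_conj]
  rw [hQ2] at h1
  rcases (show (c : Perm α).support.card = 2 ∨ (c : Perm α).support.card = 3 by omega) with h3 | h3
  · rw [h3] at h2
    have hsq : ∀ i < m, t i ^ 2 = 1 := fun i hi => ht.pow_eq_one (i := m - 1) (by omega) hi h2
    let w := Braid.centralTuple m t 1 * u⁻¹
    have hwc : cycHom _ w = 1 := by rw [map_mul, map_inv, hc, mul_inv_cancel]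
    have hwf : fixHom _ w = 1 := by rw [map_mul, map_inv, hf, mul_inv_cancel]
    have hw : w.1 * w.1 = 1 := by
      ext x
      rw [Perm.mul_apply, Perm.one_apply]
      by_cases hx : t (m - 1) x = x
      · have : w.1 x = x := by
          rw [fixHom_apply hx, hwf]
          rfl
        rw [this, this]
      · obtain ⟨a, ha⟩ := sameCycle_of_cycHom hwc hx
        rw [← ha, centralizer_zpow_apply, ← ha, ← Perm.mul_apply, ← zpow_add, ← two_mul, zpow_mul]
        rw [show (t (m - 1)) ^ (2 : ℤ) = 1 from h2, one_zpow, Perm.one_apply]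
    have hw' : w.1 = t 1 * (t 0)⁻¹ := by rw [Subgroup.coe_mul, Subgroup.coe_inv, v1, v0]
    have e0 := hsq 0 (by omega)
    have e1 := hsq 1 (by omega)
    rw [pow_two] at e0 e1
    have i0 := eq_inv_of_mul_eq_one_left e0
    have i1 := eq_inv_of_mul_eq_one_left e1
    rw [hw', ← i0] at hw
    have h4 := eq_inv_of_mul_eq_one_left hw
    rw [mul_inv_rev, ← i0, ← i1] at h4
    exact ht.eq_of_commute (i := 0) (by omega) h4.symm
  · rw [h3] at h2
    have h4 : t 0 ^ 3 = 1 := ht.pow_eq_one (i := m - 1) (by omega) (by omega) h2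
    have h5 : u ^ 3 = 1 := Subtype.ext (by rw [Subgroup.coe_pow, v0, h4]; rfl)
    have h6 := congrArg (cycHom _) h5
    rw [map_pow, map_one, pow_succ, (perm_commute_of_card_le_two hQ' _ (cycHom _ u)).2, one_mul] at h6
    exact absurd h6 h0

/-- Artin's classification of the small permutation representations of the braid group. -/
theorem IsBraid.perm_classify (m : ℕ) : 4 ≤ m → ∀ {α : Type u} [Fintype α] [DecidableEq α] {t : ℕ → Perm α},
    IsBraid m t → Fintype.card α ≤ m + 1 → t 0 = t 1 ∨ (∀ i < m, (t i).IsSwap) ∨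
      (m = 5 ∧ Fintype.card α = 6 ∧ ∀ i < m, t i ^ 2 = 1 ∧ ∀ x, t i x ≠ x) := by
  induction m using Nat.strong_induction_on with
  | _ m ih =>
  intro hm α _ _ t ht hα
  have hfix := card_fixed_add (t (m - 1))
  have hcyc := two_mul_card_cycle_le (t (m - 1))
  have hb := ht.centralTuple
  have hne1 := Perm.card_support_ne_one (t (m - 1))
  rcases (show (t (m - 1)).support.card = 0 ∨ (t (m - 1)).support.card = 2 ∨ 3 ≤ (t (m - 1)).support.card by
    omega) with h0 | h2 | h3
  · left
    have h1 : t (m - 1) ^ 1 = 1 := by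
      rw [pow_one]
      exact Perm.card_support_eq_zero.1 h0
    have h2 := ht.pow_eq_one (i := m - 1) (j := 0) (by omega) (by omega) h1
    have h3 := ht.pow_eq_one (i := m - 1) (j := 1) (by omega) (by omega) h1
    rw [pow_one] at h2 h3
    rw [h2, h3]
  · right; left
    intro i hi
    rw [← Perm.card_support_eq_two, ht.card_support_eq hi (j := m - 1) (by omega), h2]
  rcases Nat.lt_or_ge m 6 with hm6 | hm6
  · by_cases hX : Fintype.card {x // t (m - 1) x = x} ≤ 2
    · by_cases hQ : (t (m - 1)).cycleFactorsFinset.card ≤ 2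
      · exact Or.inl (ht.eq_of_card_le_two hm hX hQ h3 (by omega))
      · right; right
        have hs : (t (m - 1)).support.card = 6 := by omega
        have hsum : (t (m - 1)).cycleType.sum = 6 := by rw [Perm.sum_cycleType, hs]
        have hcard : (t (m - 1)).cycleType.card = 3 := by
          rw [Perm.cycleType_def, Multiset.card_map]
          change (t (m - 1)).cycleFactorsFinset.card = 3
          omega
        have hsq : t (m - 1) ^ 2 = 1 := by
          rw [← orderOf_dvd_iff_pow_eq_one, ← Perm.lcm_cycleType, Multiset.lcm_dvd]
          intro b hb
          obtain ⟨s, hs⟩ := Multiset.exists_cons_of_mem hb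
          have h4 := Multiset.card_nsmul_le_sum (s := s) (a := 2) fun x hx =>
            Perm.two_le_of_mem_cycleType (σ := t (m - 1)) (by rw [hs]; exact Multiset.mem_cons_of_mem hx)
          rw [hs, Multiset.sum_cons] at hsum
          rw [hs, Multiset.card_cons] at hcard
          rw [show Multiset.card s = 2 by omega, smul_eq_mul] at h4
          have h5 := Perm.two_le_of_mem_cycleType hb
          rw [show b = 2 by omega]
        refine ⟨by omega, by omega, fun i hi => ⟨ht.pow_eq_one (i := m - 1) (by omega) hi hsq, fun x => ?_⟩⟩
        have h4 := ht.card_support_eq hi (j := m - 1) (by omega)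
        have h5 : (t i).support = Finset.univ := Finset.eq_univ_of_card _ (by omega)
        rw [← Perm.mem_support, h5]
        exact Finset.mem_univ x
    · left
      have hs : (t (m - 1)).support.card = 3 := by omega
      have hX3 : Fintype.card {x // t (m - 1) x = x} = 3 := by omega
      have hQ : Fintype.card (t (m - 1)).cycleFactorsFinset ≤ 1 := by
        rw [Fintype.card_coe]
        omega
      have := Fintype.card_le_one_iff_subsingleton.1 hQ
      have hcube : t (m - 1) ^ 3 = 1 := by
        have := (card_support_eq_three_iff.1 hs).orderOf
        rw [← this, pow_orderOf_eq_one]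
      have hc : ∀ i, i + 3 ≤ m → fixHom _ (Braid.centralTuple m t i) ^ 3 = 1 := by
        intro i hi
        rw [← map_pow]
        have : Braid.centralTuple m t i ^ 3 = 1 := Subtype.ext (by
          rw [Subgroup.coe_pow, ht.centralTuple_val hi,
            ht.pow_eq_one (i := m - 1) (j := i) (by omega) (by omega) hcube]
          rfl)
        rw [this, map_one]
      have hf := (hb.map (fixHom _)).eq_of_commute (i := 0) (by omega)
        (perm_commute_of_pow_three hX3 (hc 0 (by omega)) (hc 1 (by omega)))
      exact ht.eq_of_cycHom_eq_one hm hf.symm (Subsingleton.elim _ _) (Subsingleton.elim _ _)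
  · left
    have key : ∀ {β : Type u} [Fintype β] [DecidableEq β] {s : ℕ → Perm β}, IsBraid (m - 2) s →
        Fintype.card β ≤ m - 2 → ∀ i < m - 2, s i = s 0 := by
      intro β _ _ s hs hβ i hi
      refine hs.eq_zero ?_ hi
      by_contra h01
      rcases ih (m - 2) (by omega) (by omega) hs (by omega) with h | h | ⟨h, h', -⟩
      · exact h01 h
      · obtain ⟨e, he, -⟩ := hs.exists_swap_path (by omega) h01 h
        have := Fintype.card_le_of_injective (fun i : Fin (m - 2 + 1) => e i) fun i j hij =>
          Fin.ext (he i (by omega) j (by omega) hij)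
        rw [Fintype.card_fin] at this
        omega
      · omega
    refine ht.eq_of_centralTuple_eq hm6 (key (hb.map (fixHom _)) (by omega)) (key (hb.map (cycHom _)) ?_)
    rw [Fintype.card_coe]
    omega

end classify

end Braid

namespace Braid
open Equiv

variable {m : ℕ}

theorem exists_conj_perm {ρ : Br m →* Br m} (hm : 3 ≤ m) (hρ : Function.Injective ρ) :
    ∃ c, ∀ i < m, perm m (c * ρ (sg m i) * c⁻¹) = swap i (i + 1) := by
  rcases hm.eq_or_lt with rfl | hm
  · exact exists_conj_perm_three hρ
  have hb := (isBraid_sg m).map ((permF m).comp ρ)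
  have hne := perm_map_ne hm hρ
  rcases hb.perm_classify m hm (by simp) with h | h | ⟨rfl, -, h⟩
  · exact absurd h hne
  · obtain ⟨e, he, h⟩ := hb.exists_swap_path hm hne h
    exact exists_conj_of_permF_swap he h
  · exfalso
    let f : Br 3 →* Br 5 := ρ.comp (lift (sg 5) ((isBraid_sg 5).mono (by omega)))
    have hf : ∀ i < 3, f (sg 3 i) = ρ (sg 5 i) := fun i hi => by
      rw [MonoidHom.comp_apply, lift_sg _ hi]
    have hsq : ∀ i < 5, ∀ x, perm 5 (ρ (sg 5 i)) (perm 5 (ρ (sg 5 i)) x) = x := by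
      intro i hi x
      have h1 : permF 5 (ρ (sg 5 i) ^ 2) = 1 := by
        rw [map_pow]
        exact (h i hi).1
      rw [permF_eq_one_iff, map_pow, pow_two] at h1
      rw [← Perm.mul_apply, h1, Perm.one_apply]
    have hfix : ∀ i < 5, ∀ x ≤ 5, perm 5 (ρ (sg 5 i)) x ≠ x := by
      intro i hi x hx hxx
      exact (h i hi).2 ⟨x, by omega⟩ (Fin.ext hxx)
    have h02 := perm_eq_of_fixed_point_free f (by rw [hf 0 (by omega)]; exact hsq 0 (by omega))
      (by rw [hf 2 (by omega)]; exact hsq 2 (by omega)) (by rw [hf 0 (by omega)]; exact hfix 0 (by omega))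
      (by rw [hf 2 (by omega)]; exact hfix 2 (by omega))
    rw [hf 0 (by omega), hf 2 (by omega)] at h02
    have h02' := permF_eq_of_perm h02
    refine hne (hb.zero_eq_one (i := 2) (by omega) (hb.eq_of_commute (i := 2) (by omega) ?_))
    have h03 := hb.comm 0 3 (by omega) (by omega)
    rw [MonoidHom.comp_apply, h02'] at h03
    exact h03

theorem std_of_injective {ρ : Br m →* Br m} (hm : 3 ≤ m) (hρ : Function.Injective ρ) : Std ρ := by
  obtain ⟨c, hc⟩ := exists_conj_perm hm hρ
  exact Std.of_conj (c := c) (std_of_three (fun ρ h => std_three h) m hm _ hc)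

theorem tl_zero_eq_prod (m : ℕ) : tl m 0 = (List.ofFn fun i : Fin m => sg m i).prod := by
  rw [tl, Nat.sub_zero, ← List.range_eq_range', List.ofFn_eq_map, ← List.map_coe_finRange_eq_range, List.map_map]
  rfl

theorem apply_eq_of_sg {ρ φ : Br m →* Br m} {c : Br m} {t : ℤ} {ℓ : Br m → ℤ} (hℓ : ∀ a b, ℓ (a * b) = ℓ a + ℓ b)
    (hℓσ : ∀ i < m, ℓ (sg m i) = 1) (h : ∀ i < m, ρ (sg m i) = c * φ (sg m i) * c⁻¹ * Z m ^ t) (g : Br m) :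
    ρ g = c * φ g * c⁻¹ * Z m ^ (t * ℓ g) := by
  let f : Br m →* Br m := MonoidHom.mk' (fun g => c * φ g * c⁻¹ * Z m ^ (t * ℓ g)) fun a b => by
    have h1 := Z_zpow_commute (t * ℓ a) (c * φ b * c⁻¹)
    rw [hℓ, mul_add, zpow_add, map_mul φ, mul_assoc (c * φ a * c⁻¹), ← mul_assoc (Z m ^ (t * ℓ a)), h1]
    simp only [mul_assoc, inv_mul_cancel_left]
  refine hom_congr (g := f) (fun i hi => ?_) g
  change _ = c * φ (sg m i) * c⁻¹ * Z m ^ (t * ℓ (sg m i))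
  rw [hℓσ i hi, mul_one, h i hi]

end Braid

/-- For `n ≥ 4`, any injective endomorphism `ρ` of `B_n` has the form
`ρ g = c * χ^e g * c⁻¹ * z^(t * ℓ g)` for some `c ∈ B_n`, `e ∈ {0,1}`, and `t ∈ ℤ`,
where `χ` is the inversion automorphism and `ℓ` the length homomorphism. -/
theorem braidGroup_inj_endo_geometric (n : ℕ) (hn : 4 ≤ n)
    (χ : MulAut (BraidGroup n))
    (hχ : ∀ i : Fin (n - 1), χ (braidσ n i) = (braidσ n i)⁻¹)
    (ℓ : BraidGroup n → ℤ) (hℓ : ∀ a b, ℓ (a * b) = ℓ a + ℓ b)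
    (hℓσ : ∀ i : Fin (n - 1), ℓ (braidσ n i) = 1)
    (ρ : BraidGroup n →* BraidGroup n) (hρ : Function.Injective ρ) :
    ∃ (c : BraidGroup n) (e : ℕ) (t : ℤ), (e = 0 ∨ e = 1) ∧
      ∀ g : BraidGroup n, ρ g = c * (χ ^ e) g * c⁻¹ * fullTwist n ^ (t * ℓ g) := by
  have hσ : ∀ i : Fin (n - 1), Braid.sg (n - 1) i = braidσ n i := fun i => Braid.sg_of_lt i.2
  have hz : fullTwist n = Braid.Z (n - 1) := by
    rw [fullTwist, braidδ, Braid.Z, Braid.tl_zero_eq_prod, Nat.sub_add_cancel (by omega)]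
    simp only [hσ]
  have hℓσ' : ∀ i < n - 1, ℓ (Braid.sg (n - 1) i) = 1 := fun i hi => by
    rw [hσ ⟨i, hi⟩, hℓσ]
  rw [hz]
  obtain ⟨c, t, h | h⟩ := Braid.std_of_injective (by omega) hρ
  · exact ⟨c, 0, t, Or.inl rfl, Braid.apply_eq_of_sg (φ := MonoidHom.id _) hℓ hℓσ' h⟩
  · refine ⟨c, 1, t, Or.inr rfl, ?_⟩
    rw [pow_one]
    refine Braid.apply_eq_of_sg (φ := χ.toMonoidHom) hℓ hℓσ' fun i hi => ?_
    rw [h i hi]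
    congr 3
    exact ((congrArg χ (hσ ⟨i, hi⟩)).trans ((hχ ⟨i, hi⟩).trans (congrArg _ (hσ ⟨i, hi⟩).symm))).symm
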